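/- arXiv:2511.00757 — 3 statements merged into one kernel-verified Lean document; each statement's English description precedes it below -/
import Mathlib

section
/- Let G = (V,E) be a ℤ^d-periodic graph and Q : V → ℝ a periodic potential. Then the Lebesgue measure of the spectrum of H_{μQ} tends to 0 as μ → ∞ if and only if G contains no Q-flat path having infinitely many vertices; equivalently, if and only if there is no value a in the range of Q such that the set Q^{-1}{a} contains an infinite connected induced subgraph. -/
open MeasureTheory Filter

lemma exists_approx_id (K : Set ℝ) (hK : IsCompact K) (δ : ℝ) (hδ : volume K < ENNReal.ofReal δ) :
    ∃ g : ℝ → ℝ, Continuous g ∧ (g '' K).Finite ∧ ∀ x, |g x - x| ≤ δ := by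
  obtain ⟨U, hKU, hU, hUδ⟩ := K.exists_isOpen_lt_of_lt _ hδ
  have hδ0 : 0 < δ := by
    by_contra h
    rw [ENNReal.ofReal_of_nonpos (not_lt.mp h)] at hδ
    simp at hδ
  let f : ℝ → ℝ := Set.indicator U (fun _ => (1:ℝ))
  have hf : ∀ a b, IntervalIntegrable f volume a b := by
    intro a b
    refine (intervalIntegrable_const (c := (1:ℝ))).mono_fun ((measurable_const.indicator hU.measurableSet).aestronglyMeasurable) ?_
    refine Filter.Eventually.of_forall fun x => ?_
    by_cases hx : x ∈ U <;> simp [f, hx]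
  have hInt : Integrable f := by
    rw [integrable_indicator_iff hU.measurableSet]
    exact integrableOn_const (hUδ.trans (by simp)).ne
  let g : ℝ → ℝ := fun x => x - ∫ y in (0:ℝ)..x, f y
  have hgd : ∀ x ∈ U, HasDerivAt g 0 x := by
    intro x hx
    have h1 : f =ᶠ[nhds x] fun _ => (1:ℝ) := by
      filter_upwards [hU.mem_nhds hx] with y hy
      simp [f, hy]
    have h2 : ContinuousAt f x := continuousAt_const.congr h1.symm
    have h3 := intervalIntegral.integral_hasDerivAt_right (hf 0 x)
      ((measurable_const.indicator hU.measurableSet).stronglyMeasurable.stronglyMeasurableAtFilter) h2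
    have h4 := (hasDerivAt_id x).sub h3
    have : f x = 1 := h1.self_of_nhds
    rw [this, sub_self] at h4
    exact h4
  have hgc : Continuous g := by
    exact continuous_id.sub (intervalIntegral.continuous_primitive hf 0)
  refine ⟨g, hgc, ?_, ?_⟩
  · have hlc : IsLocallyConstant (fun x : K => g x) := by
      rw [IsLocallyConstant.iff_eventually_eq]
      rintro ⟨x, hx⟩
      obtain ⟨ε, hε, hb⟩ := Metric.isOpen_iff.mp hU x (hKU hx)
      have : ∀ y ∈ Metric.ball x ε, g y = g x := by
        intro y hy
        exact (convex_ball x ε).is_const_of_fderivWithin_eq_zero (𝕜 := ℝ)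
          (fun z hz => (hgd z (hb hz)).differentiableAt.differentiableWithinAt)
          (fun z hz => by
            rw [fderivWithin_of_isOpen Metric.isOpen_ball hz]
            have := (hgd z (hb hz)).hasFDerivAt.fderiv
            rw [this]; ext; simp) hy (Metric.mem_ball_self hε)
      have hn : Metric.ball (⟨x, hx⟩ : K) ε ∈ nhds (⟨x, hx⟩ : K) := Metric.ball_mem_nhds _ hε
      filter_upwards [hn] with y hy
      exact this y hy
    have : CompactSpace K := isCompact_iff_compactSpace.mp hK
    have := hlc.range_finite
    convert this using 1
    ext; simp
  · intro x
    have : g x - x = - ∫ y in (0:ℝ)..x, f y := by simp [g]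
    rw [this, abs_neg]
    have h1 : |∫ y in (0:ℝ)..x, f y| ≤ ∫ y, ‖f y‖ := by
      rw [← Real.norm_eq_abs]
      refine (intervalIntegral.norm_integral_le_integral_norm_uIoc).trans ?_
      exact setIntegral_le_integral hInt.norm (Eventually.of_forall fun _ => norm_nonneg _)
    refine h1.trans ?_
    have h2 : ∫ y, ‖f y‖ = (volume U).toReal := by
      have : (fun y => ‖f y‖) = Set.indicator U (fun _ => (1:ℝ)) := by
        ext y; by_cases hy : y ∈ U <;> simp [f, hy]
      rw [this, integral_indicator hU.measurableSet]
      simp [Measure.real]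
    rw [h2]
    exact ENNReal.toReal_le_of_le_ofReal hδ0.le hUδ.le

open scoped Matrix.Norms.L2Operator in
lemma cfc_family_continuous {R : Type*} [Fintype R] [DecidableEq R] (M : ℝ → Matrix R R ℂ)
    (hM : Continuous M) (hh : ∀ t, (M t).IsHermitian) (K : Set ℝ) (hK : IsCompact K)
    (hs : ∀ t i, (hh t).eigenvalues i ∈ K) (g : ℝ → ℝ) (hg : Continuous g) :
    Continuous fun t => cfc g (M t) := by
  refine Continuous.cfc' hK g hM ?_ hg.continuousOn (fun t => (hh t))
  intro t x hx
  rw [(hh t).spectrum_real_eq_range_eigenvalues] at hx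
  obtain ⟨i, rfl⟩ := hx
  exact hs t i

lemma det_family_bound {R : Type*} [Fintype R] [DecidableEq R] (M : ℝ → Matrix R R ℂ)
    (hM : Continuous M) (hh : ∀ t, (M t).IsHermitian) (K : Set ℝ) (hK : IsCompact K)
    (hs : ∀ t i, (hh t).eigenvalues i ∈ K) (δ : ℝ) (hδ : volume K < ENNReal.ofReal δ)
    (z : ℂ) (hz : 1 ≤ |z.im|) (s t : ℝ) :
    ‖(M t).charpoly.eval z - (M s).charpoly.eval z‖ ≤
      (Real.exp (Fintype.card R * δ) - 1) * (‖(M t).charpoly.eval z‖ + ‖(M s).charpoly.eval z‖) := by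
  obtain ⟨g, hg, hfin, hgδ⟩ := exists_approx_id K hK δ hδ
  let D : ℝ → ℂ := fun t => (cfc g (M t)).charpoly.eval z
  have hD : ∀ t, D t = ∏ i, (z - (g ((hh t).eigenvalues i) : ℂ)) := by
    intro t
    simp [D, (hh t).charpoly_cfc_eq, Polynomial.eval_prod]
  have hDc : Continuous D := by
    have := cfc_family_continuous M hM hh K hK hs g hg
    simp only [D, Matrix.eval_charpoly]
    fun_prop
  have hDfin : (Set.range D).Finite := by
    have h1 : (Set.pi Set.univ (fun _ : R => g '' K)).Finite := Set.Finite.pi fun _ => hfin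
    refine (h1.image (fun v : R → ℝ => ∏ i, (z - (v i : ℂ)))).subset ?_
    rintro _ ⟨t, rfl⟩
    exact ⟨fun i => g ((hh t).eigenvalues i), fun i _ => ⟨_, hs t i, rfl⟩, (hD t).symm⟩
  have hconst : ∀ s t, D s = D t := by
    intro s t
    have : (Set.range D).Subsingleton := by
      by_contra hn
      exact (isPreconnected_range hDc).infinite_of_nontrivial (Set.not_subsingleton_iff.mp hn) hDfin
    exact this ⟨s, rfl⟩ ⟨t, rfl⟩
  have key : ∀ t, ‖D t - (M t).charpoly.eval z‖ ≤
      (Real.exp (Fintype.card R * δ) - 1) * ‖(M t).charpoly.eval z‖ := by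
    intro t
    have hc : (M t).charpoly.eval z = ∏ i, (z - ((hh t).eigenvalues i : ℂ)) := by
      simp [(hh t).charpoly_eq, Polynomial.eval_prod]
    have hne : ∀ x : ℝ, 1 ≤ ‖z - x‖ := by
      intro x
      refine hz.trans ?_
      have := Complex.abs_im_le_norm (z - x)
      simpa using this
    have hD2 : D t = (M t).charpoly.eval z *
        ∏ i, (1 + (((hh t).eigenvalues i : ℂ) - g ((hh t).eigenvalues i)) / (z - ((hh t).eigenvalues i : ℂ))) := by
      rw [hD, hc, ← Finset.prod_mul_distrib]
      refine Finset.prod_congr rfl fun i _ => ?_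
      have : z - ((hh t).eigenvalues i : ℂ) ≠ 0 := by
        intro h
        have := hne ((hh t).eigenvalues i)
        rw [h] at this; norm_num at this
      field_simp
      ring
    rw [hD2, ← mul_sub_one, norm_mul, mul_comm]
    gcongr
    refine (Finset.norm_prod_one_add_sub_one_le _ _).trans ?_
    gcongr
    calc _ ≤ ∑ i : R, δ := by
          refine Finset.sum_le_sum fun i _ => ?_
          rw [norm_div]
          refine (div_le_self (norm_nonneg _) (hne _)).trans ?_
          have := hgδ ((hh t).eigenvalues i)
          rw [abs_sub_comm] at this
          rw [← Complex.ofReal_sub, Complex.norm_real]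
          exact this
      _ = _ := by simp
  have h1 := key t
  have h2 := key s
  rw [hconst s t] at h2
  calc _ = ‖(D t - (M s).charpoly.eval z) - (D t - (M t).charpoly.eval z)‖ := by congr 1; ring
    _ ≤ _ := norm_sub_le _ _
    _ ≤ _ := by linarith

lemma trace_pow_eq_of_charpoly_eq {R : Type*} [Fintype R] [DecidableEq R] (A B : Matrix R R ℂ)
    (hA : A.IsHermitian) (hB : B.IsHermitian) (h : A.charpoly = B.charpoly) (k : ℕ) :
    (A ^ k).trace = (B ^ k).trace := by
  have he := (hA.eigenvalues_eq_eigenvalues_iff hB).mpr h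
  have h1 : (A ^ k).charpoly = (B ^ k).charpoly := by
    rw [← cfc_pow_id (R := ℝ) A k hA.isSelfAdjoint, ← cfc_pow_id (R := ℝ) B k hB.isSelfAdjoint, hA.charpoly_cfc_eq, hB.charpoly_cfc_eq, he]
  rw [Matrix.trace_eq_sum_roots_charpoly, Matrix.trace_eq_sum_roots_charpoly, h1]

/-- Floquet matrix in the direction of the coordinate `i`. -/
noncomputable def floq {d : ℕ} {R : Type*} (N : R → R → Finset (Fin d → ℤ)) (i : Fin d) (t : ℝ) :
    Matrix R R ℂ :=
  Matrix.of fun u v => ∑ n ∈ N u v, Complex.exp (((t * (n i : ℝ) : ℝ) : ℂ) * Complex.I)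

noncomputable def blk {R : Type*} (q : R → ℝ) (a : ℝ) (A : Matrix R R ℂ) :
    Matrix {u // q u = a} {u // q u = a} ℂ := A.toSquareBlockProp (fun u => q u = a)

noncomputable def fullM {R : Type*} [DecidableEq R] (q : R → ℝ) (μ : ℝ) (A : Matrix R R ℂ) :
    Matrix R R ℂ := Matrix.diagonal (fun u => ((μ * q u : ℝ) : ℂ)) + A

lemma floq_herm {d : ℕ} {R : Type*} (N : R → R → Finset (Fin d → ℤ)) (i : Fin d) (t : ℝ)
    (hN : ∀ u v n, n ∈ N u v ↔ -n ∈ N v u) : (floq N i t).IsHermitian := by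
  ext u v
  simp only [Matrix.conjTranspose_apply, floq, Matrix.of_apply, star_sum]
  refine Finset.sum_bij (fun n _ => -n) ?_ ?_ ?_ ?_
  · intro n hn; exact (hN _ _ _).mp hn
  · intro a _ b _ h; exact neg_injective h
  · intro n hn; exact ⟨-n, (hN _ _ _).mp hn, by simp⟩
  · intro n hn
    rw [Complex.star_def, ← Complex.exp_conj]
    congr 1
    simp

lemma floq_cont {d : ℕ} {R : Type*} (N : R → R → Finset (Fin d → ℤ)) (i : Fin d) :
    Continuous (floq N i) := by
  unfold floq
  refine continuous_matrix fun u v => ?_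
  simp only [Matrix.of_apply]
  fun_prop

lemma fullM_herm {R : Type*} [DecidableEq R] (q : R → ℝ) (μ : ℝ) (A : Matrix R R ℂ)
    (hA : A.IsHermitian) : (fullM q μ A).IsHermitian := by
  refine Matrix.IsHermitian.add ?_ hA
  rw [Matrix.isHermitian_diagonal_iff]
  intro i
  simp [isSelfAdjoint_iff]

lemma tendsto_det {R : Type*} [Fintype R] [DecidableEq R] (q : R → ℝ) (a : ℝ)
    (A : Matrix R R ℂ) (z : ℂ) :
    Tendsto (fun μ : ℝ => (∏ u, (if q u = a then (1 : ℂ) else ((μ⁻¹ : ℝ) : ℂ))) *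
      (fullM q μ A).charpoly.eval (z + ((μ * a : ℝ) : ℂ))) atTop
      (nhds ((blk q a A).charpoly.eval z * ∏ u : {u // ¬ q u = a}, ((a - q u : ℝ) : ℂ))) := by
  classical
  let L : Matrix R R ℂ := Matrix.of fun u v =>
    if q u = a then (if u = v then z else 0) - A u v else (if u = v then ((a - q u : ℝ) : ℂ) else 0)
  have hL : L.det = (blk q a A).charpoly.eval z * ∏ u : {u // ¬ q u = a}, ((a - q u : ℝ) : ℂ) := by
    rw [Matrix.twoBlockTriangular_det L (fun u => q u = a)]
    · congr 1
      · rw [Matrix.eval_charpoly]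
        congr 1
        ext u v
        simp [Matrix.toSquareBlockProp, L, blk, u.2, Matrix.diagonal_apply, Subtype.ext_iff]
      · rw [← Matrix.det_diagonal]
        congr 1
        ext u v
        simp [Matrix.toSquareBlockProp, L, u.2, Matrix.diagonal_apply, Subtype.ext_iff]
    · intro u hu v hv
      have : u ≠ v := by rintro rfl; exact hu hv
      simp [L, hu, this]
  rw [← hL]
  simp_rw [Matrix.eval_charpoly, ← Matrix.det_mul_column]
  refine (Continuous.matrix_det continuous_id).tendsto L |>.comp ?_
  refine tendsto_pi_nhds.mpr fun u => tendsto_pi_nhds.mpr fun v => ?_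
  by_cases hu : q u = a
  · have : ∀ μ : ℝ, (L u v) = (Matrix.of fun i j ↦ (if q i = a then (1:ℂ) else ((μ⁻¹ : ℝ) : ℂ)) * ((Matrix.scalar R) (z + ((μ * a : ℝ) : ℂ)) - fullM q μ A) i j) u v := by
      intro μ
      by_cases huv : u = v
      · subst huv
        simp [L, hu, fullM]
        ring
      · simp [L, hu, fullM, huv]
    refine tendsto_const_nhds.congr this
  · have hinv : Tendsto (fun μ : ℝ => ((μ⁻¹ : ℝ) : ℂ)) atTop (nhds 0) := by
      have := (Complex.continuous_ofReal.tendsto 0).comp tendsto_inv_atTop_zero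
      rw [Complex.ofReal_zero] at this
      exact this
    have h2 : Tendsto (fun μ : ℝ => L u v + ((μ⁻¹ : ℝ) : ℂ) * ((if u = v then z else 0) - A u v)) atTop (nhds (L u v)) := by
      simpa using (tendsto_const_nhds (x := L u v)).add (hinv.mul_const ((if u = v then z else 0) - A u v))
    refine h2.congr' ?_
    filter_upwards [eventually_gt_atTop 0] with μ hμ
    have hμ' : (μ : ℂ) ≠ 0 := by exact_mod_cast hμ.ne'
    by_cases huv : u = v
    · subst huv
      simp [L, hu, fullM]
      field_simp
      ring
    · simp [L, hu, fullM, huv]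

lemma charpoly_const {d : ℕ} {R : Type*} [Fintype R] [DecidableEq R]
    (N : R → R → Finset (Fin d → ℤ)) (i : Fin d)
    (hN : ∀ u v n, n ∈ N u v ↔ -n ∈ N v u) (q : R → ℝ) (a : ℝ) (K : ℝ → Set ℝ)
    (hK : ∀ μ, IsCompact (K μ)) (hvol : Tendsto (fun μ => volume (K μ)) atTop (nhds 0))
    (hev : ∀ μ t x : ℝ, ∀ φ : R → ℂ, φ ≠ 0 → (fullM q μ (floq N i t)).mulVec φ = (x : ℂ) • φ → x ∈ K μ)
    (t : ℝ) : (blk q a (floq N i t)).charpoly = (blk q a (floq N i 0)).charpoly := by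
  have hz : ∀ z : ℂ, z.im = 1 →
      (blk q a (floq N i t)).charpoly.eval z = (blk q a (floq N i 0)).charpoly.eval z := by
    intro z hz
    let σ : ℝ → ℂ := fun μ => (∏ u, (if q u = a then (1 : ℂ) else ((μ⁻¹ : ℝ) : ℂ)))
    let c : ℝ → ℝ → ℂ := fun t μ => σ μ * (fullM q μ (floq N i t)).charpoly.eval (z + ((μ * a : ℝ) : ℂ))
    let P : ℂ := ∏ u : {u // ¬ q u = a}, ((a - q u : ℝ) : ℂ)
    have hP : P ≠ 0 := by
      rw [Finset.prod_ne_zero_iff]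
      intro u _ h
      have h2 : a - q u = 0 := by exact_mod_cast h
      exact u.2 (by linarith)
    let l : ℝ → ℂ := fun t => (blk q a (floq N i t)).charpoly.eval z * P
    have hc : ∀ t, Tendsto (c t) atTop (nhds (l t)) := fun t => tendsto_det q a _ z
    have hb : ∀ δ : ℝ, 0 < δ → ∀ᶠ μ in atTop, ‖c t μ - c 0 μ‖ ≤
        (Real.exp (Fintype.card R * δ) - 1) * (‖c t μ‖ + ‖c 0 μ‖) := by
      intro δ hδ
      have := hvol.eventually (gt_mem_nhds (show (0 : ENNReal) < ENNReal.ofReal δ by simpa using hδ))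
      filter_upwards [this] with μ hμ
      have hh := fun t => fullM_herm q μ (floq N i t) (floq_herm N i t hN)
      have := det_family_bound (fun t => fullM q μ (floq N i t))
        (by
          have := floq_cont N i
          unfold fullM
          fun_prop) hh (K μ) (hK μ) (by
          intro t j
          refine hev μ t _ ((hh t).eigenvectorBasis j) ?_ ?_
          · intro h
            have h1 := (hh t).eigenvectorBasis.orthonormal.ne_zero j
            apply h1
            ext k; exact congrFun h k
          · rw [(hh t).mulVec_eigenvectorBasis j]
            ext k
            simp [Complex.real_smul]) δ hμ (z + ((μ * a : ℝ) : ℂ)) (by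
            rw [Complex.add_im, Complex.ofReal_im, hz]; norm_num) 0 t
      simp only [c, ← mul_sub, norm_mul, ← mul_add]
      calc _ ≤ _ := mul_le_mul_of_nonneg_left this (norm_nonneg (σ μ))
        _ = _ := by ring
    have hl : ∀ δ : ℝ, 0 < δ → ‖l t - l 0‖ ≤
        (Real.exp (Fintype.card R * δ) - 1) * (‖l t‖ + ‖l 0‖) := by
      intro δ hδ
      exact le_of_tendsto_of_tendsto ((hc t).sub (hc 0)).norm
        (((hc t).norm.add (hc 0).norm).const_mul _) (hb δ hδ)
    have hl0 : ‖l t - l 0‖ ≤ 0 := by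
      have h1 : Tendsto (fun δ : ℝ => (Real.exp (Fintype.card R * δ) - 1) * (‖l t‖ + ‖l 0‖))
          (nhdsWithin 0 (Set.Ioi 0)) (nhds 0) := by
        have : Continuous (fun δ : ℝ => (Real.exp (Fintype.card R * δ) - 1) * (‖l t‖ + ‖l 0‖)) := by
          fun_prop
        have := this.tendsto 0
        simp only [mul_zero, Real.exp_zero, sub_self, zero_mul] at this
        exact this.mono_left nhdsWithin_le_nhds
      refine ge_of_tendsto h1 ?_
      filter_upwards [self_mem_nhdsWithin] with δ hδ using hl δ hδ
    have := sub_eq_zero.mp (norm_le_zero_iff.mp hl0)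
    exact mul_right_cancel₀ hP this
  refine Polynomial.eq_of_infinite_eval_eq _ _ ?_
  refine Set.Infinite.mono (s := Set.range (fun x : ℝ => (x : ℂ) + Complex.I)) ?_ ?_
  · rintro _ ⟨x, rfl⟩
    exact hz _ (by simp)
  · refine Set.infinite_range_of_injective ?_
    intro x y h
    simpa using h

section walks
variable {d : ℕ} {J : Type*} [Fintype J] [DecidableEq J] (N : J → J → Finset (Fin d → ℤ)) (i : Fin d)

lemma floq_le (t : ℝ) (u v : J) : ‖floq N i t u v‖ ≤ (N u v).card := by
  simp only [floq, Matrix.of_apply]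
  refine (norm_sum_le _ _).trans ?_
  simp only [Complex.norm_exp_ofReal_mul_I, Finset.sum_const, nsmul_eq_mul, mul_one, le_refl]

/-- counting matrix -/
def cnt : Matrix J J ℝ := Matrix.of fun u v => ((N u v).card : ℝ)

lemma cnt_floq : floq N i 0 = (cnt N).map (fun x : ℝ => (x : ℂ)) := by
  ext u v; simp [floq, cnt]

lemma cnt_pow_floq (k : ℕ) : (floq N i 0) ^ k = ((cnt N) ^ k).map (fun x : ℝ => (x : ℂ)) := by
  rw [cnt_floq]
  exact ((Complex.ofRealHom.mapMatrix (m := J)).map_pow (cnt N) k).symm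

lemma pow_le (t : ℝ) (k : ℕ) (u v : J) : ‖((floq N i t) ^ k) u v‖ ≤ ((cnt N) ^ k) u v := by
  induction k generalizing u v with
  | zero => by_cases h : u = v <;> simp [h]
  | succ k ih =>
    rw [pow_succ, pow_succ, Matrix.mul_apply, Matrix.mul_apply]
    refine (norm_sum_le _ _).trans (Finset.sum_le_sum fun x _ => ?_)
    rw [norm_mul]
    exact mul_le_mul (ih u x) (floq_le N i t x v) (norm_nonneg _) ((norm_nonneg _).trans (ih u x))

lemma walk_step (t : ℝ) (k : ℕ) (u x v : J) (n m : Fin d → ℤ) (hm : m ∈ N x v)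
    (h : ‖((floq N i t) ^ k) u x - Complex.exp (((t * (n i : ℝ) : ℝ) : ℂ) * Complex.I)‖ ≤
      ((cnt N) ^ k) u x - 1) :
    ‖((floq N i t) ^ (k+1)) u v - Complex.exp (((t * ((n + m) i : ℝ) : ℝ) : ℂ) * Complex.I)‖ ≤
      ((cnt N) ^ (k+1)) u v - 1 := by
  set e : (Fin d → ℤ) → ℂ := fun n => Complex.exp (((t * (n i : ℝ) : ℝ) : ℂ) * Complex.I) with he
  have hen : ∀ n, ‖e n‖ = 1 := fun n => Complex.norm_exp_ofReal_mul_I _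
  have hadd : e (n + m) = e n * e m := by
    simp only [he, ← Complex.exp_add]; congr 1
    simp; ring
  have h1 : ‖floq N i t x v - e m‖ ≤ cnt N x v - 1 := by
    simp only [floq, cnt, Matrix.of_apply]
    rw [← Finset.sum_erase_add _ _ hm, add_sub_cancel_right]
    refine (norm_sum_le _ _).trans ?_
    simp only [Complex.norm_exp_ofReal_mul_I, Finset.sum_const, nsmul_eq_mul, mul_one]
    rw [Finset.card_erase_of_mem hm, Nat.cast_sub (Finset.card_pos.mpr ⟨m, hm⟩)]
    simp
  change ‖((floq N i t) ^ k) u x - e n‖ ≤ _ at h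
  change ‖((floq N i t) ^ (k+1)) u v - e (n + m)‖ ≤ _
  rw [pow_succ, pow_succ, Matrix.mul_apply, Matrix.mul_apply,
    ← Finset.sum_erase_add _ _ (Finset.mem_univ x), ← Finset.sum_erase_add _ _ (Finset.mem_univ x),
    add_sub_assoc, add_sub_assoc]
  refine (norm_add_le _ _).trans (add_le_add ?_ ?_)
  · refine (norm_sum_le _ _).trans (Finset.sum_le_sum fun y _ => ?_)
    rw [norm_mul]
    exact mul_le_mul (pow_le N i t k u y) (floq_le N i t y v) (norm_nonneg _)
      ((norm_nonneg _).trans (pow_le N i t k u y))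
  · have : ((floq N i t) ^ k) u x * floq N i t x v - e (n + m) =
        (((floq N i t) ^ k) u x - e n) * floq N i t x v + e n * (floq N i t x v - e m) := by
      rw [hadd]; ring
    rw [this]
    refine (norm_add_le _ _).trans ?_
    rw [norm_mul, norm_mul, hen, one_mul]
    have h3 : ‖floq N i t x v‖ ≤ cnt N x v := floq_le N i t x v
    have h4 : 0 ≤ ((cnt N) ^ k) u x - 1 := (norm_nonneg _).trans h
    nlinarith [mul_le_mul h h3 (norm_nonneg _) h4]

lemma trace_ne (t : ℝ) (k : ℕ) (u : J) (n : Fin d → ℤ) (hcos : Real.cos (t * n i) < 1)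
    (h : ‖((floq N i t) ^ k) u u - Complex.exp (((t * (n i : ℝ) : ℝ) : ℂ) * Complex.I)‖ ≤
      ((cnt N) ^ k) u u - 1) : ((floq N i t) ^ k).trace ≠ ((floq N i 0) ^ k).trace := by
  intro heq
  have := congrArg Complex.re heq
  rw [cnt_pow_floq] at this
  simp only [Matrix.trace, Matrix.diag_apply, Matrix.map_apply, Complex.re_sum, Complex.ofReal_re] at this
  refine (Finset.sum_lt_sum (s := Finset.univ) ?_ ?_).ne this
  · intro v _
    exact (Complex.re_le_norm _).trans (pow_le N i t k v v)
  · refine ⟨u, Finset.mem_univ _, ?_⟩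
    have h2 := (Complex.re_le_norm _).trans h
    rw [Complex.sub_re, Complex.exp_ofReal_mul_I_re] at h2
    linarith
end walks

/-- The `ℓ¹` size of an integer vector. -/
noncomputable def nn {d : ℕ} (n : Fin d → ℤ) : ℝ := ∑ j, |(n j : ℝ)|

lemma nn_add {d : ℕ} (n m : Fin d → ℤ) : nn (n + m) ≤ nn n + nn m := by
  unfold nn
  rw [← Finset.sum_add_distrib]
  refine Finset.sum_le_sum fun j _ => ?_
  simp only [Pi.add_apply, Int.cast_add]
  exact abs_add_le _ _

lemma nn_neg {d : ℕ} (n : Fin d → ℤ) : nn (-n) = nn n := by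
  simp [nn]

lemma summable_exp_int (ε : ℝ) (hε : 0 < ε) : Summable fun k : ℤ => Real.exp (-ε * |(k : ℝ)|) := by
  have h : Summable fun k : ℕ => Real.exp (-ε * k) := by
    have : (fun k : ℕ => Real.exp (-ε * k)) = fun k : ℕ => (Real.exp (-ε)) ^ k := by
      ext k; rw [← Real.exp_nat_mul]; congr 1; ring
    rw [this]
    exact summable_geometric_of_lt_one (Real.exp_pos _).le (by simpa using hε)
  apply Summable.of_nat_of_neg <;> simpa using h

lemma summable_exp_nn (d : ℕ) (ε : ℝ) (hε : 0 < ε) :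
    Summable fun n : Fin d → ℤ => Real.exp (-ε * nn n) := by
  induction d with
  | zero => exact (hasSum_fintype _).summable
  | succ d ih =>
    rw [← (Fin.consEquiv (fun _ : Fin (d+1) => ℤ)).summable_iff]
    have := (summable_exp_int ε hε).mul_of_nonneg ih (fun _ => (Real.exp_pos _).le)
      (fun _ => (Real.exp_pos _).le)
    refine this.congr fun p => ?_
    simp only [Function.comp_apply, nn, Fin.consEquiv, Equiv.coe_fn_mk, Fin.sum_univ_succ,
      Fin.cons_zero, Fin.cons_succ, mul_add, Real.exp_add]

lemma exp_nn_diff {d : ℕ} (ε C : ℝ) (hε : 0 < ε) (n m : Fin d → ℤ) (hm : nn m ≤ C) :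
    |Real.exp (-ε * nn (n + m)) - Real.exp (-ε * nn n)| ≤
      (Real.exp (ε * C) - 1) * Real.exp (-ε * nn n) := by
  have h1 := nn_add n m
  have h2 : nn n ≤ nn (n + m) + nn m := by
    have := nn_add (n + m) (-m)
    rwa [nn_neg, add_neg_cancel_right] at this
  set y := -ε * (nn (n + m) - nn n) with hy
  have hyC : |y| ≤ ε * C := by
    rw [hy, abs_mul, abs_neg, abs_of_pos hε]
    gcongr
    rw [abs_le]; constructor <;> linarith
  have h3 : Real.exp (-ε * nn (n + m)) = Real.exp y * Real.exp (-ε * nn n) := by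
    rw [← Real.exp_add, hy]; congr 1; ring
  rw [h3, ← sub_one_mul, abs_mul, abs_of_pos (Real.exp_pos _)]
  gcongr
  have h4 := (abs_le.mp hyC)
  have h5 : Real.exp y ≤ Real.exp (ε * C) := Real.exp_le_exp.mpr h4.2
  have h6 : Real.exp (-y) ≤ Real.exp (ε * C) := Real.exp_le_exp.mpr (by linarith)
  have h7 : Real.exp y * Real.exp (-y) = 1 := by rw [← Real.exp_add]; simp
  have h8 := Real.exp_pos y
  rw [abs_le]; constructor
  · nlinarith [sq_nonneg (Real.exp y - 1), Real.exp_pos (-y), sq_nonneg (Real.exp (-y) - 1),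
      Real.add_one_le_exp y, Real.add_one_le_exp (-y)]
  · linarith

section weyl
variable {d : ℕ} {V : Type} {R : Type*} [Fintype R]

/-- A vector of `ℓ²` built in coordinates. -/
lemma exists_vec (e : R × (Fin d → ℤ) ≃ V) (ε : ℝ) (hε : 0 < ε) (χ : (Fin d → ℤ) → ℂ)
    (hχ : ∀ n, ‖χ n‖ = 1) (φ : R → ℂ) :
    ∃ ψ : lp (fun _ : V => ℂ) 2,
      (∀ u n, ψ (e (u, n)) = (Real.exp (-ε * nn n) : ℂ) * χ n * φ u) ∧
      ‖ψ‖ ^ 2 = (∑ u, ‖φ u‖ ^ 2) * ∑' n : Fin d → ℤ, Real.exp (-ε * nn n) ^ 2 := by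
  have hS : Summable fun n : Fin d → ℤ => Real.exp (-ε * nn n) ^ 2 := by
    refine (summable_exp_nn d (2 * ε) (by positivity)).congr fun n => ?_
    rw [← Real.exp_nat_mul]; congr 1; push_cast; ring
  let f : V → ℂ := fun v => (Real.exp (-ε * nn (e.symm v).2) : ℂ) * χ (e.symm v).2 * φ (e.symm v).1
  have hf : ∀ p, ‖f (e p)‖ ^ 2 = ‖φ p.1‖ ^ 2 * Real.exp (-ε * nn p.2) ^ 2 := by
    intro p
    simp only [f, Equiv.symm_apply_apply, norm_mul, hχ, mul_one, Complex.norm_real, Real.norm_eq_abs,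
      Real.abs_exp]
    ring
  have hφs : Summable fun u => ‖φ u‖ ^ 2 := (hasSum_fintype _).summable
  have hsum : Summable fun p : R × (Fin d → ℤ) => ‖φ p.1‖ ^ 2 * Real.exp (-ε * nn p.2) ^ 2 :=
    hφs.mul_of_nonneg hS (fun _ => by positivity) (fun _ => by positivity)
  have hmem : Memℓp f 2 := by
    refine memℓp_gen ?_
    rw [← e.summable_iff]
    refine hsum.congr fun p => ?_
    simp [hf]
  refine ⟨⟨f, hmem⟩, ?_, ?_⟩
  · intro u n
    change f _ = _
    simp [f]
  · have h1 := lp.norm_rpow_eq_tsum (p := 2) (by simp) (⟨f, hmem⟩ : lp (fun _ : V => ℂ) 2)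
    simp only [ENNReal.toReal_ofNat, Real.rpow_ofNat] at h1
    rw [h1, ← e.tsum_eq]
    have : ∀ p, ‖(⟨f, hmem⟩ : lp (fun _ : V => ℂ) 2) (e p)‖ ^ 2 = ‖φ p.1‖ ^ 2 * Real.exp (-ε * nn p.2) ^ 2 := hf
    simp_rw [this]
    rw [← hφs.tsum_mul_tsum hS hsum, tsum_fintype]

lemma sum_nbrs (G : SimpleGraph V) [AddAction (Fin d → ℤ) V]
    (hadj : ∀ (n : Fin d → ℤ) (u v : V), G.Adj u v → G.Adj (n +ᵥ u) (n +ᵥ v))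
    (s : R → V) (hbij : Function.Bijective (fun p : R × (Fin d → ℤ) => p.2 +ᵥ s p.1))
    (N : R → R → Finset (Fin d → ℤ)) (hN : ∀ u v n, n ∈ N u v ↔ G.Adj (n +ᵥ s v) (s u))
    (f : V → ℂ) (u : R) (n : Fin d → ℤ) :
    ∑' w : {w : V // G.Adj w (n +ᵥ s u)}, f w = ∑ v, ∑ m ∈ N u v, f ((n + m) +ᵥ s v) := by
  let F : (Σ v : R, {m // m ∈ N u v}) → {w : V // G.Adj w (n +ᵥ s u)} := fun p =>
    ⟨(n + (p.2 : Fin d → ℤ)) +ᵥ s p.1, by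
      rw [add_vadd]; exact hadj _ _ _ ((hN _ _ _).mp p.2.2)⟩
  have hF : Function.Bijective F := by
    constructor
    · rintro ⟨v, m, hm⟩ ⟨v', m', hm'⟩ h
      have h1 : (n + m) +ᵥ s v = (n + m') +ᵥ s v' := congrArg Subtype.val h
      have h2 := hbij.1 (a₁ := (v, n + m)) (a₂ := (v', n + m')) h1
      simp only [Prod.mk.injEq, add_right_inj] at h2
      obtain ⟨rfl, rfl⟩ := h2
      rfl
    · rintro ⟨w, hw⟩
      obtain ⟨⟨v, k⟩, rfl⟩ := hbij.2 w
      have h1 := hadj (-n) _ _ hw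
      simp only [vadd_vadd, neg_add_cancel, zero_vadd] at h1
      refine ⟨⟨v, -n + k, (hN _ _ _).mpr h1⟩, ?_⟩
      simp [F]
  rw [← (Equiv.ofBijective F hF).tsum_eq, tsum_fintype, Fintype.sum_sigma]
  refine Finset.sum_congr rfl fun v _ => ?_
  exact Finset.sum_coe_sort (N u v) (fun m => f ((n + m) +ᵥ s v))

lemma mem_spectrum_of_floquet [DecidableEq R] (G : SimpleGraph V) [AddAction (Fin d → ℤ) V]
    (hadj : ∀ (n : Fin d → ℤ) (u v : V), G.Adj u v → G.Adj (n +ᵥ u) (n +ᵥ v))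
    (s : R → V) (hbij : Function.Bijective (fun p : R × (Fin d → ℤ) => p.2 +ᵥ s p.1))
    (N : R → R → Finset (Fin d → ℤ)) (hN : ∀ u v n, n ∈ N u v ↔ G.Adj (n +ᵥ s v) (s u))
    (Q : V → ℝ) (hQ : ∀ (n : Fin d → ℤ) (v : V), Q (n +ᵥ v) = Q v) (μ : ℝ)
    (H : lp (fun _ : V => ℂ) 2 →L[ℂ] lp (fun _ : V => ℂ) 2)
    (hH : ∀ (ψ : lp (fun _ : V => ℂ) 2) (v : V),
      H ψ v = ((μ * Q v : ℝ) : ℂ) * ψ v + ∑' u : {u : V // G.Adj u v}, ψ (u : V))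
    (i : Fin d) (t x : ℝ) (φ : R → ℂ) (hφ : φ ≠ 0)
    (heig : (fullM (fun u => Q (s u)) μ (floq N i t)).mulVec φ = (x : ℂ) • φ) :
    (x : ℂ) ∈ spectrum ℂ H := by
  by_contra hx
  rw [spectrum.notMem_iff] at hx
  obtain ⟨T, hT⟩ := hx
  -- lower bound
  have hlow : ∀ ψ, ‖ψ‖ ≤ ‖(↑T⁻¹ : lp (fun _ : V => ℂ) 2 →L[ℂ] lp (fun _ : V => ℂ) 2)‖ *
      ‖(x : ℂ) • ψ - H ψ‖ := by
    intro ψ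
    have h1 : (↑T⁻¹ : lp (fun _ : V => ℂ) 2 →L[ℂ] lp (fun _ : V => ℂ) 2) ((x : ℂ) • ψ - H ψ) = ψ := by
      have h2 : (↑T⁻¹ * ↑T : lp (fun _ : V => ℂ) 2 →L[ℂ] lp (fun _ : V => ℂ) 2) ψ = ψ := by simp
      rw [hT] at h2
      exact h2
    calc ‖ψ‖ = ‖(↑T⁻¹ : lp (fun _ : V => ℂ) 2 →L[ℂ] lp (fun _ : V => ℂ) 2) ((x : ℂ) • ψ - H ψ)‖ := by rw [h1]
      _ ≤ _ := ContinuousLinearMap.le_opNorm _ _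
  set C₀ := ‖(↑T⁻¹ : lp (fun _ : V => ℂ) 2 →L[ℂ] lp (fun _ : V => ℂ) 2)‖ with hC₀
  have hC₀n : 0 ≤ C₀ := norm_nonneg _
  let e : R × (Fin d → ℤ) ≃ V := Equiv.ofBijective _ hbij
  have he : ∀ u n, e (u, n) = n +ᵥ s u := fun u n => rfl
  let χ : (Fin d → ℤ) → ℂ := fun n => Complex.exp (((t * (n i : ℝ) : ℝ) : ℂ) * Complex.I)
  have hχ : ∀ n, ‖χ n‖ = 1 := fun n => Complex.norm_exp_ofReal_mul_I _
  have hχa : ∀ n m, χ (n + m) = χ n * χ m := by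
    intro n m
    simp only [χ, ← Complex.exp_add]; congr 1
    simp; ring
  let C : ℝ := ∑ u, ∑ v, ∑ m ∈ N u v, nn m
  have hnn : ∀ m : Fin d → ℤ, 0 ≤ nn m := fun m => Finset.sum_nonneg fun j _ => abs_nonneg _
  have hC : ∀ u v, ∀ m ∈ N u v, nn m ≤ C := by
    intro u v m hm
    calc nn m ≤ ∑ m ∈ N u v, nn m := Finset.single_le_sum (fun m _ => hnn m) hm
      _ ≤ ∑ v, ∑ m ∈ N u v, nn m :=
        Finset.single_le_sum (f := fun v => ∑ m ∈ N u v, nn m)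
          (fun v _ => Finset.sum_nonneg fun m _ => hnn m) (Finset.mem_univ v)
      _ ≤ C := Finset.single_le_sum (f := fun u => ∑ v, ∑ m ∈ N u v, nn m)
          (fun u _ => Finset.sum_nonneg fun v _ => Finset.sum_nonneg fun m _ => hnn m) (Finset.mem_univ u)
  let B : ℝ := ∑ u, ∑ v, ∑ _m ∈ N u v, ‖φ v‖
  have hB0 : 0 ≤ B := by positivity
  have hB : ∀ u, ∑ v, ∑ _m ∈ N u v, ‖φ v‖ ≤ B := fun u =>
    Finset.single_le_sum (f := fun u => ∑ v, ∑ _m ∈ N u v, ‖φ v‖)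
      (fun u _ => by positivity) (Finset.mem_univ u)
  let Φ : ℝ := ∑ u, ‖φ u‖ ^ 2
  have hΦ : 0 < Φ := by
    obtain ⟨u, hu⟩ := Function.ne_iff.mp hφ
    have hu' : φ u ≠ 0 := hu
    exact Finset.sum_pos' (fun _ _ => by positivity) ⟨u, Finset.mem_univ _, by positivity⟩
  have heig' : ∀ u, ((μ * Q (s u) : ℝ) : ℂ) * φ u + ∑ v, ∑ m ∈ N u v, χ m * φ v = x * φ u := by
    intro u
    have := congrFun heig u
    simp only [fullM, Matrix.add_mulVec, Matrix.mulVec_diagonal, Pi.add_apply, Pi.smul_apply, smul_eq_mul] at this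
    rw [← this]
    congr 1
    simp only [Matrix.mulVec, dotProduct, floq, Matrix.of_apply, Finset.sum_mul]
    rfl
  have main : ∀ ε : ℝ, 0 < ε →
      Φ ≤ (C₀ * ((Real.exp (ε * C) - 1) * B)) ^ 2 * Fintype.card R := by
    intro ε hε
    have hC0 : 0 ≤ C := by
      exact Finset.sum_nonneg fun u _ => Finset.sum_nonneg fun v _ => Finset.sum_nonneg fun m _ => hnn m
    have hκ : 0 ≤ Real.exp (ε * C) - 1 := by
      have := Real.one_le_exp (show 0 ≤ ε * C by positivity)
      linarith
    obtain ⟨ψ, hψ, hψn⟩ := exists_vec e ε hε χ hχ φ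
    obtain ⟨W, hW, hWn⟩ := exists_vec e ε hε χ hχ (fun _ => (1 : ℂ))
    have hS : Summable fun n : Fin d → ℤ => Real.exp (-ε * nn n) ^ 2 := by
      refine (summable_exp_nn d (2 * ε) (by positivity)).congr fun n => ?_
      rw [← Real.exp_nat_mul]; congr 1; push_cast; ring
    have hSpos : 0 < ∑' n : Fin d → ℤ, Real.exp (-ε * nn n) ^ 2 :=
      hS.tsum_pos (fun _ => by positivity) 0 (by positivity)
    have hbd : ‖(x : ℂ) • ψ - H ψ‖ ≤ ((Real.exp (ε * C) - 1) * B) * ‖W‖ := by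
      have h1 : ‖(x : ℂ) • ψ - H ψ‖ ≤ ‖((((Real.exp (ε * C) - 1) * B : ℝ)) : ℂ) • W‖ := by
        refine lp.norm_mono (by simp) fun v => ?_
        obtain ⟨⟨u, n⟩, rfl⟩ := e.surjective v
        have hW1 : ‖W (e (u, n))‖ = Real.exp (-ε * nn n) := by
          rw [hW]; simp [hχ, -Complex.ofReal_exp, Complex.norm_real]
        simp only [lp.coeFn_smul, lp.coeFn_sub, Pi.sub_apply, Pi.smul_apply, smul_eq_mul, norm_mul, hW1]
        rw [Complex.norm_real, Real.norm_of_nonneg (mul_nonneg hκ hB0)]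
        rw [hH, hψ]
        have h2 : ∑' w : {w : V // G.Adj w (e (u, n))}, ψ (w : V) =
            ∑ v, ∑ m ∈ N u v, (Real.exp (-ε * nn (n + m)) : ℂ) * χ (n + m) * φ v := by
          rw [show e (u, n) = n +ᵥ s u from rfl, sum_nbrs G hadj s hbij N hN (fun w => ψ w) u n]
          refine Finset.sum_congr rfl fun v _ => Finset.sum_congr rfl fun m _ => ?_
          exact hψ v (n + m)
        rw [h2]
        have h3 : (x : ℂ) * ((Real.exp (-ε * nn n) : ℂ) * χ n * φ u) -
            (((μ * Q (e (u, n)) : ℝ) : ℂ) * ((Real.exp (-ε * nn n) : ℂ) * χ n * φ u) +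
              ∑ v, ∑ m ∈ N u v, (Real.exp (-ε * nn (n + m)) : ℂ) * χ (n + m) * φ v) =
            ∑ v, ∑ m ∈ N u v, ((Real.exp (-ε * nn n) - Real.exp (-ε * nn (n + m)) : ℝ) : ℂ) * χ (n + m) * φ v := by
          have h4 : (x : ℂ) * ((Real.exp (-ε * nn n) : ℂ) * χ n * φ u) =
            ((Real.exp (-ε * nn n) : ℂ) * χ n) * (x * φ u) := by ring
          rw [h4, ← heig' u, he, hQ]
          have h5 : ∑ v, ∑ m ∈ N u v, ((Real.exp (-ε * nn n) - Real.exp (-ε * nn (n + m)) : ℝ) : ℂ) * χ (n + m) * φ v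
            = (Real.exp (-ε * nn n) : ℂ) * χ n * (∑ v, ∑ m ∈ N u v, χ m * φ v) -
              ∑ v, ∑ m ∈ N u v, (Real.exp (-ε * nn (n + m)) : ℂ) * χ (n + m) * φ v := by
            rw [Finset.mul_sum, ← Finset.sum_sub_distrib]
            refine Finset.sum_congr rfl fun v _ => ?_
            rw [Finset.mul_sum, ← Finset.sum_sub_distrib]
            refine Finset.sum_congr rfl fun m _ => ?_
            rw [hχa, Complex.ofReal_sub]; ring
          rw [h5]; ring
        rw [h3]
        calc _ ≤ ∑ v, ∑ m ∈ N u v, (Real.exp (ε * C) - 1) * Real.exp (-ε * nn n) * ‖φ v‖ := by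
              refine (norm_sum_le _ _).trans (Finset.sum_le_sum fun v _ => ?_)
              refine (norm_sum_le _ _).trans (Finset.sum_le_sum fun m hm => ?_)
              rw [norm_mul, norm_mul, hχ, mul_one, Complex.norm_real, Real.norm_eq_abs, abs_sub_comm]
              gcongr
              exact exp_nn_diff ε C hε n m (hC u v m hm)
          _ = (Real.exp (ε * C) - 1) * Real.exp (-ε * nn n) * ∑ v, ∑ m ∈ N u v, ‖φ v‖ := by
              simp only [Finset.mul_sum]
          _ ≤ (Real.exp (ε * C) - 1) * Real.exp (-ε * nn n) * B := by
              gcongr; exact hB u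
          _ = _ := by ring
      rwa [norm_smul, Complex.norm_real, Real.norm_of_nonneg (mul_nonneg hκ hB0)] at h1
    have h6 : ‖ψ‖ ≤ (C₀ * ((Real.exp (ε * C) - 1) * B)) * ‖W‖ := by
      calc ‖ψ‖ ≤ C₀ * ‖(x : ℂ) • ψ - H ψ‖ := hlow ψ
        _ ≤ C₀ * (((Real.exp (ε * C) - 1) * B) * ‖W‖) := by gcongr
        _ = _ := by ring
    have h7 : ‖ψ‖ ^ 2 ≤ ((C₀ * ((Real.exp (ε * C) - 1) * B)) * ‖W‖) ^ 2 := by gcongr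
    rw [mul_pow, hψn, hWn] at h7
    simp only [norm_one, one_pow, Finset.sum_const, Finset.card_univ, nsmul_eq_mul, mul_one] at h7
    rw [← mul_assoc] at h7
    exact le_of_mul_le_mul_right h7 hSpos
  have hlim : Tendsto (fun ε : ℝ => (C₀ * ((Real.exp (ε * C) - 1) * B)) ^ 2 * Fintype.card R)
      (nhdsWithin 0 (Set.Ioi 0)) (nhds 0) := by
    have : Continuous (fun ε : ℝ => (C₀ * ((Real.exp (ε * C) - 1) * B)) ^ 2 * Fintype.card R) := by
      fun_prop
    have := this.tendsto 0
    simp only [zero_mul, Real.exp_zero, sub_self, mul_zero, ne_eq, OfNat.ofNat_ne_zero,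
      not_false_eq_true, zero_pow] at this
    exact this.mono_left nhdsWithin_le_nhds
  have : Φ ≤ 0 := by
    refine ge_of_tendsto hlim ?_
    filter_upwards [self_mem_nhdsWithin] with ε hε using main ε hε
  linarith
end weyl

section forward
variable {d : ℕ} {V : Type}

lemma exists_reps [AddAction (Fin d → ℤ) V]
    (hfree : ∀ (n : Fin d → ℤ) (v : V), n +ᵥ v = v → n = 0)
    (hvorb : ∃ F : Finset V, ∀ v : V, ∃ u ∈ F, ∃ n : Fin d → ℤ, v = n +ᵥ u) :
    ∃ (R : Type) (_ : Fintype R) (s : R → V),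
      Function.Bijective (fun p : R × (Fin d → ℤ) => p.2 +ᵥ s p.1) := by
  obtain ⟨F, hF⟩ := hvorb
  let R := AddAction.orbitRel.Quotient (Fin d → ℤ) V
  have hsurj : Function.Surjective (fun u : F => (Quotient.mk _ (u : V) : R)) := by
    intro r
    induction r using Quotient.inductionOn with | _ v => ?_
    obtain ⟨u, hu, n, rfl⟩ := hF v
    refine ⟨⟨u, hu⟩, ?_⟩
    apply Quotient.sound
    exact ⟨-n, by simp⟩
  have : Finite R := Finite.of_surjective _ hsurj
  refine ⟨R, Fintype.ofFinite R, Quotient.out, ?_, ?_⟩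
  · rintro ⟨u, n⟩ ⟨v, m⟩ h
    simp only at h
    have huv : u = v := by
      rw [← Quotient.out_eq u, ← Quotient.out_eq v]
      apply Quotient.sound
      refine ⟨-n + m, ?_⟩
      simp only [add_vadd, ← h, neg_vadd_vadd]
    subst huv
    have h2 := hfree (-m + n) (Quotient.out u) (by rw [add_vadd, h, neg_vadd_vadd])
    have : n = m := by rw [neg_add_eq_zero] at h2; exact h2.symm
    rw [this]
  · intro v
    have : (AddAction.orbitRel (Fin d → ℤ) V) v (Quotient.out (Quotient.mk _ v : R)) :=
      Quotient.exact (Quotient.out_eq _).symm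
    obtain ⟨n, hn⟩ := this
    exact ⟨(_, n), hn⟩

lemma exists_nbrs {R : Type} (G : SimpleGraph V) [AddAction (Fin d → ℤ) V]
    (hfree : ∀ (n : Fin d → ℤ) (v : V), n +ᵥ v = v → n = 0)
    (hlocfin : ∀ v : V, {u : V | G.Adj u v}.Finite) (s : R → V) :
    ∃ N : R → R → Finset (Fin d → ℤ), ∀ u v n, n ∈ N u v ↔ G.Adj (n +ᵥ s v) (s u) := by
  have h : ∀ u v, {n : Fin d → ℤ | G.Adj (n +ᵥ s v) (s u)}.Finite := by
    intro u v
    refine Set.Finite.preimage (f := fun n : Fin d → ℤ => n +ᵥ s v) ?_ (hlocfin (s u))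
    intro n _ m _ h
    simp only at h
    have h2 := hfree (-m + n) (s v) (by rw [add_vadd, h, neg_vadd_vadd])
    rw [neg_add_eq_zero] at h2; exact h2.symm
  refine ⟨fun u v => (h u v).toFinset, fun u v n => ?_⟩
  simp

lemma reach_bound {R : Type} [Fintype R] [DecidableEq R] (G : SimpleGraph V) [AddAction (Fin d → ℤ) V]
    (hadj : ∀ (n : Fin d → ℤ) (u v : V), G.Adj u v → G.Adj (n +ᵥ u) (n +ᵥ v))
    (s : R → V) (hbij : Function.Bijective (fun p : R × (Fin d → ℤ) => p.2 +ᵥ s p.1))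
    (N : R → R → Finset (Fin d → ℤ)) (hN : ∀ u v n, n ∈ N u v ↔ G.Adj (n +ᵥ s v) (s u))
    (Q : V → ℝ) (hQ : ∀ (n : Fin d → ℤ) (v : V), Q (n +ᵥ v) = Q v) (S : Set V) (a : ℝ)
    (hS : ∀ v ∈ S, Q v = a) (i : Fin d) (t : ℝ)
    (x y : S) (hxy : Relation.ReflTransGen (G.induce S).Adj x y)
    (u : {u : R // Q (s u) = a}) (n : Fin d → ℤ) (hx : (x : V) = n +ᵥ s u) :
    ∀ (v : {u : R // Q (s u) = a}) (m : Fin d → ℤ), (y : V) = m +ᵥ s v →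
      ∃ k : ℕ, ‖((floq (fun u v : {u : R // Q (s u) = a} => N u v) i t) ^ k) u v -
        Complex.exp (((t * ((m - n) i : ℝ) : ℝ) : ℂ) * Complex.I)‖ ≤
          ((cnt (fun u v : {u : R // Q (s u) = a} => N u v)) ^ k) u v - 1 := by
  induction hxy with
  | refl =>
    intro v m h
    have h1 := hbij.1 (a₁ := (u.1, n)) (a₂ := (v.1, m)) (hx.symm.trans h)
    simp only [Prod.mk.injEq] at h1
    have h2 : u = v := Subtype.ext h1.1
    obtain rfl := h2
    obtain rfl := h1.2
    exact ⟨0, by simp⟩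
  | @tail y z _ hyz ih =>
    intro v m h
    obtain ⟨⟨w, k⟩, hw⟩ := hbij.2 (y : V)
    simp only at hw
    have hwa : Q (s w) = a := by rw [← hQ k, hw]; exact hS _ y.2
    obtain ⟨j, hj⟩ := ih ⟨w, hwa⟩ k hw.symm
    refine ⟨j + 1, ?_⟩
    have hadj' : G.Adj (z : V) (y : V) := SimpleGraph.Adj.symm (show G.Adj (y : V) (z : V) from hyz)
    rw [h, ← hw] at hadj'
    have h1 := hadj (-k) _ _ hadj'
    simp only [vadd_vadd, neg_add_cancel, zero_vadd] at h1
    have := walk_step (fun u v : {u : R // Q (s u) = a} => N u v) i t j u ⟨w, hwa⟩ v (k - n) (-k + m)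
      ((hN _ _ _).mpr h1) hj
    rwa [show k - n + (-k + m) = m - n by abel] at this

lemma forward_dir (G : SimpleGraph V) [AddAction (Fin d → ℤ) V]
    (hfree : ∀ (n : Fin d → ℤ) (v : V), n +ᵥ v = v → n = 0)
    (hadj : ∀ (n : Fin d → ℤ) (u v : V), G.Adj u v → G.Adj (n +ᵥ u) (n +ᵥ v))
    (hlocfin : ∀ v : V, {u : V | G.Adj u v}.Finite)
    (hvorb : ∃ F : Finset V, ∀ v : V, ∃ u ∈ F, ∃ n : Fin d → ℤ, v = n +ᵥ u)
    (Q : V → ℝ) (hQ : ∀ (n : Fin d → ℤ) (v : V), Q (n +ᵥ v) = Q v)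
    (H : ℝ → (lp (fun _ : V => ℂ) 2 →L[ℂ] lp (fun _ : V => ℂ) 2))
    (hH : ∀ (μ : ℝ) (ψ : lp (fun _ : V => ℂ) 2) (v : V),
      H μ ψ v = ((μ * Q v : ℝ) : ℂ) * ψ v + ∑' u : {u : V // G.Adj u v}, ψ (u : V))
    (hT : Tendsto (fun μ : ℝ => volume {x : ℝ | (x : ℂ) ∈ spectrum ℂ (H μ)}) atTop (nhds 0)) :
    ¬ ∃ S : Set V, S.Infinite ∧ (∃ a : ℝ, ∀ v ∈ S, Q v = a) ∧ (G.induce S).Connected := by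
  classical
  rintro ⟨S, hinf, ⟨a, hS⟩, hconn⟩
  obtain ⟨R, _, s, hbij⟩ := exists_reps hfree hvorb
  obtain ⟨N, hN⟩ := exists_nbrs G hfree hlocfin s
  have hNs : ∀ u v n, n ∈ N u v ↔ -n ∈ N v u := by
    intro u v n
    rw [hN, hN]
    constructor
    · intro h
      have := hadj (-n) _ _ h.symm
      rwa [neg_vadd_vadd] at this
    · intro h
      have := hadj n _ _ h.symm
      rwa [vadd_neg_vadd] at this
  -- pigeonhole
  let e : R × (Fin d → ℤ) ≃ V := Equiv.ofBijective _ hbij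
  have he : ∀ v, (e.symm v).2 +ᵥ s (e.symm v).1 = v := fun v => e.apply_symm_apply v
  have : Infinite S := hinf.to_subtype
  obtain ⟨x, y, hxy, hxy2⟩ := Finite.exists_ne_map_eq_of_infinite (fun x : S => (e.symm (x : V)).1)
  set u := (e.symm (x : V)).1 with hu
  set n := (e.symm (x : V)).2 with hn
  set m := (e.symm (y : V)).2 with hm
  have hxe : (x : V) = n +ᵥ s u := (he x).symm
  have hye : (y : V) = m +ᵥ s u := by rw [hxy2]; exact (he y).symm
  have hmn : m - n ≠ 0 := by
    intro h
    apply hxy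
    apply Subtype.ext
    rw [hxe, hye, sub_eq_zero.mp h]
  obtain ⟨i, hi⟩ := Function.ne_iff.mp hmn
  simp only [Pi.zero_apply] at hi
  have hi' : (((m - n) i : ℤ) : ℝ) ≠ 0 := by exact_mod_cast hi
  have hua : Q (s u) = a := by rw [← hQ n, ← hxe]; exact hS _ x.2
  let t : ℝ := Real.pi / ((m - n) i : ℤ)
  obtain ⟨k, hk⟩ := reach_bound G hadj s hbij N hN Q hQ S a hS i t x y
    ((SimpleGraph.reachable_iff_reflTransGen _ _).mp (hconn.preconnected x y)) ⟨u, hua⟩ n hxe ⟨u, hua⟩ m hye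
  have h1 := trace_ne _ i t k _ (m - n) (by
    simp only [t]
    rw [div_mul_cancel₀ _ hi', Real.cos_pi]; norm_num) hk
  apply h1
  have hb : ∀ t, floq (fun u v : {u : R // Q (s u) = a} => N u v) i t =
      blk (fun u => Q (s u)) a (floq N i t) := fun t => rfl
  rw [hb, hb]
  have hherm : ∀ t, (blk (fun u => Q (s u)) a (floq N i t)).IsHermitian := by
    intro t; rw [← hb]; exact floq_herm _ i t (fun u v n => hNs u v n)
  refine trace_pow_eq_of_charpoly_eq _ _ (hherm _) (hherm _) ?_ k
  refine charpoly_const N i hNs (fun u => Q (s u)) a (fun μ => {x : ℝ | (x : ℂ) ∈ spectrum ℂ (H μ)})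
    ?_ hT ?_ t
  · intro μ
    have hc : IsCompact (spectrum ℂ (H μ)) := spectrum.isCompact _
    exact Complex.isometry_ofReal.isClosedEmbedding.isCompact_preimage hc
  · intro μ t x φ hφ h
    exact mem_spectrum_of_floquet G hadj s hbij N hN Q hQ μ (H μ) (hH μ) i t x φ hφ h

end forward

section hilbert
variable {E : Type*} [NormedAddCommGroup E] [InnerProductSpace ℂ E] [CompleteSpace E]

lemma notMem_spectrum_of_bound (T : E →L[ℂ] E) (hT : IsSelfAdjoint T) (x c : ℝ) (hc : 0 < c)
    (h : ∀ ψ, c * ‖ψ‖ ≤ ‖T ψ - (x : ℂ) • ψ‖) : (x : ℂ) ∉ spectrum ℂ T := by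
  rw [spectrum.notMem_iff]
  set f : E →L[ℂ] E := algebraMap ℂ (E →L[ℂ] E) x - T with hf
  have hfa : ∀ ψ, f ψ = (x : ℂ) • ψ - T ψ := fun ψ => rfl
  have hb : ∀ ψ, c * ‖ψ‖ ≤ ‖f ψ‖ := by
    intro ψ; rw [hfa, norm_sub_rev]; exact h ψ
  have hsa : IsSelfAdjoint f := by
    refine IsSelfAdjoint.sub ?_ hT
    exact (IsSelfAdjoint.algebraMap _ (by simp [isSelfAdjoint_iff]))
  rw [ContinuousLinearMap.isUnit_iff_bijective,
    ContinuousLinearMap.bijective_iff_dense_range_and_antilipschitz]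
  constructor
  · rw [Submodule.topologicalClosure_eq_top_iff, ContinuousLinearMap.orthogonal_range,
      hsa.adjoint_eq, Submodule.eq_bot_iff]
    intro ψ hψ
    have h0 : f ψ = 0 := hψ
    have := hb ψ
    rw [h0, norm_zero] at this
    have : ‖ψ‖ ≤ 0 := by
      by_contra hh
      push Not at hh
      nlinarith [mul_pos hc hh]
    exact norm_le_zero_iff.mp this
  · refine ⟨(Real.toNNReal c⁻¹), f.antilipschitz_of_bound fun ψ => ?_⟩
    rw [Real.coe_toNNReal _ (inv_nonneg.mpr hc.le), inv_mul_eq_div, le_div_iff₀ hc, mul_comm]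
    exact hb ψ

lemma bound_of_spectrum (T : E →L[ℂ] E) (hT : IsSelfAdjoint T) (x ε : ℝ) (hε : 0 < ε)
    (h : ∀ l : ℝ, (l : ℂ) ∈ spectrum ℂ T → ε ≤ |x - l|) (ψ : E) :
    ε * ‖ψ‖ ≤ ‖T ψ - (x : ℂ) • ψ‖ := by
  have hx : (x : ℂ) ∉ spectrum ℂ T := by
    intro hx
    have := h x hx
    simp at this
    linarith
  rw [spectrum.notMem_iff] at hx
  obtain ⟨u, hu⟩ := hx
  have hsa : IsSelfAdjoint (u : E →L[ℂ] E) := by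
    rw [hu]
    refine IsSelfAdjoint.sub ?_ hT
    exact (IsSelfAdjoint.algebraMap _ (by simp [isSelfAdjoint_iff]))
  have hsa' : IsSelfAdjoint (↑u⁻¹ : E →L[ℂ] E) := by
    have : star u = u := Units.ext hsa
    rw [isSelfAdjoint_iff, ← Units.coe_star_inv, this]
  have hr := hsa'.spectralRadius_eq_nnnorm
  have hle : spectralRadius ℂ (↑u⁻¹ : E →L[ℂ] E) ≤ ENNReal.ofReal ε⁻¹ := by
    refine iSup₂_le fun k hk => ?_
    rw [← spectrum.map_inv, Set.mem_inv, hu, ← spectrum.singleton_sub_eq] at hk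
    obtain ⟨_, rfl, z, hz, hzk⟩ := Set.mem_sub.mp hk
    have hzr := hT.im_eq_zero_of_mem_spectrum hz
    have hz' : z = (z.re : ℂ) := by
      apply Complex.ext <;> simp [hzr]
    rw [hz'] at hz hzk
    have h1 := h _ hz
    have h2 : ‖k⁻¹‖ = |x - z.re| := by
      rw [← hzk, ← Complex.ofReal_sub, Complex.norm_real, Real.norm_eq_abs]
    rw [← h2, norm_inv] at h1
    rw [ENNReal.le_ofReal_iff_toReal_le (by simp) (by positivity)]
    simp only [ENNReal.coe_toReal, coe_nnnorm]
    exact le_inv_of_le_inv₀ hε h1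
  rw [hr] at hle
  rw [ENNReal.le_ofReal_iff_toReal_le (by simp) (by positivity)] at hle
  simp only [ENNReal.coe_toReal, coe_nnnorm] at hle
  have h3 : (↑u⁻¹ : E →L[ℂ] E) ((u : E →L[ℂ] E) ψ) = ψ := by
    have : (↑u⁻¹ * ↑u : E →L[ℂ] E) ψ = ψ := by simp
    exact this
  have h4 : ‖ψ‖ ≤ ε⁻¹ * ‖(u : E →L[ℂ] E) ψ‖ := by
    calc ‖ψ‖ = ‖(↑u⁻¹ : E →L[ℂ] E) ((u : E →L[ℂ] E) ψ)‖ := by rw [h3]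
      _ ≤ ‖(↑u⁻¹ : E →L[ℂ] E)‖ * ‖(u : E →L[ℂ] E) ψ‖ := ContinuousLinearMap.le_opNorm _ _
      _ ≤ _ := by gcongr
  have h5 : ‖(u : E →L[ℂ] E) ψ‖ = ‖T ψ - (x : ℂ) • ψ‖ := by
    rw [hu, norm_sub_rev]; rfl
  rw [h5, inv_mul_eq_div, le_div_iff₀ hε] at h4
  linarith

lemma gap_lemma (T : E →L[ℂ] E) (hT : IsSelfAdjoint T) (P : E → E) (x ε α κ : ℝ) (hε : 0 < ε)
    (hα : 0 ≤ α) (hκ : (α + ε) * (2 * α / ε + 1) ≤ κ)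
    (h1 : ∀ ψ, κ * ‖ψ - P ψ‖ ≤ ‖T ψ - (x : ℂ) • ψ‖ + α * ‖ψ‖)
    (h2 : ∀ ψ, ε * ‖P ψ‖ ≤ ‖T ψ - (x : ℂ) • ψ‖ + α * ‖ψ - P ψ‖) : (x : ℂ) ∉ spectrum ℂ T := by
  refine notMem_spectrum_of_bound T hT x (ε / 4) (by positivity) fun ψ => ?_
  have h1 := h1 ψ
  have h2 := h2 ψ
  have h3 : ‖ψ‖ ≤ ‖P ψ‖ + ‖ψ - P ψ‖ := by
    calc ‖ψ‖ = ‖P ψ + (ψ - P ψ)‖ := by congr 1; abel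
      _ ≤ _ := norm_add_le _ _
  set p := ‖P ψ‖
  set q := ‖ψ - P ψ‖
  set h := ‖T ψ - (x : ℂ) • ψ‖
  set n := ‖ψ‖
  have hq : 0 ≤ q := norm_nonneg _
  have hh : 0 ≤ h := norm_nonneg _
  have hn : 0 ≤ n := norm_nonneg _
  have h4 : (α + ε) * (2 * α / ε + 1) * q ≤ h + α * n := (by gcongr : _ ≤ κ * q).trans h1
  have h5 : (2 * α / ε + 1) * (ε * n) ≤ (2 * α / ε + 1) * h + (h + α * n) := by
    have h6 : ε * n ≤ h + (α + ε) * q := by nlinarith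
    calc (2 * α / ε + 1) * (ε * n) ≤ (2 * α / ε + 1) * (h + (α + ε) * q) := by gcongr
      _ = (2 * α / ε + 1) * h + (α + ε) * (2 * α / ε + 1) * q := by ring
      _ ≤ _ := by linarith
  have h7 : (2 * α / ε + 1) * (ε * n) = 2 * α * n + ε * n := by field_simp
  have h8 : (2 * α + ε) * h * 4 ≥ (2 * α + ε) * (ε * n) := by
    have : (2 * α / ε + 1) * h * ε = (2 * α + ε) * h := by field_simp
    nlinarith [mul_nonneg hα hn, mul_nonneg hα hh, mul_nonneg hε.le hn]
  have h9 : ε * n ≤ 4 * h := by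
    have : (2 * α + ε) * (ε * n) ≤ (2 * α + ε) * (4 * h) := by linarith
    exact le_of_mul_le_mul_left this (by positivity)
  linarith

end hilbert

section proj
variable {V : Type}

/-- Multiplication by the indicator of a set on `ℓ²`. -/
lemma exists_proj (S : Set V) : ∃ P : lp (fun _ : V => ℂ) 2 →L[ℂ] lp (fun _ : V => ℂ) 2,
    IsSelfAdjoint P ∧ ∀ ψ v, P ψ v = S.indicator (fun w => ψ w) v := by
  classical
  have hb : ∀ (ψ : lp (fun _ : V => ℂ) 2) v, ‖S.indicator (fun w => ψ w) v‖ ≤ ‖ψ v‖ := by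
    intro ψ v
    exact norm_indicator_le_norm_self _ _
  have hmem : ∀ ψ : lp (fun _ : V => ℂ) 2, Memℓp (fun v => S.indicator (fun w => ψ w) v) 2 := by
    intro ψ
    exact Memℓp.mono' (lp.memℓp ψ) (fun v => hb ψ v)
  let P₀ : lp (fun _ : V => ℂ) 2 →ₗ[ℂ] lp (fun _ : V => ℂ) 2 :=
    { toFun := fun ψ => ⟨_, hmem ψ⟩
      map_add' := by
        intro ψ φ
        ext v
        change S.indicator (fun w => ψ w + φ w) v =
          S.indicator (fun w => ψ w) v + S.indicator (fun w => φ w) v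
        by_cases hv : v ∈ S <;> simp [hv]
      map_smul' := by
        intro c ψ
        ext v
        by_cases hv : v ∈ S <;> simp [hv] }
  let P := P₀.mkContinuous 1 (fun ψ => by
    rw [one_mul]
    exact lp.norm_mono (by simp) (fun v => hb ψ v))
  have hP : ∀ ψ v, P ψ v = S.indicator (fun w => ψ w) v := fun ψ v => rfl
  refine ⟨P, ?_, hP⟩
  rw [ContinuousLinearMap.isSelfAdjoint_iff_isSymmetric]
  intro ψ φ
  change inner ℂ (P ψ) φ = inner ℂ ψ (P φ)
  rw [lp.inner_eq_tsum, lp.inner_eq_tsum]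
  refine tsum_congr fun v => ?_
  rw [hP, hP]
  by_cases hv : v ∈ S <;> simp [hv]

end proj

section finspec
variable {d : ℕ} {V : Type}

/-- The restricted adjacency relation. -/
def rrel (G : SimpleGraph V) (S : Set V) (x y : V) : Prop := G.Adj x y ∧ x ∈ S ∧ y ∈ S

lemma comp_connected (G : SimpleGraph V) (S : Set V) (v : V) :
    (G.induce {w | Relation.ReflTransGen (rrel G S) v w}).Connected := by
  rw [SimpleGraph.connected_iff_exists_forall_reachable]
  refine ⟨⟨v, Relation.ReflTransGen.refl⟩, ?_⟩
  rintro ⟨w, hw⟩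
  have hw' : Relation.ReflTransGen (rrel G S) v w := hw
  induction hw' with
  | refl => exact SimpleGraph.Reachable.refl _
  | @tail y z hy hyz ih =>
    refine (ih hy).trans (SimpleGraph.Adj.reachable ?_)
    exact hyz.1

lemma comp_finite (G : SimpleGraph V) (Q : V → ℝ) (a : ℝ)
    (hno : ¬ ∃ S : Set V, S.Infinite ∧ (∃ a : ℝ, ∀ v ∈ S, Q v = a) ∧ (G.induce S).Connected)
    (v : V) : {w | Relation.ReflTransGen (rrel G {v | Q v = a}) v w}.Finite := by
  by_contra hinf
  apply hno
  refine ⟨_, hinf, ⟨Q v, ?_⟩, comp_connected G _ v⟩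
  intro w hw
  have hw' : Relation.ReflTransGen (rrel G {v | Q v = a}) v w := hw
  induction hw' with
  | refl => rfl
  | @tail y z hy hyz ih =>
    rw [← ih hy, show Q z = a from hyz.2.2, show Q y = a from hyz.2.1]

lemma exists_poly_at (G : SimpleGraph V) (S : Set V)
    (B : lp (fun _ : V => ℂ) 2 →L[ℂ] lp (fun _ : V => ℂ) 2)
    (hB : ∀ ψ v, B ψ v = S.indicator
      (fun v => ∑' u : {u : V // G.Adj u v}, S.indicator (fun w => ψ w) (u : V)) v)
    (v : V) (hfin : {w | Relation.ReflTransGen (rrel G S) v w}.Finite) :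
    ∃ p : Polynomial ℂ, p ≠ 0 ∧ ∀ ψ : lp (fun _ : V => ℂ) 2, (∀ w, w ≠ v → ψ w = 0) →
      Polynomial.aeval B p ψ = 0 := by
  set C := {w | Relation.ReflTransGen (rrel G S) v w} with hC
  let W : Submodule ℂ (lp (fun _ : V => ℂ) 2) :=
    { carrier := {ψ | ∀ w, w ∉ C → ψ w = 0}
      add_mem' := by
        intro ψ φ hψ hφ w hw
        simp only [lp.coeFn_add, Pi.add_apply, hψ w hw, hφ w hw, add_zero]
      zero_mem' := by intro w hw; rfl
      smul_mem' := by
        intro c ψ hψ w hw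
        simp only [lp.coeFn_smul, Pi.smul_apply, hψ w hw, smul_zero] }
  have hW : ∀ ψ, ψ ∈ W ↔ ∀ w, w ∉ C → ψ w = 0 := fun ψ => Iff.rfl
  have hinv : ∀ ψ ∈ W, (B : lp (fun _ : V => ℂ) 2 →ₗ[ℂ] lp (fun _ : V => ℂ) 2) ψ ∈ W := by
    intro ψ hψ
    rw [hW] at hψ ⊢
    intro w hw
    change B ψ w = 0
    rw [hB]
    by_cases hwS : w ∈ S
    · rw [Set.indicator_of_mem hwS]
      have : ∀ u : {u : V // G.Adj u w}, S.indicator (fun w => ψ w) (u : V) = 0 := by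
        rintro ⟨u, hu⟩
        by_cases huS : u ∈ S
        · rw [Set.indicator_of_mem huS]
          refine hψ u fun huC => hw ?_
          exact Relation.ReflTransGen.tail huC ⟨hu, huS, hwS⟩
        · rw [Set.indicator_of_notMem huS]
      simp only [this, tsum_zero]
    · rw [Set.indicator_of_notMem hwS]
  have : Finite C := hfin
  let ev : W →ₗ[ℂ] (C → ℂ) :=
    { toFun := fun ψ w => (ψ : lp (fun _ : V => ℂ) 2) (w : V)
      map_add' := by intro ψ φ; rfl
      map_smul' := by intro c ψ; rfl }
  have hev : Function.Injective ev := by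
    intro ψ φ h
    apply Subtype.ext
    ext w
    by_cases hw : w ∈ C
    · exact congrFun h ⟨w, hw⟩
    · rw [(hW _).mp ψ.2 w hw, (hW _).mp φ.2 w hw]
  have hfd : Module.Finite ℂ W := Module.Finite.of_injective ev hev
  let g : W →ₗ[ℂ] W := LinearMap.restrict _ hinv
  have hg : ∀ (p : Polynomial ℂ) (ψ : W),
      ((Polynomial.aeval g p ψ : W) : lp (fun _ : V => ℂ) 2) = Polynomial.aeval B p (ψ : lp (fun _ : V => ℂ) 2) := by
    intro p
    induction p using Polynomial.induction_on' with
    | add p q hp hq =>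
      intro ψ
      simp only [map_add, LinearMap.add_apply, _root_.add_apply, Submodule.coe_add, hp, hq]
    | monomial n c =>
      have hpow : ∀ ψ : W, (((g ^ n) ψ : W) : lp (fun _ : V => ℂ) 2) = (B ^ n) (ψ : lp (fun _ : V => ℂ) 2) := by
        induction n with
        | zero => intro ψ; rfl
        | succ n ih =>
          intro ψ
          rw [pow_succ, pow_succ]
          exact ih (g ψ)
      intro ψ
      rw [Polynomial.aeval_monomial, Polynomial.aeval_monomial, Algebra.algebraMap_eq_smul_one,
        Algebra.algebraMap_eq_smul_one, smul_one_mul, smul_one_mul]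
      change ((c • ((g ^ n) ψ) : W) : lp (fun _ : V => ℂ) 2) = c • ((B ^ n) (ψ : lp (fun _ : V => ℂ) 2))
      rw [← hpow]; rfl
  refine ⟨g.charpoly, g.charpoly_monic.ne_zero, fun ψ hψ => ?_⟩
  have hψW : ψ ∈ W := by
    intro w hw
    refine hψ w ?_
    rintro rfl
    exact hw Relation.ReflTransGen.refl
  have := hg g.charpoly ⟨ψ, hψW⟩
  rw [LinearMap.aeval_self_charpoly] at this
  exact this.symm

lemma aeval_covariant [AddAction (Fin d → ℤ) V] (G : SimpleGraph V)
    (hadj : ∀ (n : Fin d → ℤ) (u v : V), G.Adj u v → G.Adj (n +ᵥ u) (n +ᵥ v)) (S : Set V)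
    (hS : ∀ (n : Fin d → ℤ) v, n +ᵥ v ∈ S ↔ v ∈ S)
    (B : lp (fun _ : V => ℂ) 2 →L[ℂ] lp (fun _ : V => ℂ) 2)
    (hB : ∀ ψ v, B ψ v = S.indicator
      (fun v => ∑' u : {u : V // G.Adj u v}, S.indicator (fun w => ψ w) (u : V)) v)
    (n : Fin d → ℤ) (p : Polynomial ℂ) : ∀ ψ φ : lp (fun _ : V => ℂ) 2,
      (∀ w, φ (n +ᵥ w) = ψ w) → ∀ w, Polynomial.aeval B p φ (n +ᵥ w) = Polynomial.aeval B p ψ w := by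
  have hstep : ∀ ψ φ : lp (fun _ : V => ℂ) 2,
      (∀ w, φ (n +ᵥ w) = ψ w) → ∀ w, B φ (n +ᵥ w) = B ψ w := by
    intro ψ φ h w
    rw [hB, hB]
    by_cases hw : w ∈ S
    · rw [Set.indicator_of_mem hw, Set.indicator_of_mem ((hS n w).mpr hw)]
      let e : {u : V // G.Adj u w} ≃ {u : V // G.Adj u (n +ᵥ w)} :=
        { toFun := fun u => ⟨n +ᵥ (u : V), hadj n _ _ u.2⟩
          invFun := fun u => ⟨-n +ᵥ (u : V), by
            have := hadj (-n) _ _ u.2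
            rwa [neg_vadd_vadd] at this⟩
          left_inv := fun u => by simp
          right_inv := fun u => by simp }
      rw [← e.tsum_eq]
      refine tsum_congr fun u => ?_
      change S.indicator (fun w => φ w) (n +ᵥ (u : V)) = _
      by_cases hu : (u : V) ∈ S
      · rw [Set.indicator_of_mem hu, Set.indicator_of_mem ((hS n u).mpr hu), h]
      · rw [Set.indicator_of_notMem hu, Set.indicator_of_notMem (fun h' => hu ((hS n u).mp h'))]
    · rw [Set.indicator_of_notMem hw, Set.indicator_of_notMem (fun h' => hw ((hS n w).mp h'))]
  induction p using Polynomial.induction_on' with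
  | add p q hp hq =>
    intro ψ φ h w
    rw [map_add]
    change Polynomial.aeval B p φ (n +ᵥ w) + Polynomial.aeval B q φ (n +ᵥ w) =
      Polynomial.aeval B p ψ w + Polynomial.aeval B q ψ w
    rw [hp ψ φ h, hq ψ φ h]
  | monomial k c =>
    have hpow : ∀ ψ φ : lp (fun _ : V => ℂ) 2,
        (∀ w, φ (n +ᵥ w) = ψ w) → ∀ w, (B ^ k) φ (n +ᵥ w) = (B ^ k) ψ w := by
      induction k with
      | zero => intro ψ φ h w; exact h w
      | succ k ih =>
        intro ψ φ h w
        rw [pow_succ]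
        exact ih (B ψ) (B φ) (hstep ψ φ h) w
    intro ψ φ h w
    rw [Polynomial.aeval_monomial, Algebra.algebraMap_eq_smul_one, smul_one_mul]
    change c * ((B ^ k) φ (n +ᵥ w)) = c * ((B ^ k) ψ w)
    rw [hpow ψ φ h]

lemma finite_spectrum [AddAction (Fin d → ℤ) V] (G : SimpleGraph V)
    (hadj : ∀ (n : Fin d → ℤ) (u v : V), G.Adj u v → G.Adj (n +ᵥ u) (n +ᵥ v))
    (hvorb : ∃ F : Finset V, ∀ v : V, ∃ u ∈ F, ∃ n : Fin d → ℤ, v = n +ᵥ u) (S : Set V)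
    (hS : ∀ (n : Fin d → ℤ) v, n +ᵥ v ∈ S ↔ v ∈ S)
    (B : lp (fun _ : V => ℂ) 2 →L[ℂ] lp (fun _ : V => ℂ) 2)
    (hB : ∀ ψ v, B ψ v = S.indicator
      (fun v => ∑' u : {u : V // G.Adj u v}, S.indicator (fun w => ψ w) (u : V)) v)
    (hfin : ∀ v, {w | Relation.ReflTransGen (rrel G S) v w}.Finite) :
    (spectrum ℂ B).Finite := by
  classical
  obtain ⟨F, hF⟩ := hvorb
  choose p hp0 hp using fun v => exists_poly_at G S B hB v (hfin v)
  let P : Polynomial ℂ := ∏ v ∈ F, p v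
  have hP0 : P ≠ 0 := Finset.prod_ne_zero_iff.mpr fun v _ => hp0 v
  have hPF : ∀ v ∈ F, ∀ ψ : lp (fun _ : V => ℂ) 2, (∀ w, w ≠ v → ψ w = 0) → Polynomial.aeval B P ψ = 0 := by
    intro v hv ψ hψ
    have : P = (∏ u ∈ F.erase v, p u) * p v := by
      rw [mul_comm]; exact (Finset.mul_prod_erase F p hv).symm
    rw [this, Polynomial.aeval_mul]
    change Polynomial.aeval B (∏ u ∈ F.erase v, p u) (Polynomial.aeval B (p v) ψ) = 0
    rw [hp v ψ hψ, map_zero]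
  have hPz : Polynomial.aeval B P = 0 := by
    ext1 ψ
    have h1 := (lp.hasSum_single (p := 2) (by simp) ψ).mapL (Polynomial.aeval B P)
    have h2 : ∀ v, Polynomial.aeval B P (lp.single 2 v (ψ v)) = 0 := by
      intro v
      obtain ⟨u, hu, n, rfl⟩ := hF v
      have h3 := aeval_covariant G hadj S hS B hB n P (lp.single 2 u (ψ (n +ᵥ u)))
        (lp.single 2 (n +ᵥ u) (ψ (n +ᵥ u))) (by
          intro w
          rw [lp.single_apply, lp.single_apply]
          by_cases hw : w = u
          · subst hw; simp
          · rw [Pi.single_eq_of_ne hw, Pi.single_eq_of_ne (fun h => hw (vadd_left_cancel n h))])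
      have h4 := hPF u hu (lp.single 2 u (ψ (n +ᵥ u))) (by
        intro w hw
        rw [lp.single_apply, Pi.single_eq_of_ne hw])
      ext w
      have h5 := h3 (-n +ᵥ w)
      rw [h4, vadd_neg_vadd] at h5
      rw [h5]; rfl
    simp only [h2] at h1
    exact h1.unique hasSum_zero
  refine Set.Finite.subset (P.rootSet_finite ℂ) ?_
  intro z hz
  have h1 := spectrum.subset_polynomial_aeval B P ⟨z, hz, rfl⟩
  rw [hPz] at h1
  have : Nontrivial (lp (fun _ : V => ℂ) 2 →L[ℂ] lp (fun _ : V => ℂ) 2) := by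
    by_contra hcon
    rw [not_nontrivial_iff_subsingleton] at hcon
    rw [spectrum.of_subsingleton] at hz
    exact hz
  rw [spectrum.zero_eq] at h1
  rw [Polynomial.mem_rootSet_of_ne hP0]
  simpa using h1

end finspec

section backward
variable {d : ℕ} {V : Type}

lemma exists_gap (vals : Finset ℝ) : ∃ c : ℝ, 0 < c ∧ ∀ a ∈ vals, ∀ b ∈ vals, a ≠ b → c ≤ |a - b| := by
  have h : ∀ᶠ c : ℝ in nhdsWithin 0 (Set.Ioi 0), ∀ a ∈ vals, ∀ b ∈ vals, a ≠ b → c ≤ |a - b| := by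
    rw [Filter.eventually_all_finset]
    intro a _
    rw [Filter.eventually_all_finset]
    intro b _
    by_cases hab : a = b
    · simp [hab]
    · have h1 : 0 < |a - b| := abs_pos.mpr (sub_ne_zero.mpr hab)
      filter_upwards [Ioo_mem_nhdsGT h1] with c hc _ using hc.2.le
  obtain ⟨c, hc, hc0⟩ := (h.and self_mem_nhdsWithin).exists
  exact ⟨c, hc0, hc⟩

lemma sum_ball (vals : Finset ℝ) (L : ℝ → Finset ℝ) (f : ℝ → ℝ → ℝ) (ε : ℝ) :
    ∑ a ∈ vals, ∑ l ∈ L a, volume (Metric.ball (f a l) ε) =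
      ENNReal.ofReal (((∑ a ∈ vals, (L a).card : ℕ) : ℝ) * (2 * ε)) := by
  simp only [Real.volume_ball, Finset.sum_const, nsmul_eq_mul, ← Finset.sum_mul]
  rw [ENNReal.ofReal_mul (Nat.cast_nonneg _), ENNReal.ofReal_natCast, Nat.cast_sum]

lemma spectrum_near (G : SimpleGraph V)
    (Q : V → ℝ) (H : ℝ → (lp (fun _ : V => ℂ) 2 →L[ℂ] lp (fun _ : V => ℂ) 2))
    (hH : ∀ (μ : ℝ) (ψ : lp (fun _ : V => ℂ) 2) (v : V),
      H μ ψ v = ((μ * Q v : ℝ) : ℂ) * ψ v + ∑' u : {u : V // G.Adj u v}, ψ (u : V))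
    (hsa : ∀ μ : ℝ, IsSelfAdjoint (H μ)) (vals : Finset ℝ) (hvals : ∀ v, Q v ∈ vals)
    (hne : vals.Nonempty)
    (P : ℝ → (lp (fun _ : V => ℂ) 2 →L[ℂ] lp (fun _ : V => ℂ) 2))
    (hPsa : ∀ a, IsSelfAdjoint (P a))
    (hP : ∀ a ψ v, P a ψ v = {v | Q v = a}.indicator (fun w => ψ w) v) (ε : ℝ) (hε : 0 < ε) :
    ∀ᶠ μ in atTop, ∀ x : ℝ, (x : ℂ) ∈ spectrum ℂ (H μ) →
      ∃ a ∈ vals, ∃ l : ℝ, (l : ℂ) ∈ spectrum ℂ (P a * H 0 * P a) ∧ |x - μ * a - l| < ε := by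
  obtain ⟨c, hc, hgap⟩ := exists_gap vals
  set α := ‖H 0‖ with hα
  have hα0 : 0 ≤ α := norm_nonneg _
  have hlarge : ∀ᶠ μ : ℝ in atTop, (α + ε) * (2 * α / ε + 1) ≤ μ * c / 2 := by
    have : Tendsto (fun μ : ℝ => μ * c / 2) atTop atTop := by
      refine (tendsto_id.atTop_mul_const (show 0 < c / 2 by positivity)).congr fun μ => ?_
      simp only [id]; ring
    exact this.eventually_ge_atTop _
  filter_upwards [hlarge, eventually_ge_atTop 0] with μ hμ hμ0 x hx
  by_contra hcon
  push Not at hcon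
  obtain ⟨a, ha, hmin⟩ := Finset.exists_min_image vals (fun a => |x - μ * a|) hne
  have hPle : ∀ ψ, ‖P a ψ‖ ≤ ‖ψ‖ := by
    intro ψ
    refine lp.norm_mono (by simp) fun v => ?_
    rw [hP]
    exact norm_indicator_le_norm_self _ _
  have hPcle : ∀ ψ, ‖ψ - P a ψ‖ ≤ ‖ψ‖ := by
    intro ψ
    refine lp.norm_mono (by simp) fun v => ?_
    rw [lp.coeFn_sub, Pi.sub_apply, hP]
    by_cases hv : v ∈ {v | Q v = a}
    · rw [Set.indicator_of_mem hv]; simp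
    · rw [Set.indicator_of_notMem hv]; simp
  have hH' : ∀ ψ v, (H μ ψ - (x : ℂ) • ψ) v = ((μ * Q v - x : ℝ) : ℂ) * ψ v + H 0 ψ v := by
    intro ψ v
    rw [lp.coeFn_sub, Pi.sub_apply, lp.coeFn_smul, Pi.smul_apply, hH, hH, smul_eq_mul]
    push_cast
    ring
  refine gap_lemma (H μ) (hsa μ) (P a) x ε α (μ * c / 2) hε hα0 hμ ?_ ?_ hx
  · intro ψ
    set η := H μ ψ - (x : ℂ) • ψ with hη
    have h1 : ‖((μ * c / 2 : ℝ) : ℂ) • (ψ - P a ψ)‖ ≤ ‖(η - H 0 ψ) - P a (η - H 0 ψ)‖ := by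
      refine lp.norm_mono (by simp) fun v => ?_
      rw [lp.coeFn_smul, Pi.smul_apply, lp.coeFn_sub, lp.coeFn_sub, Pi.sub_apply, Pi.sub_apply, hP, hP]
      by_cases hv : v ∈ {v | Q v = a}
      · rw [Set.indicator_of_mem hv, Set.indicator_of_mem hv]; simp
      · rw [Set.indicator_of_notMem hv, Set.indicator_of_notMem hv, sub_zero, sub_zero,
          lp.coeFn_sub, Pi.sub_apply, hη, hH', add_sub_cancel_right, norm_smul, norm_mul,
          Complex.norm_real, Complex.norm_real, Real.norm_of_nonneg (by positivity), Real.norm_eq_abs]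
        gcongr
        have h2 := hmin (Q v) (hvals v)
        have h3 := hgap (Q v) (hvals v) a ha hv
        have h4 : μ * c ≤ |μ * Q v - μ * a| := by
          rw [← mul_sub, abs_mul, abs_of_nonneg hμ0]
          gcongr
        have h5 : |μ * Q v - μ * a| ≤ |μ * Q v - x| + |x - μ * a| := abs_sub_le _ _ _
        rw [abs_sub_comm (μ * Q v) x] at h5 ⊢
        linarith
    rw [norm_smul, Complex.norm_real, Real.norm_of_nonneg (by positivity)] at h1
    calc _ ≤ _ := h1
      _ ≤ ‖η - H 0 ψ‖ := hPcle _
      _ ≤ ‖η‖ + ‖H 0 ψ‖ := norm_sub_le _ _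
      _ ≤ _ := by gcongr; exact ContinuousLinearMap.le_opNorm _ _
  · intro ψ
    set η := H μ ψ - (x : ℂ) • ψ with hη
    have hBsa : IsSelfAdjoint (P a * H 0 * P a) := by
      have := (hsa 0).conjugate (P a)
      rwa [(hPsa a).star_eq] at this
    have h1 := bound_of_spectrum _ hBsa (x - μ * a) ε hε (fun l hl => hcon a ha l hl) (P a ψ)
    have h2 : (P a * H 0 * P a) (P a ψ) - ((x - μ * a : ℝ) : ℂ) • P a ψ =
        P a (η - H 0 (ψ - P a ψ)) := by
      have hPP : P a (P a ψ) = P a ψ := by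
        ext v
        by_cases hv : v ∈ {v | Q v = a}
        · rw [hP, Set.indicator_of_mem hv]
        · rw [hP, hP, Set.indicator_of_notMem hv, Set.indicator_of_notMem hv]
      change P a (H 0 (P a (P a ψ))) - _ = _
      rw [hPP]
      ext v
      rw [lp.coeFn_sub, Pi.sub_apply, lp.coeFn_smul, Pi.smul_apply, hP, hP, hP]
      by_cases hv : v ∈ {v | Q v = a}
      · have hv' : Q v = a := hv
        rw [Set.indicator_of_mem hv, Set.indicator_of_mem hv, Set.indicator_of_mem hv, lp.coeFn_sub,
          Pi.sub_apply, hη, hH', map_sub, lp.coeFn_sub, Pi.sub_apply, hv', smul_eq_mul]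
        push_cast
        ring
      · rw [Set.indicator_of_notMem hv, Set.indicator_of_notMem hv, Set.indicator_of_notMem hv]; simp
    rw [h2] at h1
    calc _ ≤ _ := h1
      _ ≤ ‖η - H 0 (ψ - P a ψ)‖ := hPle _
      _ ≤ ‖η‖ + ‖H 0 (ψ - P a ψ)‖ := norm_sub_le _ _
      _ ≤ _ := by gcongr; exact ContinuousLinearMap.le_opNorm _ _

lemma backward_dir (G : SimpleGraph V) [AddAction (Fin d → ℤ) V]
    (hadj : ∀ (n : Fin d → ℤ) (u v : V), G.Adj u v → G.Adj (n +ᵥ u) (n +ᵥ v))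
    (hvorb : ∃ F : Finset V, ∀ v : V, ∃ u ∈ F, ∃ n : Fin d → ℤ, v = n +ᵥ u)
    (Q : V → ℝ) (hQ : ∀ (n : Fin d → ℤ) (v : V), Q (n +ᵥ v) = Q v)
    (H : ℝ → (lp (fun _ : V => ℂ) 2 →L[ℂ] lp (fun _ : V => ℂ) 2))
    (hH : ∀ (μ : ℝ) (ψ : lp (fun _ : V => ℂ) 2) (v : V),
      H μ ψ v = ((μ * Q v : ℝ) : ℂ) * ψ v + ∑' u : {u : V // G.Adj u v}, ψ (u : V))
    (hsa : ∀ μ : ℝ, IsSelfAdjoint (H μ))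
    (hno : ¬ ∃ S : Set V, S.Infinite ∧ (∃ a : ℝ, ∀ v ∈ S, Q v = a) ∧ (G.induce S).Connected) :
    Tendsto (fun μ : ℝ => volume {x : ℝ | (x : ℂ) ∈ spectrum ℂ (H μ)}) atTop (nhds 0) := by
  classical
  rcases isEmpty_or_nonempty V with hV | ⟨⟨v₀⟩⟩
  · have : Subsingleton (lp (fun _ : V => ℂ) 2) := ⟨fun f g => by ext v; exact hV.elim v⟩
    have : Subsingleton (lp (fun _ : V => ℂ) 2 →L[ℂ] lp (fun _ : V => ℂ) 2) :=
      ⟨fun f g => by ext1 ψ; exact Subsingleton.elim _ _⟩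
    simp [spectrum.of_subsingleton]
  obtain ⟨F, hF⟩ := id hvorb
  let vals : Finset ℝ := F.image Q
  have hvals : ∀ v, Q v ∈ vals := by
    intro v
    obtain ⟨u, hu, n, rfl⟩ := hF v
    rw [hQ]
    exact Finset.mem_image_of_mem Q hu
  choose P hPsa hP using fun a : ℝ => exists_proj {v : V | Q v = a}
  have hfin : ∀ a, {l : ℝ | (l : ℂ) ∈ spectrum ℂ (P a * H 0 * P a)}.Finite := by
    intro a
    have := finite_spectrum G hadj hvorb {v | Q v = a} (fun n v => by simp [hQ]) (P a * H 0 * P a)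
      (by
        intro ψ v
        change P a (H 0 (P a ψ)) v = _
        rw [hP]
        congr 1
        ext w
        rw [hH]
        simp only [zero_mul, Complex.ofReal_zero, zero_add]
        exact tsum_congr fun u => hP a ψ u) (comp_finite G Q a hno)
    exact Set.Finite.preimage Complex.ofReal_injective.injOn this
  let L : ℝ → Finset ℝ := fun a => (hfin a).toFinset
  let C : ℕ := ∑ a ∈ vals, (L a).card
  have hvol : ∀ ε : ℝ, 0 < ε → ∀ᶠ μ in atTop,
      volume {x : ℝ | (x : ℂ) ∈ spectrum ℂ (H μ)} ≤ ENNReal.ofReal (C * (2 * ε)) := by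
    intro ε hε
    filter_upwards [spectrum_near G Q H hH hsa vals hvals ⟨_, hvals v₀⟩ P hPsa hP ε hε] with μ hμ
    have hsub : {x : ℝ | (x : ℂ) ∈ spectrum ℂ (H μ)} ⊆
        ⋃ a ∈ vals, ⋃ l ∈ L a, Metric.ball (μ * a + l) ε := by
      intro x hx
      obtain ⟨a, ha, l, hl, hxl⟩ := hμ x hx
      simp only [Set.mem_iUnion]
      refine ⟨a, ha, l, (hfin a).mem_toFinset.mpr hl, ?_⟩
      rw [Metric.mem_ball, Real.dist_eq, ← sub_sub]
      exact hxl
    calc _ ≤ _ := measure_mono hsub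
      _ ≤ ∑ a ∈ vals, volume (⋃ l ∈ L a, Metric.ball (μ * a + l) ε) := measure_biUnion_finset_le _ _
      _ ≤ ∑ a ∈ vals, ∑ l ∈ L a, volume (Metric.ball (μ * a + l) ε) :=
        Finset.sum_le_sum fun a _ => measure_biUnion_finset_le _ _
      _ = ENNReal.ofReal (C * (2 * ε)) := by
        exact sum_ball vals L (fun a l => μ * a + l) ε
  have hlim : Tendsto (fun ε : ℝ => ENNReal.ofReal (C * (2 * ε))) (nhdsWithin 0 (Set.Ioi 0)) (nhds 0) := by
    have h1 : Continuous (fun ε : ℝ => ENNReal.ofReal (C * (2 * ε))) :=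
      ENNReal.continuous_ofReal.comp (by fun_prop)
    have := h1.tendsto 0
    simp only [mul_zero, ENNReal.ofReal_zero] at this
    exact this.mono_left nhdsWithin_le_nhds
  rw [ENNReal.tendsto_nhds_zero] at hlim ⊢
  intro δ hδ
  obtain ⟨ε, hε, hε0⟩ := ((hlim δ hδ).and self_mem_nhdsWithin).exists
  filter_upwards [hvol ε hε0] with μ hμ using hμ.trans hε

end backward

/-- **Theorem 1.1.** For a `ℤ^d`-periodic graph `G = (V, E)` and a periodic potential
`Q : V → ℝ`, the Lebesgue measure of the spectrum of `H_{μQ}` tends to `0` as `μ → ∞`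
if and only if `G` contains no `Q`-flat path with infinitely many vertices, i.e. there
is no infinite set `S ⊆ V` on which `Q` is constant and whose induced subgraph is
connected. -/
theorem measure_spectrum_tendsto_zero_iff_no_infinite_flat_path
    {d : ℕ} {V : Type} (G : SimpleGraph V) [AddAction (Fin d → ℤ) V]
    (hfree : ∀ (n : Fin d → ℤ) (v : V), n +ᵥ v = v → n = 0)
    (hadj : ∀ (n : Fin d → ℤ) (u v : V), G.Adj u v → G.Adj (n +ᵥ u) (n +ᵥ v))
    (hlocfin : ∀ v : V, {u : V | G.Adj u v}.Finite)
    (hvorb : ∃ F : Finset V, ∀ v : V, ∃ u ∈ F, ∃ n : Fin d → ℤ, v = n +ᵥ u)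
    (heorb : ∃ F : Finset (V × V), ∀ u v : V, G.Adj u v →
      ∃ e ∈ F, ∃ n : Fin d → ℤ, u = n +ᵥ e.1 ∧ v = n +ᵥ e.2)
    (hnta : ∀ (u : V) (n : Fin d → ℤ), ¬ G.Adj u (n +ᵥ u))
    (huniq : ∀ (u v : V) (n n' : Fin d → ℤ),
      G.Adj u (n +ᵥ v) → G.Adj u (n' +ᵥ v) → n = n')
    (Q : V → ℝ) (hQ : ∀ (n : Fin d → ℤ) (v : V), Q (n +ᵥ v) = Q v)
    (H : ℝ → (lp (fun _ : V => ℂ) 2 →L[ℂ] lp (fun _ : V => ℂ) 2))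
    (hH : ∀ (μ : ℝ) (ψ : lp (fun _ : V => ℂ) 2) (v : V),
      H μ ψ v = ((μ * Q v : ℝ) : ℂ) * ψ v + ∑' u : {u : V // G.Adj u v}, ψ (u : V))
    (hsa : ∀ μ : ℝ, IsSelfAdjoint (H μ)) :
    Tendsto (fun μ : ℝ => volume {x : ℝ | (x : ℂ) ∈ spectrum ℂ (H μ)}) atTop (nhds 0)
      ↔ ¬ ∃ S : Set V, S.Infinite ∧ (∃ a : ℝ, ∀ v ∈ S, Q v = a) ∧
          (G.induce S).Connected := by
  constructor
  · exact forward_dir G hfree hadj hlocfin hvorb Q hQ H hH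
  · exact backward_dir G hadj hvorb Q hQ H hH hsa
end

section
/- Let G = (V,E) be a ℤ^d-periodic graph and Q : V → ℝ a periodic potential, and assume G contains no Q-flat path with infinitely many vertices. Then there exist constants C > 0 and μ₀ > 0 such that for all μ ≥ μ₀ the Lebesgue measure of the spectrum of H_{μQ} is at most C/μ. In particular every spectral band of H_{μQ} near a point μa, for a in the range of Q, has length O(μ^{-1}). -/
open MeasureTheory Filter

open Classical in
theorem aux_exists_proj {V : Type} (s : Set V) :
    ∃ P : lp (fun _ : V => ℂ) 2 →L[ℂ] lp (fun _ : V => ℂ) 2, IsSelfAdjoint P ∧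
      ∀ ψ v, P ψ v = if v ∈ s then ψ v else 0 := by
  have hmem : ∀ ψ : lp (fun _ : V => ℂ) 2,
      Memℓp (fun v => if v ∈ s then ψ v else 0) 2 := by
    intro ψ
    have h2 : 0 < (2 : ENNReal).toReal := by norm_num
    have := (memℓp_gen_iff h2).1 (lp.memℓp ψ)
    refine memℓp_gen (this.of_nonneg_of_le (fun v => by positivity) ?_)
    intro v
    split_ifs
    · exact le_rfl
    · simp
  let L : lp (fun _ : V => ℂ) 2 →ₗ[ℂ] lp (fun _ : V => ℂ) 2 :=
    { toFun := fun ψ => ⟨fun v => if v ∈ s then ψ v else 0, hmem ψ⟩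
      map_add' := by
        intro x y
        ext v
        simp only [lp.coeFn_add, Pi.add_apply]
        split_ifs <;> simp
      map_smul' := by
        intro c x
        ext v
        simp only [lp.coeFn_smul, Pi.smul_apply, RingHom.id_apply]
        split_ifs <;> simp }
  have hL : ∀ ψ v, L ψ v = if v ∈ s then ψ v else 0 := fun ψ v => rfl
  refine ⟨L.mkContinuous 1 ?_, ?_, fun ψ v => rfl⟩
  · intro ψ
    rw [one_mul]
    apply lp.norm_mono (by norm_num)
    intro v
    rw [hL]
    split_ifs
    · exact le_rfl
    · simp
  · rw [ContinuousLinearMap.isSelfAdjoint_iff_isSymmetric]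
    intro x y
    simp only [ContinuousLinearMap.coe_coe, LinearMap.mkContinuous_apply]
    rw [lp.inner_eq_tsum, lp.inner_eq_tsum]
    congr 1
    ext v
    rw [hL, hL]
    split_ifs <;> simp

theorem aux_bddBelow {E : Type*} [NormedAddCommGroup E] [InnerProductSpace ℂ E] [CompleteSpace E]
    (B : E →L[ℂ] E) (hB : IsSelfAdjoint B) (y : ℂ) (r : ℝ) (hr : 0 < r)
    (h : ∀ z ∈ spectrum ℂ B, r ≤ ‖z - y‖) (φ : E) : r * ‖φ‖ ≤ ‖B φ - y • φ‖ := by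
  have hne : ∀ z ∈ spectrum ℂ B, z - y ≠ 0 := fun z hz => by
    have := h z hz
    intro h0
    rw [h0, norm_zero] at this
    linarith
  have hN : IsStarNormal B := hB.isStarNormal
  have hc : ContinuousOn (fun z : ℂ => (z - y)⁻¹) (spectrum ℂ B) :=
    ContinuousOn.inv₀ (by fun_prop) hne
  have hnorm : ‖cfc (fun z : ℂ => (z - y)⁻¹) B‖ ≤ r⁻¹ := by
    apply norm_cfc_le (by positivity)
    intro z hz
    rw [norm_inv]
    exact inv_anti₀ hr (h z hz)
  have hmul : cfc (fun z : ℂ => (z - y)⁻¹) B * (B - algebraMap ℂ _ y) = 1 := by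
    have h1 : B - algebraMap ℂ _ y = cfc (fun z : ℂ => z - y) B := by
      rw [cfc_sub (R := ℂ) (fun z => z) (fun _ => y) B continuousOn_id continuousOn_const,
        cfc_id' ℂ B hN, cfc_const y B hN]
    rw [h1, ← cfc_mul (R := ℂ) _ _ B hc (by fun_prop), ← cfc_one ℂ B hN]
    apply cfc_congr
    intro z hz
    exact inv_mul_cancel₀ (hne z hz)
  have h2 : φ = cfc (fun z : ℂ => (z - y)⁻¹) B (B φ - y • φ) := by
    have := congrArg (fun T : E →L[ℂ] E => T φ) hmul
    simpa [Algebra.algebraMap_eq_smul_one] using this.symm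
  have h3 : ‖φ‖ ≤ r⁻¹ * ‖B φ - y • φ‖ := by
    conv_lhs => rw [h2]
    exact ContinuousLinearMap.le_of_opNorm_le _ hnorm _
  rw [inv_mul_eq_div, le_div_iff₀ hr] at h3
  linarith

theorem aux_not_mem_spectrum {E : Type*} [NormedAddCommGroup E] [InnerProductSpace ℂ E]
    [CompleteSpace E] (T : E →L[ℂ] E) (hT : IsSelfAdjoint T) (x : ℝ) (c : ℝ) (hc : 0 < c)
    (h : ∀ ψ : E, c * ‖ψ‖ ≤ ‖T ψ - (x : ℂ) • ψ‖) : (x : ℂ) ∉ spectrum ℂ T := by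
  rw [spectrum.notMem_iff, ← IsUnit.neg_iff, neg_sub]
  set S := T - algebraMap ℂ (E →L[ℂ] E) (x : ℂ) with hS
  have hSa : IsSelfAdjoint S := by
    apply hT.sub
    rw [isSelfAdjoint_iff, ← algebraMap_star_comm]
    simp
  have hSb : ∀ ψ : E, c * ‖ψ‖ ≤ ‖S ψ‖ := by
    intro ψ
    simpa [hS, Algebra.algebraMap_eq_smul_one] using h ψ
  have hanti : AntilipschitzWith (⟨c, hc.le⟩⁻¹ : NNReal) S := by
    apply ContinuousLinearMap.antilipschitz_of_bound
    intro ψ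
    change ‖ψ‖ ≤ c⁻¹ * _
    rw [inv_mul_eq_div, le_div_iff₀ hc]
    linarith [hSb ψ]
  rw [ContinuousLinearMap.isUnit_iff_bijective,
    ContinuousLinearMap.bijective_iff_dense_range_and_antilipschitz]
  refine ⟨?_, _, hanti⟩
  rw [Submodule.topologicalClosure_eq_top_iff, Submodule.eq_bot_iff]
  intro φ hφ
  rw [ContinuousLinearMap.orthogonal_range, hSa.adjoint_eq] at hφ
  have : S φ = 0 := hφ
  have h1 := hSb φ
  rw [this, norm_zero] at h1
  have : ‖φ‖ ≤ 0 := by by_contra h0; push Not at h0; nlinarith [mul_pos hc h0]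
  simpa using this

theorem aux_commute_aeval {M : Type*} [AddCommGroup M] [Module ℂ M] (b τ : Module.End ℂ M)
    (h : ∀ f, b (τ f) = τ (b f)) (p : Polynomial ℂ) :
    ∀ f, Polynomial.aeval b p (τ f) = τ (Polynomial.aeval b p f) := by
  induction p using Polynomial.induction_on' with
  | add p q hp hq => intro f; simp [hp, hq]
  | monomial n a =>
    have hn : ∀ n : ℕ, ∀ f, (b ^ n) (τ f) = τ ((b ^ n) f) := by
      intro n
      induction n with
      | zero => intro f; simp
      | succ n ih => intro f; simp only [pow_succ, Module.End.mul_apply, h, ih]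
    intro f
    simp [Polynomial.aeval_monomial, hn]

theorem aux_coe_aeval {M : Type*} [AddCommGroup M] [Module ℂ M] {E : Type*}
    [NormedAddCommGroup E] [InnerProductSpace ℂ E] (b : Module.End ℂ M) (B : E →L[ℂ] E)
    (j : E →ₗ[ℂ] M) (h : ∀ f, b (j f) = j (B f)) (p : Polynomial ℂ) :
    ∀ f, Polynomial.aeval b p (j f) = j (Polynomial.aeval B p f) := by
  induction p using Polynomial.induction_on' with
  | add p q hp hq => intro f; simp [hp, hq]
  | monomial n a =>
    have hn : ∀ n : ℕ, ∀ f, (b ^ n) (j f) = j ((B ^ n) f) := by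
      intro n
      induction n with
      | zero => intro f; simp
      | succ n ih => intro f; simp only [pow_succ, Module.End.mul_apply,
          mul_apply_eq_comp, h, ih]
    intro f
    simp [Polynomial.aeval_monomial, hn, Algebra.algebraMap_eq_smul_one]

open Classical in
theorem aux_finite_spectrum {d : ℕ} {V : Type} [AddAction (Fin d → ℤ) V]
    (F : Finset V) (hF : ∀ v : V, ∃ u ∈ F, ∃ n : Fin d → ℤ, v = n +ᵥ u)
    (N : V → Finset V) (hN : ∀ (n : Fin d → ℤ) u v, n +ᵥ u ∈ N (n +ᵥ v) ↔ u ∈ N v)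
    (S : V → Set V) (hS : ∀ v, (S v).Finite) (hvS : ∀ v, v ∈ S v)
    (hSN : ∀ v, ∀ u ∈ S v, ∀ w ∈ N u, w ∈ S v)
    (B : lp (fun _ : V => ℂ) 2 →L[ℂ] lp (fun _ : V => ℂ) 2)
    (hB : ∀ ψ v, B ψ v = ∑ u ∈ N v, ψ u) : (spectrum ℂ B).Finite := by
  let b : Module.End ℂ (V → ℂ) := LinearMap.pi fun v => ∑ u ∈ N v, LinearMap.proj u
  have hb : ∀ f v, b f v = ∑ u ∈ N v, f u := by intro f v; simp [b]
  let j : lp (fun _ : V => ℂ) 2 →ₗ[ℂ] (V → ℂ) :=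
    { toFun := fun f => f, map_add' := fun f g => rfl, map_smul' := fun c f => rfl }
  have hj : ∀ f, b (j f) = j (B f) := by
    intro f; ext v; rw [hb]; exact (hB f v).symm
  have key : ∀ v : V, ∃ p : Polynomial ℂ, p ≠ 0 ∧ ∀ f, Polynomial.aeval b p f v = 0 := by
    intro v
    let W : Submodule ℂ ((V → ℂ) →ₗ[ℂ] ℂ) :=
      Submodule.span ℂ ((fun u => (LinearMap.proj u : (V → ℂ) →ₗ[ℂ] ℂ)) '' S v)
    have hWf : FiniteDimensional ℂ W := FiniteDimensional.span_of_finite ℂ ((hS v).image _)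
    have hWb : ∀ l ∈ W, l ∘ₗ b ∈ W := by
      intro l hl
      induction hl using Submodule.span_induction with
      | mem x hx =>
        obtain ⟨u, hu, rfl⟩ := hx
        have : (LinearMap.proj u : (V → ℂ) →ₗ[ℂ] ℂ) ∘ₗ b
            = ∑ w ∈ N u, (LinearMap.proj w : (V → ℂ) →ₗ[ℂ] ℂ) := by
          ext f; simp [hb]
        simp only [this]
        exact Submodule.sum_mem _ fun w hw =>
          Submodule.subset_span ⟨w, hSN v u hu w hw, rfl⟩
      | zero => simp
      | add x y _ _ hx hy => rw [LinearMap.add_comp]; exact W.add_mem hx hy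
      | smul a x _ hx => rw [LinearMap.smul_comp]; exact W.smul_mem _ hx
    have hWn : ∀ n : ℕ, ∀ l ∈ W, l ∘ₗ (b ^ n) ∈ W := by
      intro n
      induction n with
      | zero => intro l hl; rw [pow_zero, Module.End.one_eq_id, LinearMap.comp_id]; exact hl
      | succ n ih =>
        intro l hl
        rw [pow_succ, Module.End.mul_eq_comp, ← LinearMap.comp_assoc]
        exact hWb _ (ih l hl)
    have hWp : ∀ p : Polynomial ℂ, LinearMap.proj v ∘ₗ (Polynomial.aeval b p) ∈ W := by
      intro p
      induction p using Polynomial.induction_on' with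
      | add p q hp hq => rw [map_add, LinearMap.comp_add]; exact W.add_mem hp hq
      | monomial n a =>
        have : (LinearMap.proj v : (V → ℂ) →ₗ[ℂ] ℂ) ∘ₗ
            (Polynomial.aeval b (Polynomial.monomial n a))
            = a • ((LinearMap.proj v : (V → ℂ) →ₗ[ℂ] ℂ) ∘ₗ (b ^ n)) := by
          ext f; simp [Polynomial.aeval_monomial]
        rw [this]
        exact W.smul_mem _ (hWn n _ (Submodule.subset_span ⟨v, hvS v, rfl⟩))
    let Φ : Polynomial ℂ →ₗ[ℂ] W :=
      { toFun := fun p => ⟨_, hWp p⟩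
        map_add' := by intro p q; ext f; simp
        map_smul' := by intro c p; ext f; simp }
    have hni : ¬ Function.Injective Φ := by
      intro hi
      exact Polynomial.not_finite (R := ℂ) (Module.Finite.of_injective Φ hi)
    rw [← LinearMap.ker_eq_bot, Submodule.eq_bot_iff] at hni
    push Not at hni
    obtain ⟨p, hp, hp0⟩ := hni
    refine ⟨p, hp0, fun f => ?_⟩
    have h1 : Φ p = 0 := hp
    have h2 := congrArg (fun w : W => (w : (V → ℂ) →ₗ[ℂ] ℂ) f) h1
    exact h2
  choose p hp0 hp using key
  let P : Polynomial ℂ := ∏ v ∈ F, p v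
  have hP0 : P ≠ 0 := Finset.prod_ne_zero_iff.2 fun v _ => hp0 v
  have hPb : ∀ f, Polynomial.aeval b P f = 0 := by
    intro f
    ext w
    obtain ⟨v, hv, n, rfl⟩ := hF w
    let τ : Module.End ℂ (V → ℂ) := LinearMap.funLeft ℂ ℂ (fun v => n +ᵥ v)
    have hτ : ∀ f, b (τ f) = τ (b f) := by
      intro f
      ext u
      change b (τ f) u = b f (n +ᵥ u)
      rw [hb, hb]
      refine Finset.sum_bij (fun x _ => n +ᵥ x) ?_ ?_ ?_ ?_
      · intro x hx; exact (hN n x u).2 hx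
      · intro x _ y _ hxy; exact vadd_left_cancel n hxy
      · intro y hy
        refine ⟨-n +ᵥ y, ?_, by simp⟩
        rw [← hN n]; simpa using hy
      · intro x _; rfl
    have h1 := congrFun (aux_commute_aeval b τ hτ P f) v
    have h2 : Polynomial.aeval b P (τ f) v = 0 := by
      have : P = p v * ∏ w ∈ F.erase v, p w := (Finset.mul_prod_erase F p hv).symm
      rw [this, map_mul, Module.End.mul_apply, hp]
    rw [h2] at h1
    exact h1.symm
  have hPB : Polynomial.aeval B P = 0 := by
    ext f v
    have h1 := aux_coe_aeval b B j hj P f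
    rw [hPb] at h1
    exact (congrFun h1 v).symm
  rcases subsingleton_or_nontrivial (lp (fun _ : V => ℂ) 2) with h | h
  · rw [spectrum.of_subsingleton]; exact Set.finite_empty
  · refine (P.roots.toFinset.finite_toSet).subset ?_
    intro z hz
    have h1 := spectrum.subset_polynomial_aeval B P ⟨z, hz, rfl⟩
    rw [hPB, spectrum.zero_eq] at h1
    simp [hP0]
    exact h1

theorem aux_estimate {E : Type*} [NormedAddCommGroup E] [InnerProductSpace ℂ E]
    [CompleteSpace E] {ι : Type*} [Fintype ι] [DecidableEq ι] (P : ι → (E →L[ℂ] E))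
    (hPs : ∀ i, IsSelfAdjoint (P i)) (hPP : ∀ i k, P i * P k = if i = k then P i else 0)
    (hsum : ∑ i, P i = 1) (q : ι → ℝ) (A : E →L[ℂ] E) (hA : IsSelfAdjoint A)
    (δ : ℝ) (hδ : 0 < δ) (hq : ∀ i k, i ≠ k → δ ≤ |q i - q k|)
    (M L K : ℝ) (hM : M = ‖A‖) (hL : L = 2 * Fintype.card ι / δ) (hK : K = 2 * (M * L * M) + 2)
    (μ : ℝ) (hμ : 2 * L * M + 1 ≤ μ) (x : ℝ)
    (hx : ∀ i, ∀ z ∈ spectrum ℂ (∑ i, P i * A * P i), K / μ ≤ ‖z - ((x - μ * q i : ℝ) : ℂ)‖) :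
    (x : ℂ) ∉ spectrum ℂ (A + ∑ i, ((μ * q i : ℝ) : ℂ) • P i) := by
  have hM0 : 0 ≤ M := hM ▸ norm_nonneg _
  have hL0 : 0 ≤ L := by rw [hL]; positivity
  have hK0 : 0 < K := by rw [hK]; positivity
  have hμ0 : 0 < μ := by nlinarith [mul_nonneg hL0 hM0]
  have hP1 : ∀ i ψ, ‖P i ψ‖ ≤ ‖ψ‖ := by
    intro i ψ
    have h1 : ‖P i‖ ≤ 1 := by
      apply IsStarProjection.norm_le
      refine ⟨?_, hPs i⟩
      have := hPP i i
      rwa [if_pos rfl] at this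
    simpa using ContinuousLinearMap.le_of_opNorm_le _ h1 ψ
  have hPPa : ∀ i k ψ, P i (P k ψ) = if i = k then P i ψ else 0 := by
    intro i k ψ
    have := congrArg (fun T : E →L[ℂ] E => T ψ) (hPP i k)
    simp only [mul_apply_eq_comp] at this
    rw [this]
    split_ifs <;> rfl
  have hsuma : ∀ ψ, ∑ i, P i ψ = ψ := by
    intro ψ
    have := congrArg (fun T : E →L[ℂ] E => T ψ) hsum
    simpa using this
  have hBs : IsSelfAdjoint (∑ i, P i * A * P i) := by
    rw [isSelfAdjoint_iff, star_sum]
    refine Finset.sum_congr rfl fun i _ => ?_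
    rw [star_mul, star_mul, (hPs i).star_eq, hA.star_eq, mul_assoc]
  set T := A + ∑ i, ((μ * q i : ℝ) : ℂ) • P i with hT
  have hTs : IsSelfAdjoint T := by
    apply hA.add
    rw [isSelfAdjoint_iff, star_sum]
    refine Finset.sum_congr rfl fun i _ => ?_
    rw [star_smul, (hPs i).star_eq]
    simp
  have hPT : ∀ k ψ, P k (T ψ - (x : ℂ) • ψ)
      = P k (A ψ) + ((μ * q k - x : ℝ) : ℂ) • P k ψ := by
    intro k ψ
    simp only [hT, _root_.add_apply, map_sub, map_add, map_smul,
      _root_.sum_apply, map_sum, _root_.smul_apply, hPPa]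
    simp only [smul_ite, smul_zero, Finset.sum_ite_eq, Finset.mem_univ, if_true]
    rw [add_sub_assoc, ← sub_smul]
    push_cast
    rfl
  have hAn : ∀ ψ, ‖A ψ‖ ≤ M * ‖ψ‖ := fun ψ => hM ▸ A.le_opNorm ψ
  set D := 1 + (M + K / μ) * (L / μ) with hD
  have hD0 : 0 < D := by positivity
  refine aux_not_mem_spectrum T hTs x (1 / μ / D) (by positivity) ?_
  intro ψ
  rw [div_mul_eq_mul_div, div_le_iff₀ hD0]
  set η := ‖T ψ - (x : ℂ) • ψ‖ with hη
  have hη0 : 0 ≤ η := norm_nonneg _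
  rcases isEmpty_or_nonempty ι with hι | hι
  · have : ψ = 0 := by rw [← hsuma ψ]; simp
    rw [this]; simp; positivity
  obtain ⟨i, hi⟩ := Finite.exists_min (fun i => |μ * q i - x|)
  have hgap : ∀ k, k ≠ i → μ * δ / 2 ≤ |μ * q k - x| := by
    intro k hk
    have h1 := mul_le_mul_of_nonneg_left (hq k i hk) hμ0.le
    rw [← abs_of_pos hμ0, ← abs_mul, abs_of_pos hμ0] at h1
    have h2 : |μ * (q k - q i)| ≤ |μ * q k - x| + |μ * q i - x| := by
      have : μ * (q k - q i) = (μ * q k - x) - (μ * q i - x) := by ring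
      rw [this]; exact abs_sub _ _
    have := hi k
    linarith
  have hk : ∀ k, k ≠ i → ‖P k ψ‖ ≤ 2 / (μ * δ) * (M * ‖ψ‖ + η) := by
    intro k hk
    have h1 : ((μ * q k - x : ℝ) : ℂ) • P k ψ = P k (T ψ - (x : ℂ) • ψ) - P k (A ψ) := by
      rw [hPT]; abel
    have h2 : |μ * q k - x| * ‖P k ψ‖ ≤ η + M * ‖ψ‖ := by
      have h3 := congrArg norm h1
      rw [norm_smul, Complex.norm_real, Real.norm_eq_abs] at h3
      rw [h3]
      refine (norm_sub_le _ _).trans (add_le_add (hP1 _ _) ((hP1 _ _).trans (hAn _)))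
    have h4 := mul_le_mul_of_nonneg_right (hgap k hk) (norm_nonneg (P k ψ))
    rw [div_mul_eq_mul_div, le_div_iff₀ (by positivity)]
    linarith
  set χ := ∑ k ∈ Finset.univ.erase i, P k ψ with hχ
  have hψ : ψ = P i ψ + χ := by
    rw [hχ, Finset.add_sum_erase _ (fun k => P k ψ) (Finset.mem_univ i), hsuma]
  have hχn : ‖χ‖ ≤ L / μ * (M * ‖ψ‖ + η) := by
    calc ‖χ‖ ≤ ∑ k ∈ Finset.univ.erase i, ‖P k ψ‖ := norm_sum_le _ _
      _ ≤ ∑ k ∈ Finset.univ.erase i, 2 / (μ * δ) * (M * ‖ψ‖ + η) :=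
          Finset.sum_le_sum fun k hk' => hk k (Finset.ne_of_mem_erase hk')
      _ ≤ ∑ k : ι, 2 / (μ * δ) * (M * ‖ψ‖ + η) :=
          Finset.sum_le_sum_of_subset_of_nonneg (Finset.erase_subset _ _)
            (fun _ _ _ => by positivity)
      _ = L / μ * (M * ‖ψ‖ + η) := by
          rw [Finset.sum_const, nsmul_eq_mul, hL, Finset.card_univ]
          field_simp
  have hBφ : (∑ i, P i * A * P i) (P i ψ) = P i (A (P i ψ)) := by
    simp only [_root_.sum_apply, mul_apply_eq_comp, hPPa]
    rw [Finset.sum_eq_single i]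
    · simp
    · intro k _ hki; simp [hki]
    · simp
  have h5 := aux_bddBelow _ hBs ((x - μ * q i : ℝ) : ℂ) (K / μ) (by positivity) (hx i) (P i ψ)
  have h6 : (∑ i, P i * A * P i) (P i ψ) - ((x - μ * q i : ℝ) : ℂ) • P i ψ
      = P i (T ψ - (x : ℂ) • ψ) - P i (A χ) := by
    rw [hBφ, hPT]
    have : A χ = A ψ - A (P i ψ) := by
      rw [← map_sub]; congr 1; rw [eq_sub_iff_add_eq, add_comm]; exact hψ.symm
    rw [this, map_sub]
    have h7 : ((μ * q i - x : ℝ) : ℂ) = - ((x - μ * q i : ℝ) : ℂ) := by push_cast; ring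
    rw [h7, neg_smul]
    abel
  rw [h6] at h5
  have h8 : K / μ * ‖P i ψ‖ ≤ η + M * ‖χ‖ := h5.trans
    ((norm_sub_le _ _).trans (add_le_add (hP1 _ _) ((hP1 _ _).trans (hAn _))))
  have h9 : ‖ψ‖ ≤ ‖P i ψ‖ + ‖χ‖ := by
    conv_lhs => rw [hψ]
    exact norm_add_le _ _
  have hκ : 0 ≤ K / μ := by positivity
  have h10 : K / μ * ‖ψ‖ ≤ η + (M + K / μ) * ‖χ‖ := by nlinarith
  have h11 : (M + K / μ) * ‖χ‖ ≤ (M + K / μ) * (L / μ * (M * ‖ψ‖ + η)) :=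
    mul_le_mul_of_nonneg_left hχn (by positivity)
  have h12 : (M + K / μ) * (L / μ) * M ≤ (K - 1) / μ := by
    have : K / μ * (L * M) ≤ K / 2 := by
      rw [div_mul_eq_mul_div, div_le_div_iff₀ hμ0 (by norm_num)]
      nlinarith
    rw [le_div_iff₀ hμ0]
    have e : (M + K / μ) * (L / μ) * M * μ = M * L * M + K / μ * (L * M) := by
      field_simp
    rw [e]
    linarith
  have h13 := mul_le_mul_of_nonneg_right h12 (norm_nonneg ψ)
  have e2 : (K - 1) / μ = K / μ - 1 / μ := by ring
  rw [e2] at h13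
  rw [hD]
  nlinarith

theorem aux_main {E : Type*} [NormedAddCommGroup E] [InnerProductSpace ℂ E]
    [CompleteSpace E] {ι : Type*} [Fintype ι] [DecidableEq ι] (P : ι → (E →L[ℂ] E))
    (hPs : ∀ i, IsSelfAdjoint (P i)) (hPP : ∀ i k, P i * P k = if i = k then P i else 0)
    (hsum : ∑ i, P i = 1) (q : ι → ℝ) (hq : Function.Injective q) (A : E →L[ℂ] E)
    (hA : IsSelfAdjoint A) (hfin : (spectrum ℂ (∑ i, P i * A * P i)).Finite) :
    ∃ C > (0 : ℝ), ∃ μ₀ > (0 : ℝ), ∀ μ ≥ μ₀,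
      volume {x : ℝ | (x : ℂ) ∈ spectrum ℂ (A + ∑ i, ((μ * q i : ℝ) : ℂ) • P i)}
        ≤ ENNReal.ofReal (C / μ) := by
  obtain ⟨δ, hδ, hδq⟩ : ∃ δ > 0, ∀ i k, i ≠ k → δ ≤ |q i - q k| := by
    let s : Finset (ι × ι) := Finset.univ.filter fun p => p.1 ≠ p.2
    rcases s.eq_empty_or_nonempty with hs | hs
    · refine ⟨1, one_pos, fun i k hik => ?_⟩
      have : (i, k) ∈ s := by simp [s, hik]
      rw [hs] at this
      simp at this
    · obtain ⟨p, hp, hmin⟩ := s.exists_min_image (fun p => |q p.1 - q p.2|) hs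
      refine ⟨|q p.1 - q p.2|, ?_, fun i k hik => hmin (i, k) (by simp [s, hik])⟩
      rw [gt_iff_lt, abs_pos, sub_ne_zero]
      intro h
      simp only [s, Finset.mem_filter] at hp
      exact hp.2 (hq h)
  set M := ‖A‖ with hM
  set L := 2 * Fintype.card ι / δ with hL
  set K := 2 * (M * L * M) + 2 with hK
  have hM0 : 0 ≤ M := norm_nonneg _
  have hL0 : 0 ≤ L := by positivity
  have hK0 : 0 < K := by positivity
  set Z := hfin.toFinset with hZ
  refine ⟨Fintype.card ι * Z.card * (2 * K) + 1, by positivity, 2 * L * M + 1, by positivity, ?_⟩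
  intro μ hμ
  have hμ0 : 0 < μ := lt_of_lt_of_le (by positivity) hμ
  have hsub : {x : ℝ | (x : ℂ) ∈ spectrum ℂ (A + ∑ i, ((μ * q i : ℝ) : ℂ) • P i)} ⊆
      ⋃ p ∈ (Finset.univ : Finset ι) ×ˢ Z, Metric.closedBall (μ * q p.1 + p.2.re) (K / μ) := by
    intro x hx
    by_contra hcon
    refine aux_estimate P hPs hPP hsum q A hA δ hδ hδq M L K hM hL hK μ hμ x ?_ hx
    intro i z hz
    by_contra hlt
    push Not at hlt
    apply hcon
    simp only [Set.mem_iUnion]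
    refine ⟨(i, z), by simp [hZ, hz], ?_⟩
    rw [Metric.mem_closedBall, Real.dist_eq]
    refine le_trans ?_ hlt.le
    refine le_trans (le_of_eq ?_) (Complex.abs_re_le_norm _)
    rw [Complex.sub_re, Complex.ofReal_re, ← abs_neg]
    congr 1; ring
  calc volume _ ≤ volume (⋃ p ∈ (Finset.univ : Finset ι) ×ˢ Z,
        Metric.closedBall (μ * q p.1 + p.2.re) (K / μ)) := measure_mono hsub
    _ ≤ ∑ p ∈ (Finset.univ : Finset ι) ×ˢ Z,
        volume (Metric.closedBall (μ * q p.1 + p.2.re) (K / μ)) :=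
        measure_biUnion_finset_le _ _
    _ = ENNReal.ofReal (Fintype.card ι * Z.card * (2 * (K / μ))) := by
        simp only [Real.volume_closedBall, Finset.sum_const, Finset.card_product, Finset.card_univ]
        rw [← ENNReal.ofReal_nsmul, nsmul_eq_mul]
        push_cast
        rfl
    _ ≤ _ := by
        apply ENNReal.ofReal_le_ofReal
        rw [le_div_iff₀ hμ0]
        have : (Fintype.card ι * Z.card * (2 * (K / μ))) * μ
          = Fintype.card ι * Z.card * (2 * K) := by field_simp
        rw [this]; linarith

/-- If `G` contains no `Q`-flat path with infinitely many vertices, then there are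
constants `C > 0` and `μ₀ > 0` such that `Leb σ(H_{μQ}) ≤ C / μ` for all `μ ≥ μ₀`. -/
theorem measure_spectrum_le_of_no_infinite_flat_path
    {d : ℕ} {V : Type} (G : SimpleGraph V) [AddAction (Fin d → ℤ) V]
    -- the action is free
    (hfree : ∀ (n : Fin d → ℤ) (v : V), n +ᵥ v = v → n = 0)
    -- the action preserves adjacency
    (hadj : ∀ (n : Fin d → ℤ) (u v : V), G.Adj u v → G.Adj (n +ᵥ u) (n +ᵥ v))
    -- the graph is locally finite
    (hlocfin : ∀ v : V, {u : V | G.Adj u v}.Finite)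
    -- finitely many orbits of vertices
    (hvorb : ∃ F : Finset V, ∀ v : V, ∃ u ∈ F, ∃ n : Fin d → ℤ, v = n +ᵥ u)
    -- finitely many orbits of edges
    (heorb : ∃ F : Finset (V × V), ∀ u v : V, G.Adj u v →
      ∃ e ∈ F, ∃ n : Fin d → ℤ, u = n +ᵥ e.1 ∧ v = n +ᵥ e.2)
    -- no vertex is adjacent to one of its own translates
    (hnta : ∀ (u : V) (n : Fin d → ℤ), ¬ G.Adj u (n +ᵥ u))
    -- for every pair of vertices there is at most one connecting translate
    (huniq : ∀ (u v : V) (n n' : Fin d → ℤ),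
      G.Adj u (n +ᵥ v) → G.Adj u (n' +ᵥ v) → n = n')
    -- `Q` is a periodic potential
    (Q : V → ℝ) (hQ : ∀ (n : Fin d → ℤ) (v : V), Q (n +ᵥ v) = Q v)
    -- `H μ` is the bounded self-adjoint operator `H_{μQ}` on `ℓ²(V)`
    (H : ℝ → (lp (fun _ : V => ℂ) 2 →L[ℂ] lp (fun _ : V => ℂ) 2))
    (hH : ∀ (μ : ℝ) (ψ : lp (fun _ : V => ℂ) 2) (v : V),
      H μ ψ v = ((μ * Q v : ℝ) : ℂ) * ψ v + ∑' u : {u : V // G.Adj u v}, ψ (u : V))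
    (hsa : ∀ μ : ℝ, IsSelfAdjoint (H μ))
    -- `G` contains no `Q`-flat path with infinitely many vertices
    (hflat : ¬ ∃ S : Set V, S.Infinite ∧ (∃ a : ℝ, ∀ v ∈ S, Q v = a) ∧
      (G.induce S).Connected) :
    ∃ C > (0 : ℝ), ∃ μ₀ > (0 : ℝ), ∀ μ ≥ μ₀,
      volume {x : ℝ | (x : ℂ) ∈ spectrum ℂ (H μ)} ≤ ENNReal.ofReal (C / μ) := by
  classical
  obtain ⟨F, hF⟩ := hvorb
  have hfr : (Set.range Q).Finite := by
    refine ((F.finite_toSet).image Q).subset ?_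
    rintro _ ⟨v, rfl⟩
    obtain ⟨u, hu, n, rfl⟩ := hF v
    exact ⟨u, hu, (hQ n u).symm⟩
  have : Fintype (Set.range Q) := hfr.fintype
  choose P0 hP0s hP0 using fun a : ℝ => aux_exists_proj {v : V | Q v = a}
  have hP0' : ∀ a ψ v, P0 a ψ v = if Q v = a then ψ v else 0 := by
    intro a ψ v; rw [hP0]; rfl
  let P : Set.range Q → (lp (fun _ : V => ℂ) 2 →L[ℂ] lp (fun _ : V => ℂ) 2) := fun i => P0 i
  have hP : ∀ i ψ v, P i ψ v = if Q v = i then ψ v else 0 := fun i ψ v => hP0' i ψ v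
  have hsel : ∀ (v : V) (g : Set.range Q → ℂ),
      ∑ i : Set.range Q, (if Q v = (i : ℝ) then g i else 0) = g ⟨Q v, v, rfl⟩ := by
    intro v g
    rw [Finset.sum_eq_single ⟨Q v, v, rfl⟩]
    · simp
    · intro i _ hi
      rw [if_neg]
      intro h
      exact hi (Subtype.ext h.symm)
    · simp
  have hsumap : ∀ (T : Set.range Q → (lp (fun _ : V => ℂ) 2 →L[ℂ] lp (fun _ : V => ℂ) 2))
      (ψ : lp (fun _ : V => ℂ) 2) (v : V), (∑ i, T i) ψ v = ∑ i, T i ψ v := by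
    intro T ψ v
    rw [_root_.sum_apply, lp.coeFn_sum, Finset.sum_apply]
  have hH' : ∀ μ, H μ = H 0 + ∑ i : Set.range Q, ((μ * (i : ℝ) : ℝ) : ℂ) • P i := by
    intro μ
    ext ψ v
    rw [_root_.add_apply, lp.coeFn_add, Pi.add_apply, hsumap, hH, hH]
    have h1 : ∀ i : Set.range Q, ((((μ * (i : ℝ) : ℝ) : ℂ) • P i) ψ) v
        = if Q v = (i : ℝ) then ((μ * (i : ℝ) : ℝ) : ℂ) * ψ v else 0 := by
      intro i
      rw [_root_.smul_apply, lp.coeFn_smul, Pi.smul_apply, hP, smul_ite, smul_zero, smul_eq_mul]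
    rw [Finset.sum_congr rfl fun i _ => h1 i, hsel]
    simp
    ring
  let N : V → Finset V := fun v => (hlocfin v).toFinset.filter fun u => Q u = Q v
  have hNmem : ∀ u v, u ∈ N v ↔ G.Adj u v ∧ Q u = Q v := by intro u v; simp [N]
  have htsum : ∀ (v : V) (f : V → ℂ), ∑' u : {u : V // G.Adj u v}, f u
      = ∑ u ∈ (hlocfin v).toFinset, f u := by
    intro v f
    have : Fintype {u : V // G.Adj u v} := (hlocfin v).fintype
    rw [tsum_fintype]
    exact (Finset.sum_subtype _ (fun u => by simp) f).symm
  have hB : ∀ ψ v, (∑ i, P i * H 0 * P i) ψ v = ∑ u ∈ N v, ψ u := by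
    intro ψ v
    rw [hsumap]
    have h1 : ∀ i : Set.range Q, ((P i * H 0 * P i) ψ) v
        = if Q v = (i : ℝ) then H 0 (P i ψ) v else 0 := by
      intro i
      rw [mul_apply_eq_comp, mul_apply_eq_comp, hP]
    rw [Finset.sum_congr rfl fun i _ => h1 i, hsel, hH, htsum, Finset.sum_filter]
    simp [hP]
  let G' : SimpleGraph V :=
    { Adj := fun u v => G.Adj u v ∧ Q u = Q v
      symm := ⟨fun u v h => ⟨h.1.symm, h.2.symm⟩⟩
      loopless := ⟨fun u h => G.loopless.irrefl u h.1⟩ }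
  let S : V → Set V := fun v => (G'.connectedComponentMk v).supp
  have hSr : ∀ v u, u ∈ S v ↔ G'.Reachable u v := by
    intro v u
    simp [S]
  have hQr : ∀ u v, G'.Reachable u v → Q u = Q v := by
    rintro u v ⟨w⟩
    induction w with
    | nil => rfl
    | cons h _ ih => exact h.2.trans ih
  have hSfin : ∀ v, (S v).Finite := by
    intro v
    by_contra hinf
    refine hflat ⟨S v, hinf, ⟨Q v, fun u hu => hQr u v ((hSr v u).1 hu)⟩, ?_⟩
    have h1 : (G'.induce (S v)).Connected :=
      SimpleGraph.ConnectedComponent.connected_toSimpleGraph (G'.connectedComponentMk v)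
    refine h1.mono ?_
    intro a b hab
    exact hab.1
  have hadj' : ∀ (n : Fin d → ℤ) (u v : V), G.Adj (n +ᵥ u) (n +ᵥ v) ↔ G.Adj u v := by
    intro n u v
    refine ⟨fun h => ?_, hadj n u v⟩
    simpa using hadj (-n) _ _ h
  have hfin : (spectrum ℂ (∑ i, P i * H 0 * P i)).Finite := by
    refine aux_finite_spectrum F hF N ?_ S hSfin ?_ ?_ _ hB
    · intro n u v
      rw [hNmem, hNmem, hadj', hQ, hQ]
    · intro v; rw [hSr]
    · intro v u hu w hw
      rw [hSr] at hu ⊢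
      have : G'.Adj w u := (hNmem w u).1 hw
      exact this.reachable.trans hu
  have := aux_main P (fun i => hP0s i) ?_ ?_ (fun i => (i : ℝ)) Subtype.val_injective
    (H 0) (hsa 0) hfin
  · obtain ⟨C, hC, μ₀, hμ₀, h⟩ := this
    refine ⟨C, hC, μ₀, hμ₀, fun μ hμ => ?_⟩
    rw [hH' μ]
    exact h μ hμ
  · intro i k
    ext ψ v
    rw [mul_apply_eq_comp, hP, hP]
    by_cases hik : i = k
    · subst hik
      rw [if_pos rfl, hP]
      split_ifs <;> rfl
    · rw [if_neg hik]
      by_cases h1 : Q v = i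
      · rw [if_pos h1, if_neg]
        · rfl
        · intro h2; exact hik (Subtype.ext (h1.symm.trans h2))
      · rw [if_neg h1]; rfl
  · ext ψ v
    rw [hsumap, Finset.sum_congr rfl fun i _ => hP i ψ v, hsel]
    rfl
end

section
/- Let G = (V,E) be a ℤ^d-periodic graph and Q : V → ℝ a periodic potential, and assume G contains a Q-flat path with infinitely many vertices. Then there exist constants c > 0 and μ₀ > 0 such that for all μ ≥ μ₀ the Lebesgue measure of the spectrum of H_{μQ} is at least c; in particular Leb σ(H_{μQ}) does not tend to 0 as μ → ∞. -/
open MeasureTheory Filter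
namespace FlatPath
open Polynomial

/-- number of negative eigenvalues -/
noncomputable def ncount {n : Type*} [Fintype n] [DecidableEq n] (M : Matrix n n ℂ) : ℕ :=
  (M.charpoly.roots.filter (fun z => z.re < 0)).card

lemma ncount_of_prod {n m : Type*} [Fintype n] [DecidableEq n] [Fintype m] (M : Matrix n n ℂ)
    (c : m → ℝ) (h : M.charpoly = ∏ i, (X - C (c i : ℂ))) :
    ncount M = (Finset.univ.filter (fun i => c i < 0)).card := by
  classical
  unfold ncount
  have h2 : (∏ i, (X - C (c i : ℂ))) =
      ((Finset.univ.val.map (fun i => (c i : ℂ))).map (fun a => X - C a)).prod := by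
    rw [Multiset.map_map]; rfl
  rw [h, h2, Polynomial.roots_multiset_prod_X_sub_C, Multiset.filter_map, Multiset.card_map]
  simp only [Function.comp_def, Complex.ofReal_re]
  rfl

lemma trace_aeval {n : Type*} [Fintype n] [DecidableEq n] {M : Matrix n n ℂ} (hM : M.IsHermitian)
    (p : ℝ[X]) : (aeval M p).trace = ((∑ i, p.eval (hM.eigenvalues i) : ℝ) : ℂ) := by
  have key : ∀ k : ℕ, (M ^ k).trace = ∑ i, ((hM.eigenvalues i : ℂ)) ^ k := by
    intro k
    conv_lhs => rw [hM.spectral_theorem, ← map_pow, Matrix.diagonal_pow]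
    rw [Unitary.conjStarAlgAut_apply, Matrix.trace_mul_cycle]
    simp
  rw [Polynomial.aeval_eq_sum_range, Matrix.trace_sum]
  simp only [Matrix.trace_smul, key, Polynomial.eval_eq_sum_range]
  push_cast
  rw [Finset.sum_comm]
  simp [Finset.mul_sum]

lemma trace_pow_herm {n : Type*} [Fintype n] [DecidableEq n] {M : Matrix n n ℂ} (hM : M.IsHermitian)
    (k : ℕ) : (M ^ k).trace = ∑ i, ((hM.eigenvalues i : ℂ)) ^ k := by
  have := trace_aeval hM (X ^ k)
  simpa using this

lemma ncount_herm {n : Type*} [Fintype n] [DecidableEq n] {M : Matrix n n ℂ} (hM : M.IsHermitian) :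
    ncount M = (Finset.univ.filter (fun i => hM.eigenvalues i < 0)).card :=
  ncount_of_prod M _ hM.charpoly_eq

lemma ncount_sub_scalar {n : Type*} [Fintype n] [DecidableEq n] {M : Matrix n n ℂ}
    (hM : M.IsHermitian) (z : ℝ) :
    (M - Matrix.scalar n (z : ℂ)).charpoly = ∏ i, (X - C ((hM.eigenvalues i - z : ℝ) : ℂ)) := by
  rw [Matrix.charpoly_sub_scalar, hM.charpoly_eq, Polynomial.prod_comp]
  refine Finset.prod_congr rfl fun i _ => ?_
  simp
  ring

/-- local constancy of the number of negative eigenvalues at an invertible point -/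
lemma ncount_eventually {n : Type*} [Fintype n] [DecidableEq n] {Y : Type*} [TopologicalSpace Y]
    (M : Y → Matrix n n ℂ) (hc : Continuous M) (hM : ∀ y, (M y).IsHermitian) (y₀ : Y)
    (hdet : (M y₀).det ≠ 0) : ∀ᶠ y in nhds y₀, ncount (M y) = ncount (M y₀) := by
  have hpow : ∀ p : ℝ[X], Continuous fun y => ∑ i, p.eval ((hM y).eigenvalues i) := by
    intro p
    have h1 : Continuous fun y => (aeval (M y) p).trace := by
      refine Continuous.matrix_trace ?_
      simp only [Polynomial.aeval_eq_sum_range]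
      fun_prop
    have h2 := Complex.continuous_re.comp h1
    refine h2.congr fun y => ?_
    simp only [Function.comp]
    rw [trace_aeval (hM y)]
    exact Complex.ofReal_re _
  -- bound on eigenvalues
  have hsq := hpow (X ^ 2)
  simp only [eval_pow, eval_X] at hsq
  set R : ℝ := (∑ i, ((hM y₀).eigenvalues i) ^ 2) + 2 with hR
  have hR1 : 1 ≤ R := by
    have : 0 ≤ ∑ i, ((hM y₀).eigenvalues i) ^ 2 := Finset.sum_nonneg fun i _ => sq_nonneg _
    linarith
  have hbd : ∀ᶠ y in nhds y₀, ∀ i, |(hM y).eigenvalues i| ≤ R := by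
    have : ∀ᶠ y in nhds y₀, ∑ i, ((hM y).eigenvalues i) ^ 2 < R :=
      (hsq.tendsto y₀).eventually_lt_const (by linarith)
    filter_upwards [this] with y hy i
    have h3 : ((hM y).eigenvalues i) ^ 2 ≤ ∑ i, ((hM y).eigenvalues i) ^ 2 :=
      Finset.single_le_sum (f := fun i => ((hM y).eigenvalues i) ^ 2)
        (fun i _ => sq_nonneg _) (Finset.mem_univ i)
    refine abs_le_of_sq_le_sq (by nlinarith) (by linarith)
  -- gap
  have hdetc : Continuous fun y => ‖(M y).det‖ := (hc.matrix_det).norm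
  set c := ‖(M y₀).det‖ / 2 with hcdef
  have hcpos : 0 < c := by positivity
  have hgap : ∀ᶠ y in nhds y₀, ∀ i, c / R ^ (Fintype.card n) ≤ |(hM y).eigenvalues i| := by
    have : ∀ᶠ y in nhds y₀, c < ‖(M y).det‖ :=
      (hdetc.tendsto y₀).eventually_const_lt (by
        have : 0 < ‖(M y₀).det‖ := by positivity
        rw [hcdef]; linarith)
    filter_upwards [this, hbd] with y hy hb i
    rw [(hM y).det_eq_prod_eigenvalues, norm_prod, ← Finset.mul_prod_erase _ _ (Finset.mem_univ i)]
      at hy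
    have h4 : ∏ j ∈ Finset.univ.erase i, ‖((hM y).eigenvalues j : ℂ)‖ ≤ R ^ (Fintype.card n) := by
      calc _ ≤ ∏ j ∈ Finset.univ.erase i, R := by
            refine Finset.prod_le_prod (fun _ _ => norm_nonneg _) fun j _ => ?_
            simpa using hb j
        _ = R ^ (Finset.univ.erase i).card := by simp
        _ ≤ _ := pow_le_pow_right₀ hR1 (by
            simp)
    rw [div_le_iff₀ (by positivity)]
    have h5 : ‖((hM y).eigenvalues i : ℂ)‖ = |(hM y).eigenvalues i| := by simp
    refine hy.le.trans ?_
    change ‖((hM y).eigenvalues i : ℂ)‖ * _ ≤ _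
    rw [h5]
    exact mul_le_mul_of_nonneg_left h4 (abs_nonneg _)
  set δ := c / R ^ (Fintype.card n) with hδ
  have hδpos : 0 < δ := by positivity
  let g : ℝ → ℝ := fun x => max 0 (min 1 ((1 - x / δ) / 2))
  have hg : Continuous g := by fun_prop
  have hgneg : ∀ x, x ≤ -δ → g x = 1 := by
    intro x hx
    have : x / δ ≤ -1 := by rw [div_le_iff₀ hδpos]; linarith
    simp only [g]
    rw [min_eq_left (by linarith), max_eq_right (by norm_num)]
  have hgpos : ∀ x, δ ≤ x → g x = 0 := by
    intro x hx
    have : 1 ≤ x / δ := by rw [le_div_iff₀ hδpos]; linarith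
    simp only [g]
    exact max_eq_left ((min_le_right _ _).trans (by linarith))
  obtain ⟨p, hp⟩ := exists_polynomial_near_of_continuousOn (-R) R g hg.continuousOn
    (1 / (4 * (Fintype.card n + 1))) (by positivity)
  have hN : ∀ y, (∀ i, |(hM y).eigenvalues i| ≤ R) → (∀ i, δ ≤ |(hM y).eigenvalues i|) →
      |∑ i, p.eval ((hM y).eigenvalues i) - ncount (M y)| ≤ 1 / 4 := by
    intro y hb hgp
    have h6 : (ncount (M y) : ℝ) = ∑ i, g ((hM y).eigenvalues i) := by
      rw [ncount_herm (hM y), Finset.card_filter]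
      push_cast
      refine Finset.sum_congr rfl fun i _ => ?_
      split_ifs with h
      · have := hgp i
        rw [abs_of_neg h] at this
        rw [hgneg _ (by linarith)]
      · have := hgp i
        rw [abs_of_nonneg (not_lt.1 h)] at this
        rw [hgpos _ (by linarith)]
    rw [h6, ← Finset.sum_sub_distrib]
    refine (Finset.abs_sum_le_sum_abs _ _).trans ?_
    refine (Finset.sum_le_card_nsmul _ _ (1 / (4 * ((Fintype.card n : ℝ) + 1))) fun i _ =>
      (hp _ (abs_le.1 (hb i))).le).trans ?_
    rw [nsmul_eq_mul, Finset.card_univ]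
    rw [mul_one_div, div_le_div_iff₀ (by positivity) (by positivity)]
    nlinarith [(Nat.cast_nonneg (Fintype.card n) : (0:ℝ) ≤ Fintype.card n)]
  have hfin : ∀ᶠ y in nhds y₀, dist (∑ i, p.eval ((hM y).eigenvalues i))
      (∑ i, p.eval ((hM y₀).eigenvalues i)) < 1 / 4 :=
    Metric.tendsto_nhds.1 ((hpow p).tendsto y₀) _ (by norm_num)
  have h0 := hN y₀ hbd.self_of_nhds hgap.self_of_nhds
  filter_upwards [hfin, hbd, hgap] with y h7 h8 h9
  have h10 := hN y h8 h9
  rw [Real.dist_eq] at h7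
  rw [abs_le] at h0 h10
  rw [abs_lt] at h7
  have h11 : (ncount (M y) : ℝ) < ncount (M y₀) + 1 := by linarith
  have h12 : (ncount (M y₀) : ℝ) < ncount (M y) + 1 := by linarith
  norm_cast at h11 h12
  omega

lemma exists_separating {n : Type*} [Fintype n] [DecidableEq n] {A B : Matrix n n ℂ}
    (hA : A.IsHermitian) (hB : B.IsHermitian) (k : ℕ) (hk : (A ^ k).trace ≠ (B ^ k).trace) :
    ∃ z : ℝ, (∀ i, hA.eigenvalues i - z ≠ 0) ∧ (∀ i, hB.eigenvalues i - z ≠ 0) ∧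
      (Finset.univ.filter (fun i => hA.eigenvalues i - z < 0)).card ≠
      (Finset.univ.filter (fun i => hB.eigenvalues i - z < 0)).card := by
  have aux : ∀ (N : ℕ) (f g : Fin N → ℝ), Antitone f → Antitone g → ∀ j, f j < g j →
      ∃ z : ℝ, (∀ i, f i - z ≠ 0) ∧ (∀ i, g i - z ≠ 0) ∧
      (Finset.univ.filter (fun i => f i - z < 0)).card ≠
      (Finset.univ.filter (fun i => g i - z < 0)).card := by
    intro N f g hf hg j hj
    obtain ⟨z, hz, hz'⟩ := ((Set.Ioo_infinite hj).sdiff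
      ((Set.finite_range f).union (Set.finite_range g))).nonempty
    refine ⟨z, fun i hi => hz' (Or.inl ⟨i, by linarith⟩), fun i hi => hz' (Or.inr ⟨i, by linarith⟩),
      (Finset.card_lt_card ?_).ne'⟩
    rw [Finset.ssubset_iff_of_subset]
    · refine ⟨j, ?_, ?_⟩
      · simp only [Finset.mem_filter, Finset.mem_univ, true_and]; linarith [hz.1]
      · simp only [Finset.mem_filter, Finset.mem_univ, true_and]; linarith [hz.2]
    · intro i
      simp only [Finset.mem_filter, Finset.mem_univ, true_and]
      intro hi
      have : j ≤ i := by
        by_contra h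
        have := hg (not_le.1 h).le
        linarith [hz.2]
      linarith [hf this, hz.1]
  have main : ∃ z : ℝ, (∀ i, hA.eigenvalues₀ i - z ≠ 0) ∧ (∀ i, hB.eigenvalues₀ i - z ≠ 0) ∧
      (Finset.univ.filter (fun i => hA.eigenvalues₀ i - z < 0)).card ≠
      (Finset.univ.filter (fun i => hB.eigenvalues₀ i - z < 0)).card := by
    have : ∃ j, hA.eigenvalues₀ j ≠ hB.eigenvalues₀ j := by
      by_contra! h
      apply hk
      rw [trace_pow_herm hA, trace_pow_herm hB]
      refine Finset.sum_congr rfl fun i _ => ?_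
      simp only [Matrix.IsHermitian.eigenvalues, h]
    obtain ⟨j, hj⟩ := this
    rcases hj.lt_or_gt with h | h
    · exact aux _ _ _ hA.eigenvalues₀_antitone hB.eigenvalues₀_antitone j h
    · obtain ⟨z, h1, h2, h3⟩ := aux _ _ _ hB.eigenvalues₀_antitone hA.eigenvalues₀_antitone j h
      exact ⟨z, h2, h1, h3.symm⟩
  obtain ⟨z, h1, h2, h3⟩ := main
  refine ⟨z, fun i => h1 _, fun i => h2 _, ?_⟩
  have conv : ∀ {C : Matrix n n ℂ} (hC : C.IsHermitian),
      (Finset.univ.filter (fun i => hC.eigenvalues i - z < 0)).card =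
      (Finset.univ.filter (fun i => hC.eigenvalues₀ i - z < 0)).card := by
    intro C hC
    refine Finset.card_equiv (Fintype.equivOfCardEq (Fintype.card_fin _)).symm fun i => ?_
    simp [Matrix.IsHermitian.eigenvalues]
  rw [conv hA, conv hB]
  exact h3

/-- the rescaled matrix -/
noncomputable def resc {n : Type*} [DecidableEq n] (A : Matrix n n ℂ) (q : n → ℝ)
    (e z : ℝ) : Matrix n n ℂ :=
  Matrix.of fun x y => (((if q x = 0 then 1 else e) * (if q y = 0 then 1 else e) : ℝ) : ℂ) *
    (A x y - if x = y then (z : ℂ) else 0) + if x = y then (q x : ℂ) else 0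

lemma resc_herm {n : Type*} [DecidableEq n] {A : Matrix n n ℂ} (hA : A.IsHermitian) (q : n → ℝ)
    (e z : ℝ) : (resc A q e z).IsHermitian := by
  ext x y
  have := hA.apply x y
  by_cases h : x = y
  · subst h
    simp [resc, Matrix.conjTranspose_apply] at this ⊢
    exact Or.inl this
  · have h' : ¬ y = x := fun h' => h h'.symm
    simp [resc, Matrix.conjTranspose_apply, h, h'] at this ⊢
    rw [this]
    split_ifs <;> simp

lemma resc_det {n : Type*} [Fintype n] [DecidableEq n] (A : Matrix n n ℂ) (q : n → ℝ)
    (e z : ℝ) (he : 0 < e) (h : (resc A q e z).det = 0) :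
    (A + Matrix.diagonal (fun x => ((q x / e ^ 2 - z : ℝ) : ℂ))).det = 0 := by
  set D : Matrix n n ℂ := Matrix.diagonal fun x => (((if q x = 0 then 1 else e : ℝ)) : ℂ) with hD
  have h1 : resc A q e z =
      D * (A + Matrix.diagonal (fun x => ((q x / e ^ 2 - z : ℝ) : ℂ))) * D := by
    ext x y
    have he' : (e : ℂ) ≠ 0 := by exact_mod_cast he.ne'
    rw [hD, Matrix.mul_diagonal, Matrix.diagonal_mul]
    by_cases hxy : x = y
    · subst hxy
      by_cases hq : q x = 0
      · simp [resc, hq]; ring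
      · simp [resc, hq]; field_simp; ring
    · simp [resc, hxy]; split_ifs <;> simp <;> ring
  rw [h1, Matrix.det_mul, Matrix.det_mul] at h
  have hD0 : D.det ≠ 0 := by
    rw [hD, Matrix.det_diagonal]
    refine Finset.prod_ne_zero_iff.2 fun x _ => ?_
    rw [Complex.ofReal_ne_zero]
    split_ifs
    · norm_num
    · exact he.ne'
  simpa [hD0] using h

lemma resc_zero_charpoly {n : Type*} [Fintype n] [DecidableEq n] (A : Matrix n n ℂ) (q : n → ℝ)
    (z : ℝ) :
    (resc A q 0 z).charpoly =
      ((A.submatrix (Subtype.val : {x // q x = 0} → n) Subtype.val) -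
        Matrix.scalar _ (z : ℂ)).charpoly *
      ∏ x : {x // ¬ q x = 0}, (X - C (q x : ℂ)) := by
  rw [Matrix.charpoly, Matrix.twoBlockTriangular_det _ (fun x => q x = 0)]
  · congr 1
    · rw [Matrix.charpoly]
      congr 1
      ext x y : 2
      have hx := x.2
      have hy := y.2
      by_cases hxy : x = y
      · subst hxy
        simp [Matrix.toSquareBlockProp, resc, hx]
      · have : ¬ (x : n) = y := fun h => hxy (Subtype.ext h)
        simp [Matrix.toSquareBlockProp, resc, hx, hy, hxy, this]
    · rw [← Matrix.det_diagonal]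
      congr 1
      ext x y : 2
      have hx := x.2
      have hy := y.2
      by_cases hxy : x = y
      · subst hxy
        simp [Matrix.toSquareBlockProp, resc, hx]
      · have : ¬ (x : n) = y := fun h => hxy (Subtype.ext h)
        simp [Matrix.toSquareBlockProp, resc, hx, hxy, this]
  · intro x hx y hy
    have : ¬ x = y := fun h => hx (h ▸ hy)
    simp [resc, hx, this]

lemma resc_zero_ncount {n : Type*} [Fintype n] [DecidableEq n] {A : Matrix n n ℂ} (q : n → ℝ)
    (z : ℝ) (hA : (A.submatrix (Subtype.val : {x // q x = 0} → n) Subtype.val).IsHermitian)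
    (hz : ∀ i, hA.eigenvalues i - z ≠ 0) :
    (resc A q 0 z).det ≠ 0 ∧
    ncount (resc A q 0 z) = (Finset.univ.filter (fun i => hA.eigenvalues i - z < 0)).card +
      (Finset.univ.filter (fun x : {x // ¬ q x = 0} => q x < 0)).card := by
  have h := resc_zero_charpoly A q z
  rw [ncount_sub_scalar hA] at h
  let c : {x // q x = 0} ⊕ {x // ¬ q x = 0} → ℝ :=
    Sum.elim (fun i => hA.eigenvalues i - z) (fun x => q x)
  have h2 : (resc A q 0 z).charpoly = ∏ i, (X - C (c i : ℂ)) := by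
    rw [Fintype.prod_sum_type, h]
    rfl
  constructor
  · rw [Matrix.det_eq_sign_charpoly_coeff, h2, coeff_zero_eq_eval_zero, eval_prod]
    refine mul_ne_zero (by simp) (Finset.prod_ne_zero_iff.2 fun x _ => ?_)
    have : c x ≠ 0 := by
      rcases x with x | x
      · exact hz x
      · exact x.2
    simpa using this
  · rw [ncount_of_prod _ c h2, Finset.card_filter, Fintype.sum_sum_type, Finset.card_filter,
      Finset.card_filter]
    rfl

lemma resc_cont {n : Type*} [Fintype n] [DecidableEq n] (A : ℝ → Matrix n n ℂ)
    (hc : Continuous A) (q : n → ℝ) :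
    Continuous fun t : ℝ × ℝ × ℝ => resc (A t.1) q t.2.1 t.2.2 := by
  refine continuous_matrix fun x y => ?_
  have hA1 : Continuous fun t : ℝ × ℝ × ℝ => A t.1 x y :=
    (hc.comp continuous_fst).matrix_elem x y
  have h2 : Continuous fun t : ℝ × ℝ × ℝ => ((t.2.1 : ℝ) : ℂ) := by fun_prop
  have h3 : Continuous fun t : ℝ × ℝ × ℝ => ((t.2.2 : ℝ) : ℂ) := by fun_prop
  have h4 : ∀ w, Continuous fun t : ℝ × ℝ × ℝ => (((if q w = 0 then 1 else t.2.1 : ℝ)) : ℂ) := by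
    intro w
    split_ifs
    · exact continuous_const
    · exact h2
  have h5 : Continuous fun t : ℝ × ℝ × ℝ => (if x = y then (t.2.2 : ℂ) else 0) := by
    split_ifs
    · exact h3
    · exact continuous_const
  simp only [resc, Matrix.of_apply, Complex.ofReal_mul]
  exact (((h4 x).mul (h4 y)).mul (hA1.sub h5)).add continuous_const

theorem exists_interval {n : Type*} [Fintype n] [DecidableEq n] (A : ℝ → Matrix n n ℂ)
    (hc : Continuous A) (hA : ∀ s, (A s).IsHermitian) (q : n → ℝ) (s₁ : ℝ) (k : ℕ)
    (hk : (((A 0).submatrix (Subtype.val : {x // q x = 0} → n) Subtype.val) ^ k).trace ≠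
      (((A s₁).submatrix (Subtype.val : {x // q x = 0} → n) Subtype.val) ^ k).trace) :
    ∃ z₀ : ℝ, ∃ η > 0, ∀ e : ℝ, 0 < e → e < η → ∀ z, |z - z₀| < η →
      ∃ s, (A s + Matrix.diagonal (fun x => ((q x / e ^ 2 - z : ℝ) : ℂ))).det = 0 := by
  have hs : ∀ s, ((A s).submatrix (Subtype.val : {x // q x = 0} → n) Subtype.val).IsHermitian :=
    fun s => (hA s).submatrix _
  obtain ⟨z₀, h1, h2, h3⟩ := exists_separating (hs 0) (hs s₁) k hk
  have hcont := resc_cont A hc q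
  obtain ⟨d0, n0⟩ := resc_zero_ncount q z₀ (hs 0) h1
  obtain ⟨d1, n1⟩ := resc_zero_ncount q z₀ (hs s₁) h2
  have e0 := ncount_eventually (fun y : ℝ × ℝ => resc (A 0) q y.1 y.2)
    (hcont.comp (Continuous.prodMk continuous_const continuous_id)) (fun y => resc_herm (hA 0) _ _ _) (0, z₀) d0
  have e1 := ncount_eventually (fun y : ℝ × ℝ => resc (A s₁) q y.1 y.2)
    (hcont.comp (Continuous.prodMk continuous_const continuous_id)) (fun y => resc_herm (hA s₁) _ _ _) (0, z₀) d1
  obtain ⟨η, hη, hball⟩ := Metric.eventually_nhds_iff.1 (e0.and e1)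
  refine ⟨z₀, η, hη, fun e he he' z hz => ?_⟩
  obtain ⟨h4, h5⟩ := @hball (e, z) (by
    rw [Prod.dist_eq, max_lt_iff]
    refine ⟨?_, ?_⟩
    · simpa [Real.dist_eq, abs_of_pos he] using he'
    · simpa [Real.dist_eq] using hz)
  by_contra! hcon
  have hdet : ∀ s, (resc (A s) q e z).det ≠ 0 := fun s hs => hcon s (resc_det _ _ _ _ he hs)
  have hloc : IsLocallyConstant fun s => ncount (resc (A s) q e z) := by
    rw [IsLocallyConstant.iff_eventually_eq]
    intro s
    refine ncount_eventually (fun s => resc (A s) q e z) ?_ (fun s => resc_herm (hA s) _ _ _) s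
      (hdet s)
    exact hcont.comp (Continuous.prodMk continuous_id (continuous_const (y := (e, z))))
  have h6 := hloc.apply_eq_of_preconnectedSpace 0 s₁
  simp only at h4 h5 h6
  omega

end FlatPath

namespace FlatPath

/-- the ℓ¹ norm on `ℤ^d` -/
noncomputable def l1 {d : ℕ} (n : Fin d → ℤ) : ℝ := ∑ j, |(n j : ℝ)|

lemma l1_add {d : ℕ} (n m : Fin d → ℤ) : l1 (n + m) ≤ l1 n + l1 m := by
  unfold l1
  rw [← Finset.sum_add_distrib]
  refine Finset.sum_le_sum fun j _ => ?_
  simpa using abs_add_le (n j : ℝ) (m j : ℝ)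

lemma l1_neg {d : ℕ} (n : Fin d → ℤ) : l1 (-n) = l1 n := by simp [l1]

lemma l1_nonneg {d : ℕ} (n : Fin d → ℤ) : 0 ≤ l1 n := Finset.sum_nonneg fun _ _ => abs_nonneg _

lemma summable_exp_int (e : ℝ) (he : 0 < e) : Summable fun n : ℤ => Real.exp (-e * |(n : ℝ)|) := by
  have h : Summable fun n : ℕ => Real.exp (-e * n) := by
    have := Real.summable_exp_nat_mul_iff (a := -e)
    have := this.2 (by linarith)
    refine this.congr fun n => ?_
    rw [mul_comm]
  refine Summable.of_nat_of_neg ?_ ?_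
  · simpa using h
  · simpa using h

lemma summable_exp_l1 (d : ℕ) (e : ℝ) (he : 0 < e) :
    Summable fun n : Fin d → ℤ => Real.exp (-e * l1 n) := by
  induction d with
  | zero => exact (hasSum_fintype _).summable
  | succ d ih =>
    rw [← (Fin.consEquiv (fun _ : Fin (d + 1) => ℤ)).summable_iff]
    have := (summable_exp_int e he).mul_of_nonneg ih (fun _ => (Real.exp_pos _).le)
      (fun _ => (Real.exp_pos _).le)
    refine this.congr fun p => ?_
    simp only [Function.comp, l1, ← Real.exp_add]
    congr 1
    rw [Fin.sum_univ_succ]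
    simp [Fin.consEquiv]
    ring

lemma hasSum_prod {V Ω : Type*} [Fintype Ω] {d : ℕ} (E : V ≃ Ω × (Fin d → ℤ))
    (f : Ω → ℝ) (g : (Fin d → ℤ) → ℝ) (hg : Summable g) (hg0 : ∀ n, 0 ≤ g n) (hf0 : ∀ x, 0 ≤ f x) :
    HasSum (fun v => f (E v).1 * g (E v).2) ((∑ x, f x) * ∑' n, g n) := by
  have h1 : HasSum (fun p : Ω × (Fin d → ℤ) => f p.1 * g p.2) ((∑ x, f x) * ∑' n, g n) := by
    have hf : Summable f := (hasSum_fintype f).summable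
    have := (hasSum_fintype f).mul hg.hasSum (hf.mul_of_nonneg hg hf0 hg0)
    exact this
  exact E.hasSum_iff.2 h1

theorem mem_spectrum_of_floquet {V Ω : Type} [Fintype Ω] {d : ℕ} (E : V ≃ Ω × (Fin d → ℤ))
    (N : Ω → Finset (Ω × (Fin d → ℤ)))
    (T : lp (fun _ : V => ℂ) 2 →L[ℂ] lp (fun _ : V => ℂ) 2) (w : Ω → ℂ)
    (hT : ∀ ψ v, T ψ v = w (E v).1 * ψ v + ∑ t ∈ N (E v).1, ψ (E.symm (t.1, t.2 + (E v).2)))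
    (χ : (Fin d → ℤ) → ℂ) (hχ : ∀ n m, χ (n + m) = χ n * χ m) (hχ1 : ∀ n, ‖χ n‖ = 1)
    (φ : Ω → ℂ) (hφ : φ ≠ 0) (l : ℂ)
    (heig : ∀ x, w x * φ x + ∑ t ∈ N x, χ t.2 * φ t.1 = l * φ x) :
    l ∈ spectrum ℂ T := by
  by_contra hl
  rw [spectrum.mem_iff, not_not] at hl
  obtain ⟨U, hU⟩ := hl
  set K : ℝ := ‖(↑U⁻¹ : lp (fun _ : V => ℂ) 2 →L[ℂ] lp (fun _ : V => ℂ) 2)‖ with hK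
  have hbound : ∀ ψ, ‖ψ‖ ≤ K * ‖l • ψ - T ψ‖ := by
    intro ψ
    have h1 : (↑U⁻¹ : lp (fun _ : V => ℂ) 2 →L[ℂ] lp (fun _ : V => ℂ) 2) (l • ψ - T ψ) = ψ := by
      have h2 : l • ψ - T ψ = (U : lp (fun _ : V => ℂ) 2 →L[ℂ] lp (fun _ : V => ℂ) 2) ψ := by
        rw [hU]; simp [Algebra.algebraMap_eq_smul_one]
      rw [h2, ← mul_apply_eq_comp, Units.inv_mul]
      rfl
    calc ‖ψ‖ = _ := by rw [h1]
      _ ≤ _ := ContinuousLinearMap.le_opNorm _ _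
  set B : ℝ := ∑ x, ∑ t ∈ N x, ‖φ t.1‖ with hB
  set r : ℝ := ∑ x, ∑ t ∈ N x, l1 t.2 with hr
  have hB0 : 0 ≤ B := Finset.sum_nonneg fun _ _ => Finset.sum_nonneg fun _ _ => norm_nonneg _
  have hr0 : 0 ≤ r := Finset.sum_nonneg fun _ _ => Finset.sum_nonneg fun _ _ => l1_nonneg _
  have hBx : ∀ x, ∑ t ∈ N x, ‖φ t.1‖ ≤ B := fun x =>
    Finset.single_le_sum (f := fun x => ∑ t ∈ N x, ‖φ t.1‖)
      (fun _ _ => Finset.sum_nonneg fun _ _ => norm_nonneg _) (Finset.mem_univ x)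
  have hrx : ∀ x, ∀ t ∈ N x, l1 t.2 ≤ r := fun x t ht =>
    (Finset.single_le_sum (f := fun t : Ω × (Fin d → ℤ) => l1 t.2)
      (fun _ _ => l1_nonneg _) ht).trans
    (Finset.single_le_sum (f := fun x => ∑ t ∈ N x, l1 t.2)
      (fun _ _ => Finset.sum_nonneg fun _ _ => l1_nonneg _) (Finset.mem_univ x))
  have hmain : ∀ e : ℝ, 0 < e → ∑ x, ‖φ x‖ ^ 2 ≤
      K ^ 2 * ((B * (Real.exp (e * r) - 1)) ^ 2 * Fintype.card Ω) := by
    intro e he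
    let W : (Fin d → ℤ) → ℝ := fun n => Real.exp (-e * l1 n)
    have hWpos : ∀ n, 0 < W n := fun n => Real.exp_pos _
    have hWsum : Summable fun n => W n ^ 2 := by
      refine (summable_exp_l1 d (2 * e) (by linarith)).congr fun n => ?_
      simp only [W, ← Real.exp_nat_mul]
      congr 1; push_cast; ring
    set S := ∑' n, W n ^ 2 with hS
    have hSpos : 0 < S := hWsum.tsum_pos (fun n => sq_nonneg _) 0 (by have := hWpos 0; positivity)
    have hψsum := hasSum_prod E (fun x => ‖φ x‖ ^ 2) _ hWsum (fun n => sq_nonneg _)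
      (fun x => sq_nonneg _)
    have hgsum := hasSum_prod E (fun x => (B * (Real.exp (e * r) - 1)) ^ 2) _ hWsum
      (fun n => sq_nonneg _) (fun x => sq_nonneg _)
    let f : V → ℂ := fun v => W (E v).2 * χ (E v).2 * φ (E v).1
    have hfn : ∀ v, ‖f v‖ ^ 2 = ‖φ (E v).1‖ ^ 2 * W (E v).2 ^ 2 := by
      intro v
      simp only [f, norm_mul, hχ1, Complex.norm_real, Real.norm_eq_abs, abs_of_pos (hWpos _)]
      ring
    have hf : Memℓp f 2 := by
      refine memℓp_gen ?_
      simp only [ENNReal.toReal_ofNat, Real.rpow_ofNat, hfn]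
      exact hψsum.summable
    let ψ : lp (fun _ : V => ℂ) 2 := ⟨f, hf⟩
    have hψv : ∀ v, ψ v = f v := fun v => rfl
    have hnorm : ∀ ξ : lp (fun _ : V => ℂ) 2, ‖ξ‖ ^ 2 = ∑' v, ‖ξ v‖ ^ 2 := by
      intro ξ
      have := lp.norm_rpow_eq_tsum (p := 2) (by norm_num) ξ
      simpa using this
    have hsum2 : ∀ ξ : lp (fun _ : V => ℂ) 2, Summable fun v => ‖ξ v‖ ^ 2 := by
      intro ξ
      have := (lp.memℓp ξ).summable (by norm_num)
      simpa using this
    have h1 : ‖ψ‖ ^ 2 = (∑ x, ‖φ x‖ ^ 2) * S := by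
      rw [hnorm]
      simp only [hψv, hfn]
      exact hψsum.tsum_eq
    have hpt : ∀ v, ‖(l • ψ - T ψ) v‖ ≤ (B * (Real.exp (e * r) - 1)) * W (E v).2 := by
      intro v
      have h3 : (l • ψ - T ψ) v = -∑ t ∈ N (E v).1,
          ((W (t.2 + (E v).2) - W (E v).2 : ℝ) : ℂ) * χ (E v).2 * (χ t.2 * φ t.1) := by
        have h4 : (l • ψ - T ψ) v = l * ψ v - T ψ v := rfl
        rw [h4, hT]
        simp only [hψv, f, Equiv.apply_symm_apply, hχ]
        have h5 : l * (W (E v).2 * χ (E v).2 * φ (E v).1) =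
          W (E v).2 * χ (E v).2 * (l * φ (E v).1) := by ring
        rw [h5, ← heig, mul_add, Finset.mul_sum, ← Finset.sum_neg_distrib]
        have h6 : ∀ a b c c' D : ℂ, c' = c → D = a - b → c + a - (c' + b) = D := by
          intro a b c c' D h h'; rw [h, h']; ring
        refine h6 _ _ _ _ _ (by ring) ?_
        rw [← Finset.sum_sub_distrib]
        refine Finset.sum_congr rfl fun t _ => ?_
        push_cast
        ring
      rw [h3, norm_neg]
      refine (norm_sum_le _ _).trans ?_
      have h7 : ∀ t ∈ N (E v).1,
          ‖((W (t.2 + (E v).2) - W (E v).2 : ℝ) : ℂ) * χ (E v).2 * (χ t.2 * φ t.1)‖ ≤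
          ((Real.exp (e * r) - 1) * W (E v).2) * ‖φ t.1‖ := by
        intro t ht
        simp only [norm_mul, hχ1, Complex.norm_real, Real.norm_eq_abs, mul_one, one_mul]
        refine mul_le_mul_of_nonneg_right ?_ (norm_nonneg _)
        have ht1 := hrx _ t ht
        have h8 : W (t.2 + (E v).2) ≤ Real.exp (e * r) * W (E v).2 := by
          simp only [W, ← Real.exp_add]
          refine Real.exp_le_exp.2 ?_
          have := l1_add (-t.2) (t.2 + (E v).2)
          rw [l1_neg, neg_add_cancel_left] at this
          nlinarith
        have h9 : Real.exp (-(e * r)) * W (E v).2 ≤ W (t.2 + (E v).2) := by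
          simp only [W, ← Real.exp_add]
          refine Real.exp_le_exp.2 ?_
          have := l1_add t.2 (E v).2
          nlinarith
        have h10 : 1 - Real.exp (-(e * r)) ≤ Real.exp (e * r) - 1 := by
          have := Real.add_one_le_exp (e * r)
          have := Real.add_one_le_exp (-(e * r))
          linarith
        have h11 := mul_le_mul_of_nonneg_right h10 (hWpos (E v).2).le
        rw [abs_le]
        constructor <;> linarith
      refine (Finset.sum_le_sum h7).trans ?_
      rw [← Finset.mul_sum]
      have h12 : 0 ≤ Real.exp (e * r) - 1 := by
        have := Real.one_le_exp (mul_nonneg he.le hr0)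
        linarith
      calc _ ≤ ((Real.exp (e * r) - 1) * W (E v).2) * B :=
            mul_le_mul_of_nonneg_left (hBx _) (mul_nonneg h12 (hWpos _).le)
        _ = _ := by ring
    have h2 : ‖l • ψ - T ψ‖ ^ 2 ≤ ((B * (Real.exp (e * r) - 1)) ^ 2 * Fintype.card Ω) * S := by
      rw [hnorm]
      refine ((hsum2 _).tsum_le_tsum (fun v => ?_) hgsum.summable).trans (le_of_eq ?_)
      · have := pow_le_pow_left₀ (norm_nonneg _) (hpt v) 2
        rwa [mul_pow] at this
      · rw [hgsum.tsum_eq, Finset.sum_const, Finset.card_univ, nsmul_eq_mul,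
          mul_comm (Fintype.card Ω : ℝ)]
    have h13 := pow_le_pow_left₀ (norm_nonneg _) (hbound ψ) 2
    rw [h1, mul_pow] at h13
    have h14 := h13.trans (mul_le_mul_of_nonneg_left h2 (sq_nonneg K))
    rw [← mul_assoc] at h14
    exact le_of_mul_le_mul_right h14 hSpos
  have hlim : Tendsto (fun e : ℝ => K ^ 2 * ((B * (Real.exp (e * r) - 1)) ^ 2 * Fintype.card Ω))
      (nhdsWithin 0 (Set.Ioi 0)) (nhds 0) := by
    have hc : Continuous fun e : ℝ =>
      K ^ 2 * ((B * (Real.exp (e * r) - 1)) ^ 2 * Fintype.card Ω) := by fun_prop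
    have := hc.tendsto 0
    simp only [zero_mul, Real.exp_zero, sub_self, mul_zero, ne_eq, OfNat.ofNat_ne_zero,
      not_false_eq_true, zero_pow] at this
    exact this.mono_left nhdsWithin_le_nhds
  have hle : ∑ x, ‖φ x‖ ^ 2 ≤ 0 := by
    refine ge_of_tendsto hlim ?_
    filter_upwards [self_mem_nhdsWithin] with e he using hmain e he
  apply hφ
  funext x
  have h15 := (Finset.sum_eq_zero_iff_of_nonneg (fun x _ => sq_nonneg ‖φ x‖)).1
    (le_antisymm hle (Finset.sum_nonneg fun _ _ => sq_nonneg _)) x (Finset.mem_univ x)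
  simpa using h15

end FlatPath

namespace FlatPath

lemma exists_equiv {d : ℕ} {V : Type} [AddAction (Fin d → ℤ) V]
    (hfree : ∀ (n : Fin d → ℤ) (v : V), n +ᵥ v = v → n = 0)
    (hvorb : ∃ F : Finset V, ∀ v : V, ∃ u ∈ F, ∃ n : Fin d → ℤ, v = n +ᵥ u) :
    ∃ (Ω : Type) (_ : Finite Ω) (E : V ≃ Ω × (Fin d → ℤ)),
      ∀ n v, E (n +ᵥ v) = ((E v).1, n + (E v).2) := by
  let Ω := Quotient (AddAction.orbitRel (Fin d → ℤ) V)
  have hfin : Finite Ω := by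
    obtain ⟨F, hF⟩ := hvorb
    refine Finite.of_surjective (fun u : F => (Quotient.mk _ (u : V) : Ω)) ?_
    intro x
    induction x using Quotient.inductionOn with
    | h v =>
      obtain ⟨u, hu, n, hn⟩ := hF v
      refine ⟨⟨u, hu⟩, Quotient.sound ?_⟩
      change AddAction.orbitRel _ _ u v
      rw [AddAction.orbitRel_apply]
      exact ⟨-n, by rw [hn]; simp⟩
  let f : Ω × (Fin d → ℤ) → V := fun p => p.2 +ᵥ p.1.out
  have hmk : ∀ (n : Fin d → ℤ) (v : V), (Quotient.mk _ (n +ᵥ v) : Ω) = Quotient.mk _ v := by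
    intro n v
    refine Quotient.sound ?_
    change AddAction.orbitRel _ _ _ v
    rw [AddAction.orbitRel_apply]
    exact ⟨n, rfl⟩
  have hf : Function.Bijective f := by
    constructor
    · rintro ⟨x, n⟩ ⟨y, m⟩ h
      simp only [f] at h
      have hxy : x = y := by
        have := congrArg (fun v => (Quotient.mk _ v : Ω)) h
        simp only [hmk, Quotient.out_eq] at this
        exact this
      subst hxy
      have h2 : (-m + n) +ᵥ x.out = x.out := by
        rw [add_vadd, h, neg_vadd_vadd]
      have := hfree _ _ h2
      rw [neg_add_eq_zero] at this
      rw [this]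
    · intro v
      have : AddAction.orbitRel (Fin d → ℤ) V v (Quotient.mk _ v : Ω).out :=
        Setoid.symm' _ (Quotient.mk_out (s := AddAction.orbitRel (Fin d → ℤ) V) v)
      rw [AddAction.orbitRel_apply] at this
      obtain ⟨n, hn⟩ := this
      exact ⟨(Quotient.mk _ v, n), hn⟩
  let E := Equiv.ofBijective f hf
  refine ⟨Ω, hfin, E.symm, fun n v => ?_⟩
  rw [Equiv.symm_apply_eq]
  have h1 : f (E.symm v) = v := E.apply_symm_apply v
  change _ = (n + (E.symm v).2) +ᵥ (E.symm v).1.out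
  rw [add_vadd]
  exact congrArg _ h1.symm

/-- characters -/
noncomputable def ch {d : ℕ} (m : Fin d → ℤ) (s : ℝ) (n : Fin d → ℤ) : ℂ :=
  Complex.exp (((s * ∑ j, (m j : ℝ) * (n j : ℝ) : ℝ) : ℂ) * Complex.I)

lemma ch_add {d : ℕ} (m : Fin d → ℤ) (s : ℝ) (n n' : Fin d → ℤ) :
    ch m s (n + n') = ch m s n * ch m s n' := by
  unfold ch
  rw [← Complex.exp_add]
  congr 1
  rw [← add_mul, ← Complex.ofReal_add, ← mul_add, ← Finset.sum_add_distrib]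
  simp [mul_add]

lemma ch_norm {d : ℕ} (m : Fin d → ℤ) (s : ℝ) (n : Fin d → ℤ) : ‖ch m s n‖ = 1 :=
  Complex.norm_exp_ofReal_mul_I _

lemma ch_conj {d : ℕ} (m : Fin d → ℤ) (s : ℝ) (n : Fin d → ℤ) :
    star (ch m s n) = ch m s (-n) := by
  unfold ch
  rw [Complex.star_def, ← Complex.exp_conj]
  congr 1
  simp

lemma ch_zero {d : ℕ} (m : Fin d → ℤ) (s : ℝ) : ch m s 0 = 1 := by simp [ch]

lemma ch_zero' {d : ℕ} (m : Fin d → ℤ) (n : Fin d → ℤ) : ch m 0 n = 1 := by simp [ch]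

lemma ch_pi {d : ℕ} (m : Fin d → ℤ) (hm : m ≠ 0) : ∃ s, ch m s m = -1 := by
  refine ⟨Real.pi / ∑ j, (m j : ℝ) * (m j : ℝ), ?_⟩
  have : ∑ j, (m j : ℝ) * (m j : ℝ) ≠ 0 := by
    intro h
    rw [Finset.sum_eq_zero_iff_of_nonneg (fun j _ => mul_self_nonneg _)] at h
    apply hm
    funext j
    simpa using h j (Finset.mem_univ j)
  unfold ch
  rw [div_mul_cancel₀ _ this, Complex.exp_pi_mul_I]

/-- Floquet matrix -/
noncomputable def fl {Ω : Type} [DecidableEq Ω] {d : ℕ} (N : Ω → Finset (Ω × (Fin d → ℤ)))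
    (m : Fin d → ℤ) (s : ℝ) : Matrix Ω Ω ℂ :=
  Matrix.of fun x y => ∑ t ∈ N x, if t.1 = y then ch m s t.2 else 0

/-- Floquet matrix at zero, over the reals -/
noncomputable def fl0 {Ω : Type} [DecidableEq Ω] {d : ℕ} (N : Ω → Finset (Ω × (Fin d → ℤ))) :
    Matrix Ω Ω ℝ :=
  Matrix.of fun x y => ∑ t ∈ N x, if t.1 = y then 1 else 0

lemma fl_cont {Ω : Type} [DecidableEq Ω] {d : ℕ} (N : Ω → Finset (Ω × (Fin d → ℤ)))
    (m : Fin d → ℤ) : Continuous (fl N m) := by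
  refine continuous_matrix fun x y => ?_
  simp only [fl, Matrix.of_apply]
  refine continuous_finsetSum _ fun t _ => ?_
  split_ifs
  · unfold ch; fun_prop
  · exact continuous_const

lemma fl_herm {Ω : Type} [DecidableEq Ω] {d : ℕ} (N : Ω → Finset (Ω × (Fin d → ℤ)))
    (hN : ∀ x y n, (y, n) ∈ N x → (x, -n) ∈ N y) (m : Fin d → ℤ) (s : ℝ) :
    (fl N m s).IsHermitian := by
  ext x y
  rw [Matrix.conjTranspose_apply]
  simp only [fl, Matrix.of_apply]
  rw [star_sum, ← Finset.sum_filter_add_sum_filter_not (N x) (fun t => t.1 = y),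
    ← Finset.sum_filter_add_sum_filter_not (N y) (fun t => t.1 = x)]
  congr 1
  · refine Finset.sum_bij' (fun t _ => (y, -t.2)) (fun t _ => (x, -t.2)) ?_ ?_ ?_ ?_ ?_
    · rintro ⟨a, n⟩ h
      simp only [Finset.mem_filter] at h ⊢
      obtain ⟨h, rfl⟩ := h
      exact ⟨hN _ _ _ h, trivial⟩
    · rintro ⟨a, n⟩ h
      simp only [Finset.mem_filter] at h ⊢
      obtain ⟨h, rfl⟩ := h
      exact ⟨hN _ _ _ h, trivial⟩
    · rintro ⟨a, n⟩ h
      simp only [Finset.mem_filter] at h ⊢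
      simp [h.2]
    · rintro ⟨a, n⟩ h
      simp only [Finset.mem_filter] at h ⊢
      simp [h.2]
    · rintro ⟨a, n⟩ h
      simp only [Finset.mem_filter] at h ⊢
      rw [if_pos h.2, if_pos trivial, ch_conj]
  · rw [Finset.sum_eq_zero, Finset.sum_eq_zero]
    · intro t ht
      rw [if_neg (Finset.mem_filter.1 ht).2]
    · intro t ht
      rw [if_neg (Finset.mem_filter.1 ht).2, star_zero]

lemma fl_zero {Ω : Type} [DecidableEq Ω] {d : ℕ} (N : Ω → Finset (Ω × (Fin d → ℤ)))
    (m : Fin d → ℤ) : fl N m 0 = (fl0 N).map Complex.ofReal := by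
  ext x y
  simp [fl, fl0, ch_zero']

lemma fl_dom {Ω : Type} [DecidableEq Ω] {d : ℕ} (N : Ω → Finset (Ω × (Fin d → ℤ)))
    (m : Fin d → ℤ) (s : ℝ) (x y : Ω) : ‖fl N m s x y‖ ≤ fl0 N x y := by
  simp only [fl, fl0, Matrix.of_apply]
  refine (norm_sum_le _ _).trans (Finset.sum_le_sum fun t _ => ?_)
  split_ifs
  · rw [ch_norm]
  · simp

lemma fl_step {Ω : Type} [DecidableEq Ω] {d : ℕ} (N : Ω → Finset (Ω × (Fin d → ℤ)))
    (m : Fin d → ℤ) (s : ℝ) (x y : Ω) (n : Fin d → ℤ) (h : (y, n) ∈ N x) :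
    ‖fl N m s x y - ch m s n‖ ≤ fl0 N x y - 1 := by
  classical
  simp only [fl, fl0, Matrix.of_apply]
  rw [← Finset.add_sum_erase _ _ h, ← Finset.add_sum_erase _ _ h]
  simp only [if_true, add_sub_cancel_left]
  refine (norm_sum_le _ _).trans (Finset.sum_le_sum fun t _ => ?_)
  split_ifs
  · rw [ch_norm]
  · simp

lemma dom_pow {n : Type*} [Fintype n] [DecidableEq n] (M : Matrix n n ℂ) (B : Matrix n n ℝ)
    (h : ∀ x y, ‖M x y‖ ≤ B x y) (k : ℕ) : ∀ x y, ‖(M ^ k) x y‖ ≤ (B ^ k) x y := by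
  induction k with
  | zero =>
    intro x y
    simp only [pow_zero, Matrix.one_apply]
    split_ifs <;> simp
  | succ k ih =>
    intro x y
    rw [pow_succ', pow_succ', Matrix.mul_apply, Matrix.mul_apply]
    refine (norm_sum_le _ _).trans (Finset.sum_le_sum fun z _ => ?_)
    rw [norm_mul]
    exact mul_le_mul (h _ _) (ih _ _) (norm_nonneg _) ((norm_nonneg _).trans (h _ _))

lemma step_mul {n : Type*} [Fintype n] [DecidableEq n] (M M' : Matrix n n ℂ) (B B' : Matrix n n ℝ)
    (h : ∀ x y, ‖M x y‖ ≤ B x y) (h' : ∀ x y, ‖M' x y‖ ≤ B' x y) (x y z : n) (α β : ℂ)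
    (hα : ‖α‖ = 1) (hβ : ‖β‖ = 1) (h1 : ‖M x y - α‖ ≤ B x y - 1)
    (h2 : ‖M' y z - β‖ ≤ B' y z - 1) : ‖(M * M') x z - α * β‖ ≤ (B * B') x z - 1 := by
  rw [Matrix.mul_apply, Matrix.mul_apply, ← Finset.add_sum_erase _ _ (Finset.mem_univ y),
    ← Finset.add_sum_erase _ _ (Finset.mem_univ y)]
  have h3 : ‖∑ w ∈ Finset.univ.erase y, M x w * M' w z‖ ≤
      ∑ w ∈ Finset.univ.erase y, B x w * B' w z := by
    refine (norm_sum_le _ _).trans (Finset.sum_le_sum fun z _ => ?_)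
    rw [norm_mul]
    exact mul_le_mul (h _ _) (h' _ _) (norm_nonneg _) ((norm_nonneg _).trans (h _ _))
  have h4 : ‖M x y * M' y z - α * β‖ ≤ B x y * B' y z - 1 := by
    have e1 : M x y * M' y z - α * β =
        (M x y - α) * β + (α * (M' y z - β) + (M x y - α) * (M' y z - β)) := by ring
    rw [e1]
    refine (norm_add_le _ _).trans ?_
    refine (add_le_add_right (norm_add_le _ _) _).trans ?_
    rw [norm_mul, norm_mul, norm_mul, hα, hβ]
    have := mul_le_mul h1 h2 (norm_nonneg _) ((norm_nonneg _).trans h1)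
    nlinarith
  have e2 : ∀ a b c : ℂ, a + b - c = (a - c) + b := by intros; ring
  rw [e2]
  refine (norm_add_le _ _).trans ?_
  linarith

lemma trace_ne {n : Type*} [Fintype n] [DecidableEq n] (M M0 : Matrix n n ℂ) (B : Matrix n n ℝ)
    (hM0 : M0 = B.map Complex.ofReal)
    (h : ∀ x y, ‖M x y‖ ≤ B x y) (k : ℕ) (x : n) (hx : ‖(M ^ k) x x - (-1)‖ ≤ (B ^ k) x x - 1) :
    (M0 ^ k).trace ≠ (M ^ k).trace := by
  intro heq
  have h0 : (M0 ^ k).trace = (((B ^ k).trace : ℝ) : ℂ) := by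
    have : M0 ^ k = (B ^ k).map Complex.ofRealHom := by
      rw [Matrix.map_pow, hM0]; rfl
    rw [this]
    simp [Matrix.trace]
  have h1 : ‖(M ^ k).trace - (-1)‖ ≤ (B ^ k).trace - 1 := by
    simp only [Matrix.trace, Matrix.diag]
    rw [← Finset.add_sum_erase _ _ (Finset.mem_univ x),
      ← Finset.add_sum_erase _ (fun i => (B ^ k) i i) (Finset.mem_univ x)]
    have e2 : ∀ a b c : ℂ, a + b - c = (a - c) + b := by intros; ring
    rw [e2]
    refine (norm_add_le _ _).trans ?_
    have h3 : ‖∑ w ∈ Finset.univ.erase x, (M ^ k) w w‖ ≤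
        ∑ w ∈ Finset.univ.erase x, (B ^ k) w w :=
      (norm_sum_le _ _).trans (Finset.sum_le_sum fun z _ => dom_pow M B h k z z)
    linarith
  rw [← heq, h0, sub_neg_eq_add] at h1
  have h2 := (Complex.re_le_norm _).trans h1
  simp at h2
  linarith

end FlatPath

/-- If `G` contains a `Q`-flat path with infinitely many vertices, then there are
constants `c > 0` and `μ₀ > 0` such that `Leb σ(H_{μQ}) ≥ c` for all `μ ≥ μ₀`;
in particular `Leb σ(H_{μQ})` does not tend to `0` as `μ → ∞`. -/
theorem measure_spectrum_bounded_below_of_infinite_flat_path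
    {d : ℕ} {V : Type} (G : SimpleGraph V) [AddAction (Fin d → ℤ) V]
    -- the action is free
    (hfree : ∀ (n : Fin d → ℤ) (v : V), n +ᵥ v = v → n = 0)
    -- the action preserves adjacency
    (hadj : ∀ (n : Fin d → ℤ) (u v : V), G.Adj u v → G.Adj (n +ᵥ u) (n +ᵥ v))
    -- the graph is locally finite
    (hlocfin : ∀ v : V, {u : V | G.Adj u v}.Finite)
    -- finitely many orbits of vertices
    (hvorb : ∃ F : Finset V, ∀ v : V, ∃ u ∈ F, ∃ n : Fin d → ℤ, v = n +ᵥ u)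
    -- finitely many orbits of edges
    (heorb : ∃ F : Finset (V × V), ∀ u v : V, G.Adj u v →
      ∃ e ∈ F, ∃ n : Fin d → ℤ, u = n +ᵥ e.1 ∧ v = n +ᵥ e.2)
    -- no vertex is adjacent to one of its own translates
    (hnta : ∀ (u : V) (n : Fin d → ℤ), ¬ G.Adj u (n +ᵥ u))
    -- for every pair of vertices there is at most one connecting translate
    (huniq : ∀ (u v : V) (n n' : Fin d → ℤ),
      G.Adj u (n +ᵥ v) → G.Adj u (n' +ᵥ v) → n = n')
    -- `Q` is a periodic potential
    (Q : V → ℝ) (hQ : ∀ (n : Fin d → ℤ) (v : V), Q (n +ᵥ v) = Q v)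
    -- `H μ` is the bounded self-adjoint operator `H_{μQ}` on `ℓ²(V)`
    (H : ℝ → (lp (fun _ : V => ℂ) 2 →L[ℂ] lp (fun _ : V => ℂ) 2))
    (hH : ∀ (μ : ℝ) (ψ : lp (fun _ : V => ℂ) 2) (v : V),
      H μ ψ v = ((μ * Q v : ℝ) : ℂ) * ψ v + ∑' u : {u : V // G.Adj u v}, ψ (u : V))
    (hsa : ∀ μ : ℝ, IsSelfAdjoint (H μ))
    -- `G` contains a `Q`-flat path with infinitely many vertices
    (hflat : ∃ S : Set V, S.Infinite ∧ (∃ a : ℝ, ∀ v ∈ S, Q v = a) ∧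
      (G.induce S).Connected) :
    (∃ c > (0 : ℝ), ∃ μ₀ > (0 : ℝ), ∀ μ ≥ μ₀,
      ENNReal.ofReal c ≤ volume {x : ℝ | (x : ℂ) ∈ spectrum ℂ (H μ)}) ∧
    ¬ Tendsto (fun μ : ℝ => volume {x : ℝ | (x : ℂ) ∈ spectrum ℂ (H μ)})
        atTop (nhds 0) := by
  classical
  obtain ⟨Ω, hfin, E, hE⟩ := FlatPath.exists_equiv hfree hvorb
  have : Fintype Ω := Fintype.ofFinite Ω
  obtain ⟨S, hSinf, ⟨a, hQa⟩, hconn⟩ := hflat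
  have hEs : ∀ n x k, n +ᵥ E.symm (x, k) = E.symm (x, n + k) := by
    intro n x k
    rw [Equiv.eq_symm_apply, hE]
    simp
  have hQE : ∀ v, Q (E.symm ((E v).1, 0)) = Q v := by
    intro v
    rw [← hQ (E v).2, hEs, add_zero]
    simp
  have hadj' : ∀ (n : Fin d → ℤ) (u v : V), G.Adj (n +ᵥ u) (n +ᵥ v) ↔ G.Adj u v := by
    intro n u v
    refine ⟨fun h => ?_, hadj n u v⟩
    simpa using hadj (-n) _ _ h
  let N : Ω → Finset (Ω × (Fin d → ℤ)) := fun x => (hlocfin (E.symm (x, 0))).toFinset.image E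
  have hNmem : ∀ x t, t ∈ N x ↔ G.Adj (E.symm t) (E.symm (x, 0)) := by
    intro x t
    simp only [N, Finset.mem_image, Set.Finite.mem_toFinset, Set.mem_ofPred_eq]
    constructor
    · rintro ⟨u, hu, rfl⟩
      simpa using hu
    · intro h
      exact ⟨_, h, by simp⟩
  have hNadj : ∀ u v, G.Adj u v ↔ ((E u).1, (E u).2 - (E v).2) ∈ N (E v).1 := by
    intro u v
    rw [hNmem, ← hadj' (E v).2 (E.symm _), hEs, hEs]
    simp
  have hNsym : ∀ x y n, (y, n) ∈ N x → (x, -n) ∈ N y := by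
    intro x y n h
    rw [hNmem] at h ⊢
    have := (hadj' (-n) _ _).2 h.symm
    rw [hEs, hEs] at this
    simpa using this
  -- the operator in coordinates
  have hT : ∀ (μ : ℝ) (ψ : lp (fun _ : V => ℂ) 2) (v : V), H μ ψ v =
      ((μ * Q (E.symm ((E v).1, 0)) : ℝ) : ℂ) * ψ v +
        ∑ t ∈ N (E v).1, ψ (E.symm (t.1, t.2 + (E v).2)) := by
    intro μ ψ v
    rw [hH, hQE]
    congr 1
    rw [← Finset.tsum_subtype (N (E v).1) (fun t => ψ (E.symm (t.1, t.2 + (E v).2)))]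
    let e : {u : V // G.Adj u v} ≃ {t // t ∈ N (E v).1} :=
      Equiv.subtypeEquiv (E.trans ((Equiv.refl Ω).prodCongr (Equiv.subRight (E v).2)))
        (fun u => hNadj u v)
    rw [← e.tsum_eq]
    refine tsum_congr fun u => ?_
    have h1 : (e u : Ω × (Fin d → ℤ)) = ((E u).1, (E u).2 - (E v).2) := rfl
    rw [h1]
    simp
  -- two equivalent vertices on the flat path
  obtain ⟨u, hu, v, hv, huv, hEuv⟩ := hSinf.exists_ne_map_eq_of_mapsTo
    (f := fun v => (E v).1) (t := Set.univ) (fun _ _ => Set.mem_univ _) Set.finite_univ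
  set m : Fin d → ℤ := (E v).2 - (E u).2 with hm
  have hm0 : m ≠ 0 := by
    intro h
    apply huv
    apply E.injective
    exact Prod.ext hEuv (sub_eq_zero.1 h).symm
  obtain ⟨s₁, hs₁⟩ := FlatPath.ch_pi m hm0
  let q : Ω → ℝ := fun x => Q (E.symm (x, 0)) - a
  let κ : S → {x // q x = 0} := fun w => ⟨(E (w : V)).1, by
    simp only [q, hQE, hQa _ w.2, sub_self]⟩
  let A : Matrix {x // q x = 0} {x // q x = 0} ℂ :=
    (FlatPath.fl N m s₁).submatrix Subtype.val Subtype.val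
  let B : Matrix {x // q x = 0} {x // q x = 0} ℝ :=
    (FlatPath.fl0 N).submatrix Subtype.val Subtype.val
  have hdom : ∀ x y, ‖A x y‖ ≤ B x y := fun x y => FlatPath.fl_dom N m s₁ x y
  have hwalk : ∀ (w w' : S), (G.induce S).Walk w w' → ∃ k : ℕ,
      ‖(A ^ k) (κ w) (κ w') - FlatPath.ch m s₁ ((E (w' : V)).2 - (E (w : V)).2)‖ ≤
        (B ^ k) (κ w) (κ w') - 1 := by
    intro w w' p
    induction p with
    | nil => exact ⟨0, by simp [FlatPath.ch_zero]⟩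
    | @cons x y z hxy p ih =>
      obtain ⟨k, hk⟩ := ih
      refine ⟨k + 1, ?_⟩
      have h1 : ‖A (κ x) (κ y) - FlatPath.ch m s₁ ((E (y : V)).2 - (E (x : V)).2)‖ ≤
          B (κ x) (κ y) - 1 :=
        FlatPath.fl_step N m s₁ _ _ _ ((hNadj y x).1 hxy.symm)
      have h2 := FlatPath.step_mul A (A ^ k) B (B ^ k) hdom (FlatPath.dom_pow A B hdom k)
        (κ x) (κ y) (κ z) _ _ (FlatPath.ch_norm _ _ _) (FlatPath.ch_norm _ _ _) h1 hk
      rw [← FlatPath.ch_add, ← pow_succ', ← pow_succ'] at h2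
      convert h2 using 4
      abel
  obtain ⟨k, hk⟩ := hwalk ⟨u, hu⟩ ⟨v, hv⟩ (hconn.preconnected _ _).some
  have hκ : κ ⟨v, hv⟩ = κ ⟨u, hu⟩ := Subtype.ext hEuv.symm
  rw [hκ] at hk
  simp only at hk
  rw [← hm, hs₁] at hk
  have htr := FlatPath.trace_ne A ((FlatPath.fl N m 0).submatrix Subtype.val Subtype.val) B
    (by rw [FlatPath.fl_zero]; rfl) hdom k _ hk
  obtain ⟨z₀, η, hη, hinterval⟩ := FlatPath.exists_interval (FlatPath.fl N m) (FlatPath.fl_cont N m)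
    (FlatPath.fl_herm N hNsym m) q s₁ k htr
  have hmain : ∃ c > (0 : ℝ), ∃ μ₀ > (0 : ℝ), ∀ μ ≥ μ₀,
      ENNReal.ofReal c ≤ volume {x : ℝ | (x : ℂ) ∈ spectrum ℂ (H μ)} := by
    refine ⟨2 * η, by positivity, (1 / η) ^ 2 + 1, by positivity, fun μ hμ => ?_⟩
    have hμ0 : 0 < μ := lt_of_lt_of_le (by positivity) hμ
    have hsub : Metric.ball (μ * a + z₀) η ⊆ {x : ℝ | (x : ℂ) ∈ spectrum ℂ (H μ)} := by
      intro x hx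
      rw [Metric.mem_ball, Real.dist_eq] at hx
      have he : 1 / Real.sqrt μ < η := by
        rw [div_lt_comm₀ (Real.sqrt_pos.2 hμ0) hη]
        refine Real.lt_sqrt_of_sq_lt ?_
        linarith
      obtain ⟨s, hs⟩ := hinterval (1 / Real.sqrt μ) (by positivity) he (x - μ * a) (by
        rwa [sub_sub])
      obtain ⟨φ, hφ0, hφ⟩ := Matrix.exists_mulVec_eq_zero_iff.2 hs
      refine FlatPath.mem_spectrum_of_floquet E N (H μ)
        (fun x => ((μ * Q (E.symm (x, 0)) : ℝ) : ℂ)) (hT μ) (FlatPath.ch m s)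
        (FlatPath.ch_add m s) (FlatPath.ch_norm m s) φ hφ0 (x : ℂ) fun y => ?_
      have h1 := congrFun hφ y
      rw [Matrix.add_mulVec, Pi.add_apply, Matrix.mulVec_diagonal, Pi.zero_apply] at h1
      have h2 : (FlatPath.fl N m s).mulVec φ y = ∑ t ∈ N y, FlatPath.ch m s t.2 * φ t.1 := by
        simp only [Matrix.mulVec, dotProduct, FlatPath.fl, Matrix.of_apply, Finset.sum_mul]
        rw [Finset.sum_comm]
        refine Finset.sum_congr rfl fun t _ => ?_
        simp
      have h3 : q y / (1 / Real.sqrt μ) ^ 2 - (x - μ * a) = μ * Q (E.symm (y, 0)) - x := by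
        rw [div_pow, Real.sq_sqrt hμ0.le]
        simp only [q]
        field_simp
        ring
      rw [h2, h3, Complex.ofReal_sub] at h1
      linear_combination h1
    calc ENNReal.ofReal (2 * η) = volume (Metric.ball (μ * a + z₀) η) := by
          rw [Real.volume_ball]
      _ ≤ _ := measure_mono hsub
  refine ⟨hmain, fun hlim => ?_⟩
  obtain ⟨c, hc, μ₀, -, hb⟩ := hmain
  have h0 : ENNReal.ofReal c ≤ 0 := by
    refine ge_of_tendsto hlim ?_
    filter_upwards [eventually_ge_atTop μ₀] with μ hμ using hb μ hμ
  exact absurd (ENNReal.ofReal_pos.2 hc) (not_lt.2 h0)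
end
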